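/- Let Ω be a convex body of class C²₊ in ℝⁿ and ψ ∈ C¹(∂Ω). If ∫_{∂Ω} ψ|∇U|² dH^{n-1} = 0, then -∫_{∂Ω} tr(II_{∂Ω}) ψ² |∇U|² dH^{n-1} - 2∫_{∂Ω} ψ (∇U̇ · ν_Ω)|∇U| dH^{n-1} + 4∫_{∂Ω} ψ² |∇U| dH^{n-1} ≤ ∫_{∂Ω} (II_{∂Ω}^{-1} ∇_{∂Ω}ψ · ∇_{∂Ω}ψ)|∇U|² dH^{n-1}, where U̇ is harmonic in Ω with boundary value U̇ = |∇U|ψ on ∂Ω. -/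

import Mathlib

open MeasureTheory
open scoped InnerProductSpace

/-- The Euclidean Laplacian, as the sum of second derivatives in coordinate directions. -/
noncomputable def lap {n : ℕ} (f : EuclideanSpace ℝ (Fin n) → ℝ)
    (x : EuclideanSpace ℝ (Fin n)) : ℝ :=
  ∑ i : Fin n, fderiv ℝ (fun y => fderiv ℝ f y (EuclideanSpace.single i 1)) x
    (EuclideanSpace.single i 1)

/-- Orthogonal projection onto the tangent space of the hypersurface with unit normal
field `ν` at the point `x`. -/
noncomputable def tproj {n : ℕ} (ν : EuclideanSpace ℝ (Fin n) → EuclideanSpace ℝ (Fin n))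
    (x v : EuclideanSpace ℝ (Fin n)) : EuclideanSpace ℝ (Fin n) :=
  v - ⟪v, ν x⟫_ℝ • ν x

/-- The trace of the second fundamental form `II = Dν` (i.e. of the Weingarten map
restricted to the tangent space) at a boundary point `x`. -/
noncomputable def trII {n : ℕ} (ν : EuclideanSpace ℝ (Fin n) → EuclideanSpace ℝ (Fin n))
    (x : EuclideanSpace ℝ (Fin n)) : ℝ :=
  ∑ i : Fin n, ⟪fderiv ℝ ν x (tproj ν x (EuclideanSpace.single i 1)),
    tproj ν x (EuclideanSpace.single i 1)⟫_ℝ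

/-- The tangential gradient `∇_{∂Ω} ψ` at a boundary point `x`. -/
noncomputable def tgrad {n : ℕ} (ν : EuclideanSpace ℝ (Fin n) → EuclideanSpace ℝ (Fin n))
    (ψ : EuclideanSpace ℝ (Fin n) → ℝ) (x : EuclideanSpace ℝ (Fin n)) :
    EuclideanSpace ℝ (Fin n) :=
  tproj ν x (gradient ψ x)

section Aux
open MeasureTheory Set Filter Topology
open scoped InnerProductSpace ENNReal Pointwise NNReal


/-- One-dimensional Brunn-Minkowski inequality. -/
lemma bm_one {A B C : Set ℝ} (hA : MeasurableSet A) (hB : MeasurableSet B)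
    (hA0 : A.Nonempty) (hB0 : B.Nonempty)
    (h : ∀ a ∈ A, ∀ b ∈ B, (a + b) / 2 ∈ C) :
    volume A + volume B ≤ 2 * volume C := by
  have key : ∀ K ⊆ A, IsCompact K → ∀ L ⊆ B, IsCompact L →
      volume K + volume L ≤ 2 * volume C := by
    have key' : ∀ K ⊆ A, IsCompact K → K.Nonempty → ∀ L ⊆ B, IsCompact L → L.Nonempty →
        volume K + volume L ≤ 2 * volume C := by
      intro K hKA hK hK0 L hLB hL hL0
      set a := sSup K with ha
      set b := sInf L with hb
      have haK : a ∈ K := hK.sSup_mem hK0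
      have hbL : b ∈ L := hL.sInf_mem hL0
      have h1 : volume ((fun x : ℝ => (1/2 : ℝ) * x + b/2) '' K) = ENNReal.ofReal (1/2) * volume K := by
        have : (fun x : ℝ => (1/2 : ℝ) * x + b/2) '' K = (fun x => x + b/2) '' ((1/2 : ℝ) • K) := by
          rw [← image_smul, image_image]; rfl
        rw [this, image_add_right, measure_preimage_add_right, Measure.addHaar_smul]
        simp
      have h2 : volume ((fun x : ℝ => (1/2 : ℝ) * x + a/2) '' L) = ENNReal.ofReal (1/2) * volume L := by
        have : (fun x : ℝ => (1/2 : ℝ) * x + a/2) '' L = (fun x => x + a/2) '' ((1/2 : ℝ) • L) := by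
          rw [← image_smul, image_image]; rfl
        rw [this, image_add_right, measure_preimage_add_right, Measure.addHaar_smul]
        simp
      have h3 : (fun x : ℝ => (1/2 : ℝ) * x + b/2) '' K ⊆ C ∩ Iic ((a+b)/2) := by
        rintro _ ⟨x, hx, rfl⟩
        have hxa : x ≤ a := le_csSup hK.bddAbove hx
        refine ⟨?_, ?_⟩
        · have := h x (hKA hx) b (hLB hbL)
          convert this using 1; ring
        · simp only [mem_Iic]; linarith
      have h4 : (fun x : ℝ => (1/2 : ℝ) * x + a/2) '' L ⊆ C ∩ Ici ((a+b)/2) := by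
        rintro _ ⟨x, hx, rfl⟩
        have hxa : b ≤ x := csInf_le hL.bddBelow hx
        refine ⟨?_, ?_⟩
        · have := h a (hKA haK) x (hLB hx)
          convert this using 1; ring
        · simp only [mem_Ici]; linarith
      have h5 : volume (C ∩ Ici ((a+b)/2)) = volume (C \ Iic ((a+b)/2)) := by
        rw [sdiff_eq, compl_Iic]
        apply measure_congr
        exact (ae_eq_refl C).inter Ioi_ae_eq_Ici.symm
      have h6 : volume C = volume (C ∩ Iic ((a+b)/2)) + volume (C \ Iic ((a+b)/2)) :=
        (measure_inter_add_sdiff C measurableSet_Iic).symm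
      have h7 := measure_mono (μ := volume) h3
      have h8 := measure_mono (μ := volume) h4
      rw [h1] at h7; rw [h2, h5] at h8
      have h9 : ENNReal.ofReal (1/2) * volume K + ENNReal.ofReal (1/2) * volume L ≤ volume C := by
        rw [h6]; exact add_le_add h7 h8
      calc volume K + volume L = 2 * (ENNReal.ofReal (1/2) * volume K + ENNReal.ofReal (1/2) * volume L) := by
            rw [← mul_add, ← mul_assoc]
            have : (2:ℝ≥0∞) * ENNReal.ofReal (1/2) = 1 := by
              rw [show (2:ℝ≥0∞) = ENNReal.ofReal 2 by simp, ← ENNReal.ofReal_mul (by norm_num)]; norm_num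
            rw [this, one_mul]
        _ ≤ _ := by gcongr
    obtain ⟨a0, ha0⟩ := hA0
    obtain ⟨b0, hb0⟩ := hB0
    intro K hKA hK L hLB hL
    have := key' (insert a0 K) (insert_subset ha0 hKA) (hK.insert a0) (insert_nonempty _ _)
      (insert b0 L) (insert_subset hb0 hLB) (hL.insert b0) (insert_nonempty _ _)
    refine le_trans ?_ this
    gcongr <;> exact subset_insert _ _
  rw [hA.measure_eq_iSup_isCompact, hB.measure_eq_iSup_isCompact]

  have e : ∀ S : Set ℝ, (⨆ (K : Set ℝ) (_ : K ⊆ S) (_ : IsCompact K), volume K) =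
      ⨆ (K : Set ℝ) (_ : K ⊆ S ∧ IsCompact K), volume K := by
    intro S; simp only [iSup_and]
  rw [e, e]
  exact ENNReal.biSup_add_biSup_le' (p := fun K => K ⊆ A ∧ IsCompact K)
    (q := fun K => K ⊆ B ∧ IsCompact K) ⟨∅, by simp⟩ ⟨∅, by simp⟩
    (fun K hK L hL => key K hK.1 hK.2 L hL.1 hL.2)

lemma ennreal_amgm {a b c : ℝ≥0∞} (h : a + b ≤ 2 * c) : a * b ≤ c ^ 2 := by
  rcases eq_or_ne c ⊤ with rfl | hc
  · simp
  have hab : a + b ≠ ⊤ := ne_top_of_le_ne_top (by finiteness) h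
  have ha : a ≠ ⊤ := fun h => by simp [h] at hab
  have hb : b ≠ ⊤ := fun h => by simp [h] at hab
  lift a to NNReal using ha
  lift b to NNReal using hb
  lift c to NNReal using hc
  norm_cast at h ⊢
  have h' : (a:ℝ) + b ≤ 2 * c := by exact_mod_cast h
  have : (a:ℝ) * b ≤ c^2 := by
    nlinarith [sq_nonneg ((a:ℝ) - b), a.2, b.2, c.2, NNReal.coe_nonneg a, NNReal.coe_nonneg b]
  exact_mod_cast this

lemma pl_real {f g h : ℝ → ℝ} (hf : Measurable f) (hg : Measurable g) (hh : Measurable h)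
    (hf0 : ∀ x, 0 ≤ f x) (hg0 : ∀ x, 0 ≤ g x) (hh0 : ∀ x, 0 ≤ h x) {k : ℝ}
    (hfk : ∀ x, f x ≤ k) (hgk : ∀ x, g x ≤ k)
    (H : ∀ x y, f x * g y ≤ h ((x + y) / 2) ^ 2) :
    (∫⁻ x, ENNReal.ofReal (f x)) * (∫⁻ x, ENNReal.ofReal (g x))
      ≤ (∫⁻ x, ENNReal.ofReal (h x)) ^ 2 := by
  set A := ⨆ x, f x with hA
  set B := ⨆ x, g x with hB
  have bf : BddAbove (range f) := ⟨k, by rintro _ ⟨x, rfl⟩; exact hfk x⟩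
  have bg : BddAbove (range g) := ⟨k, by rintro _ ⟨x, rfl⟩; exact hgk x⟩
  have hfA : ∀ x, f x ≤ A := fun x => le_ciSup bf x
  have hgB : ∀ x, g x ≤ B := fun x => le_ciSup bg x
  have hA0 : 0 ≤ A := (hf0 0).trans (hfA 0)
  have hB0 : 0 ≤ B := (hg0 0).trans (hgB 0)
  rcases hA0.eq_or_lt with hA1 | hA1
  · have : ∀ x, f x = 0 := fun x => le_antisymm (hA1 ▸ hfA x) (hf0 x)
    simp [this]
  rcases hB0.eq_or_lt with hB1 | hB1
  · have : ∀ x, g x = 0 := fun x => le_antisymm (hB1 ▸ hgB x) (hg0 x)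
    simp [this]
  set D := Real.sqrt (A * B) with hD
  have hD0 : 0 < D := Real.sqrt_pos.2 (mul_pos hA1 hB1)
  have hD2 : D ^ 2 = A * B := Real.sq_sqrt (mul_pos hA1 hB1).le
  have scale : ∀ (q : ℝ → ℝ) (c : ℝ), 0 < c → Measurable q →
      ∫⁻ x, ENNReal.ofReal (q x) = ENNReal.ofReal c * ∫⁻ x, ENNReal.ofReal (q x / c) := by
    intro q c hc hq
    rw [← lintegral_const_mul _ (by fun_prop)]
    congr 1; ext x
    rw [← ENNReal.ofReal_mul hc.le]; congr 1; field_simp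
  have lay : ∀ (q : ℝ → ℝ) (c : ℝ), 0 < c → Measurable q → (∀ x, 0 ≤ q x) →
      ∫⁻ x, ENNReal.ofReal (q x / c) = ∫⁻ t in Ioi 0, volume {x | t < q x / c} := by
    intro q c hc hq hq0
    exact lintegral_eq_lintegral_meas_lt volume (ae_of_all _ fun x => div_nonneg (hq0 x) hc.le)
      (by fun_prop)
  have cut : ∀ (q : ℝ → ℝ) (c : ℝ), 0 < c → (∀ x, q x ≤ c) →
      ∫⁻ t in Ioi 0, volume {x | t < q x / c} = ∫⁻ t in Ioo 0 1, volume {x | t < q x / c} := by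
    intro q c hc hq
    rw [← lintegral_indicator measurableSet_Ioi, ← lintegral_indicator measurableSet_Ioo]
    congr 1; ext t
    by_cases h0 : t ∈ Ioo (0:ℝ) 1
    · rw [indicator_of_mem h0, indicator_of_mem (show t ∈ Ioi 0 from h0.1)]
    · rw [indicator_of_notMem h0]
      by_cases h1 : t ∈ Ioi (0:ℝ)
      · rw [indicator_of_mem h1]
        have h2 : 1 ≤ t := by
          by_contra h3; exact h0 ⟨h1, not_le.1 h3⟩
        have : {x | t < q x / c} = ∅ := by
          ext x; simp only [mem_ofPred_eq, mem_empty_iff_false, iff_false, not_lt]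
          exact ((div_le_one hc).2 (hq x)).trans h2
        rw [this]; simp
      · rw [indicator_of_notMem h1]
  have main : (∫⁻ x, ENNReal.ofReal (f x / A)) + (∫⁻ x, ENNReal.ofReal (g x / B))
      ≤ 2 * ∫⁻ x, ENNReal.ofReal (h x / D) := by
    rw [lay f A hA1 hf hf0, lay g B hB1 hg hg0, lay h D hD0 hh hh0, cut f A hA1 hfA,
      cut g B hB1 hgB]
    have mz : ∀ (q : ℝ → ℝ), Measurable fun t : ℝ => volume {x | t < q x} := by
      intro q
      exact Antitone.measurable (fun s t hst => measure_mono fun x hx => lt_of_le_of_lt hst hx)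
    rw [← lintegral_add_left (mz _)]
    calc ∫⁻ t in Ioo 0 1, (volume {x | t < f x / A} + volume {x | t < g x / B})
        ≤ ∫⁻ t in Ioo 0 1, 2 * volume {x | t < h x / D} := by
          apply setLIntegral_mono' measurableSet_Ioo
          intro t ht
          apply bm_one (measurableSet_lt measurable_const (by fun_prop))
            (measurableSet_lt measurable_const (by fun_prop))
          · obtain ⟨x, hx⟩ := exists_lt_of_lt_ciSup (show t * A < ⨆ x, f x by
              rw [← hA]; nlinarith [ht.2])
            exact ⟨x, by rw [mem_ofPred_eq, lt_div_iff₀ hA1]; exact hx⟩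
          · obtain ⟨x, hx⟩ := exists_lt_of_lt_ciSup (show t * B < ⨆ x, g x by
              rw [← hB]; nlinarith [ht.2])
            exact ⟨x, by rw [mem_ofPred_eq, lt_div_iff₀ hB1]; exact hx⟩
          · intro a ha b hb
            simp only [mem_ofPred_eq] at ha hb ⊢
            rw [lt_div_iff₀ hA1] at ha
            rw [lt_div_iff₀ hB1] at hb
            rw [lt_div_iff₀ hD0]
            have h1 : (t * D) ^ 2 < h ((a + b) / 2) ^ 2 := by
              refine lt_of_lt_of_le ?_ (H a b)
              rw [mul_pow, hD2]
              have : t * A * (t * B) < f a * g b :=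
                mul_lt_mul'' ha hb (mul_nonneg ht.1.le hA0) (mul_nonneg ht.1.le hB0)
              nlinarith
            exact lt_of_pow_lt_pow_left₀ 2 (hh0 _) h1
      _ = 2 * ∫⁻ t in Ioo 0 1, volume {x | t < h x / D} := lintegral_const_mul _ (mz _)
      _ ≤ _ := by
        gcongr
        exact Ioo_subset_Ioi_self
  have fin := ennreal_amgm main
  rw [scale f A hA1 hf, scale g B hB1 hg, scale h D hD0 hh, mul_pow, ← ENNReal.ofReal_pow hD0.le, hD2,
    ENNReal.ofReal_mul hA0]
  calc _ = ENNReal.ofReal A * ENNReal.ofReal B * ((∫⁻ x, ENNReal.ofReal (f x / A)) * 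
        (∫⁻ x, ENNReal.ofReal (g x / B))) := by ring
    _ ≤ _ := by gcongr

lemma pl_one {f g h : ℝ → ℝ≥0∞} (hf : Measurable f) (hg : Measurable g) (hh : Measurable h)
    (H : ∀ x y, f x * g y ≤ h ((x + y) / 2) ^ 2) :
    (∫⁻ x, f x) * (∫⁻ x, g x) ≤ (∫⁻ x, h x) ^ 2 := by
  have tr : ∀ k : ℕ, (∫⁻ x, min (f x) k) * (∫⁻ x, min (g x) k) ≤ (∫⁻ x, h x) ^ 2 := by
    intro k
    have := pl_real (f := fun x => (min (f x) k).toReal) (g := fun x => (min (g x) k).toReal)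
      (h := fun x => (min (h x) k).toReal) (by fun_prop) (by fun_prop) (by fun_prop)
      (fun _ => ENNReal.toReal_nonneg) (fun _ => ENNReal.toReal_nonneg)
      (fun _ => ENNReal.toReal_nonneg) (k := k)
      (fun x => ENNReal.toReal_le_of_le_ofReal (by positivity) (by simp))
      (fun x => ENNReal.toReal_le_of_le_ofReal (by positivity) (by simp))
      (fun x y => by
        rw [← ENNReal.toReal_mul, ← ENNReal.toReal_pow]
        apply ENNReal.toReal_mono
        · have : min (h ((x + y) / 2)) (k:ℝ≥0∞) ≠ ⊤ := ne_top_of_le_ne_top (by simp) (min_le_right _ _)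
          finiteness
        · rcases le_total (h ((x+y)/2)) (k:ℝ≥0∞) with h1 | h1
          · rw [min_eq_left h1]
            exact le_trans (by gcongr <;> exact min_le_left _ _) (H x y)
          · rw [min_eq_right h1, sq]
            gcongr <;> exact min_le_right _ _)
    have e : ∀ q : ℝ → ℝ≥0∞, ∀ x, ENNReal.ofReal ((min (q x) k).toReal) = min (q x) k := by
      intro q x
      exact ENNReal.ofReal_toReal (ne_top_of_le_ne_top (by simp) (min_le_right _ _))
    simp only [e] at this
    refine this.trans ?_
    gcongr; exact min_le_left _ _
  have lim : ∀ q : ℝ → ℝ≥0∞, Measurable q → 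
      Tendsto (fun k : ℕ => ∫⁻ x, min (q x) k) atTop (𝓝 (∫⁻ x, q x)) := by
    intro q hq
    apply lintegral_tendsto_of_tendsto_of_monotone
    · intro n; fun_prop
    · refine ae_of_all _ fun x => ?_
      intro a b hab
      simp only
      gcongr
    · refine ae_of_all _ fun x => ?_
      have := (tendsto_const_nhds (x := q x)).min ENNReal.tendsto_nat_nhds_top
      simpa using this
  rcases eq_or_ne (∫⁻ x, f x) 0 with h0 | h0
  · simp [h0]
  rcases eq_or_ne (∫⁻ x, g x) 0 with h1 | h1
  · simp [h1]
  exact le_of_tendsto' (ENNReal.Tendsto.mul (lim f hf) (Or.inl h0) (lim g hg) (Or.inl h1)) tr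

lemma pl_pi : ∀ (n : ℕ) {f g h : (Fin n → ℝ) → ℝ≥0∞}, Measurable f → Measurable g → Measurable h →
    (∀ x y, f x * g y ≤ h ((1/2 : ℝ) • (x + y)) ^ 2) →
    (∫⁻ x, f x) * (∫⁻ x, g x) ≤ (∫⁻ x, h x) ^ 2 := by
  intro n
  induction n with
  | zero =>
    intro f g h hf hg hh H
    have hv : (volume : Measure (Fin 0 → ℝ)) = Measure.dirac 0 := by
      rw [volume_pi, Measure.pi_of_empty (x := 0)]
    rw [hv, lintegral_dirac, lintegral_dirac, lintegral_dirac]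
    simpa using H 0 0
  | succ n ih =>
    intro f g h hf hg hh H
    have mp := (volume_preserving_piFinSuccAbove (fun _ : Fin (n+1) => ℝ) 0).symm
    have conv : ∀ q : (Fin (n+1) → ℝ) → ℝ≥0∞, Measurable q →
        ∫⁻ x, q x = ∫⁻ y : Fin n → ℝ, ∫⁻ t : ℝ, q (Fin.cons t y) := by
      intro q hq
      rw [← mp.lintegral_comp hq]
      rw [Measure.volume_eq_prod]
      have ec : ∀ (t : ℝ) (y : Fin n → ℝ), (Fin.cons t y : Fin (n+1) → ℝ) =
          (MeasurableEquiv.piFinSuccAbove (fun _ => ℝ) 0).symm (t, y) := by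
        intro t y
        exact (Fin.insertNth_zero' t y).symm
      simp only [ec]
      exact lintegral_prod_symm (μ := (volume : Measure ℝ)) (ν := (volume : Measure (Fin n → ℝ)))
        (fun z => q ((MeasurableEquiv.piFinSuccAbove (fun _ => ℝ) 0).symm z))
        ((hq.comp mp.measurable).aemeasurable)
    have mcons : Measurable fun p : (Fin n → ℝ) × ℝ => (Fin.cons p.2 p.1 : Fin (n+1) → ℝ) := by
      apply measurable_pi_lambda
      intro i
      refine Fin.cases ?_ (fun j => ?_) i
      · simpa using measurable_snd
      · simp only [Fin.cons_succ]; exact (measurable_pi_apply j).comp measurable_fst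
    rw [conv f hf, conv g hg, conv h hh]
    have mq : ∀ q : (Fin (n+1) → ℝ) → ℝ≥0∞, Measurable q →
        Measurable fun y : Fin n → ℝ => ∫⁻ t : ℝ, q (Fin.cons t y) := by
      intro q hq
      exact Measurable.lintegral_prod_right' (f := fun p : (Fin n → ℝ) × ℝ => q (Fin.cons p.2 p.1))
        (hq.comp mcons)
    apply ih (mq f hf) (mq g hg) (mq h hh)
    intro x y
    have ms : ∀ x : Fin n → ℝ, Measurable fun t : ℝ => (Fin.cons t x : Fin (n+1) → ℝ) := fun x =>
      mcons.comp (measurable_prodMk_left)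
    apply pl_one (hf.comp (ms x)) (hg.comp (ms y)) (hh.comp (ms _))
    intro s t
    have := H (Fin.cons s x) (Fin.cons t y)
    have e : (Fin.cons ((s + t) / 2) ((1/2 : ℝ) • (x + y)) : Fin (n+1) → ℝ)
        = (1/2 : ℝ) • ((Fin.cons s x : Fin (n+1) → ℝ) + Fin.cons t y) := by
      ext i
      refine Fin.cases ?_ (fun j => ?_) i
      · simp; ring
      · simp; ring
    rw [← e] at this
    exact this

/-- Prékopa-Leindler inequality (midpoint version) in Euclidean space. -/
lemma prekopa_leindler {n : ℕ} {f g h : EuclideanSpace ℝ (Fin n) → ℝ≥0∞} (hf : Measurable f)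
    (hg : Measurable g) (hh : Measurable h)
    (H : ∀ x y, f x * g y ≤ h ((1/2 : ℝ) • (x + y)) ^ 2) :
    (∫⁻ x, f x) * (∫⁻ x, g x) ≤ (∫⁻ x, h x) ^ 2 := by
  have mp := PiLp.volume_preserving_toLp (Fin n)
  rw [← mp.lintegral_comp hf, ← mp.lintegral_comp hg, ← mp.lintegral_comp hh]
  apply pl_pi n (hf.comp mp.measurable) (hg.comp mp.measurable) (hh.comp mp.measurable)
  intro x y
  exact H _ _


lemma unif_cont_compact {X Y : Type*} [PseudoMetricSpace X] [PseudoMetricSpace Y] [ProperSpace X]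
    {G : X → Y} (hG : Continuous G) {K : Set X} (hK : IsCompact K) {ε : ℝ} (hε : 0 < ε) :
    ∃ δ > 0, ∀ x ∈ K, ∀ y, dist y x ≤ δ → dist (G y) (G x) ≤ ε := by
  have hU := (hK.cthickening (r := 1)).uniformContinuousOn_of_continuous hG.continuousOn
  obtain ⟨δ, hδ, H⟩ := Metric.uniformContinuousOn_iff_le.1 hU ε hε
  refine ⟨min δ 1, by positivity, fun x hx y hy => ?_⟩
  have hxK : ∀ y, dist y x ≤ 1 → y ∈ Metric.cthickening 1 K := fun y hy =>
    Metric.mem_cthickening_of_dist_le y x 1 K hx hy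
  exact H y (hxK y (hy.trans (min_le_right _ _))) x (hxK x (by simp)) (hy.trans (min_le_left _ _))

lemma unif_cont_compact' {X Y : Type*} [PseudoMetricSpace X] [SeminormedAddCommGroup Y] [ProperSpace X]
    {G : X → Y} (hG : Continuous G) {K : Set X} (hK : IsCompact K) {ε : ℝ} (hε : 0 < ε) :
    ∃ δ > 0, ∀ x ∈ K, ∀ y, dist y x ≤ δ → ‖G y - G x‖ ≤ ε := by
  obtain ⟨δ, hδ, H⟩ := unif_cont_compact hG hK hε
  exact ⟨δ, hδ, fun x hx y hy => by rw [← dist_eq_norm]; exact H x hx y hy⟩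

/-- Uniform second order Taylor expansion on compact sets. -/
lemma taylor2 {n : ℕ} {f : EuclideanSpace ℝ (Fin n) → ℝ} (hf : ContDiff ℝ 2 f)
    {K : Set (EuclideanSpace ℝ (Fin n))} (hK : IsCompact K) {ε : ℝ} (hε : 0 < ε) :
    ∃ r > 0, ∀ x ∈ K, ∀ h, ‖h‖ ≤ r →
      |f (x + h) - f x - fderiv ℝ f x h - (1/2) * fderiv ℝ (fderiv ℝ f) x h h| ≤ ε * ‖h‖ ^ 2 := by
  have hf1 : ContDiff ℝ 1 (fderiv ℝ f) := hf.fderiv_right (by norm_num)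
  have hG : Continuous (fderiv ℝ (fderiv ℝ f)) := hf1.continuous_fderiv (by norm_num)
  have hd : Differentiable ℝ f := hf.differentiable (by norm_num)
  have hd1 : Differentiable ℝ (fderiv ℝ f) := hf1.differentiable (by norm_num)
  obtain ⟨δ, hδ, H⟩ := unif_cont_compact' (G := fderiv ℝ (fderiv ℝ f)) hG hK hε
  refine ⟨δ, hδ, fun x hx h hh => ?_⟩
  have h1 : ∀ y ∈ Metric.closedBall x ‖h‖, ‖fderiv ℝ (fderiv ℝ f) y - fderiv ℝ (fderiv ℝ f) x‖ ≤ ε := by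
    intro y hy
    exact H x hx y ((Metric.mem_closedBall.1 hy).trans hh)
  have h2 : ∀ y ∈ Metric.closedBall x ‖h‖,
      ‖fderiv ℝ f y - fderiv ℝ f x - fderiv ℝ (fderiv ℝ f) x (y - x)‖ ≤ ε * ‖y - x‖ := by
    intro y hy
    exact (convex_closedBall x ‖h‖).norm_image_sub_le_of_norm_hasFDerivWithin_le'
      (fun z _ => (hd1 z).hasFDerivAt.hasFDerivWithinAt) h1 (Metric.mem_closedBall_self (norm_nonneg _)) hy
  have h3 := norm_image_sub_le_of_norm_deriv_le_segment_01'
    (f := fun t : ℝ => f (x + t • h) - t * fderiv ℝ f x h - (1/2) * t ^ 2 * fderiv ℝ (fderiv ℝ f) x h h)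
    (f' := fun t : ℝ => fderiv ℝ f (x + t • h) h - fderiv ℝ f x h - t * fderiv ℝ (fderiv ℝ f) x h h)
    (C := ε * ‖h‖ ^ 2) ?_ ?_
  · have e : (f (x + (1:ℝ) • h) - 1 * fderiv ℝ f x h - (1/2) * 1 ^ 2 * fderiv ℝ (fderiv ℝ f) x h h)
      - (f (x + (0:ℝ) • h) - 0 * fderiv ℝ f x h - (1/2) * 0 ^ 2 * fderiv ℝ (fderiv ℝ f) x h h)
      = f (x + h) - f x - fderiv ℝ f x h - (1/2) * fderiv ℝ (fderiv ℝ f) x h h := by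
      simp; ring
    rw [← e]; exact h3
  · intro t ht
    have l1 : HasDerivAt (fun t : ℝ => x + t • h) h t := by
      simpa using ((hasDerivAt_id t).smul_const h).const_add x
    have l2 := (hd (x + t • h)).hasFDerivAt.comp_hasDerivAt t l1
    have l3 := ((hasDerivAt_id t).mul_const (fderiv ℝ f x h))
    have l4 := ((hasDerivAt_pow 2 t).const_mul (1/2)).mul_const (fderiv ℝ (fderiv ℝ f) x h h)
    refine (((l2.sub l3).sub l4).congr_deriv ?_).hasDerivWithinAt
    simp
  · intro t ht
    have hm : x + t • h ∈ Metric.closedBall x ‖h‖ := by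
      rw [Metric.mem_closedBall, dist_eq_norm]
      simp only [add_sub_cancel_left, norm_smul, Real.norm_eq_abs, abs_of_nonneg ht.1]
      nlinarith [norm_nonneg h, ht.2]
    have := h2 _ hm
    simp only [add_sub_cancel_left] at this
    have h5 := ContinuousLinearMap.le_of_opNorm_le _ this h
    simp only [sub_apply, map_smul, smul_apply, smul_eq_mul] at h5
    refine h5.trans ?_
    rw [norm_smul, Real.norm_eq_abs, abs_of_nonneg ht.1]
    have : t ≤ 1 := ht.2.le
    have h6 : 0 ≤ ε * ‖h‖ ^ 2 := by positivity
    nlinarith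

lemma lap_eq {n : ℕ} {f : EuclideanSpace ℝ (Fin n) → ℝ} (hf : ContDiff ℝ 2 f)
    (x : EuclideanSpace ℝ (Fin n)) :
    lap f x = ∑ i : Fin n, fderiv ℝ (fderiv ℝ f) x (EuclideanSpace.single i 1)
      (EuclideanSpace.single i 1) := by
  have hf1 : ContDiff ℝ 1 (fderiv ℝ f) := hf.fderiv_right (by norm_num)
  have hd1 : Differentiable ℝ (fderiv ℝ f) := hf1.differentiable (by norm_num)
  unfold lap
  refine Finset.sum_congr rfl fun i _ => ?_
  have := ((hd1 x).hasFDerivAt.clm_apply (hasFDerivAt_const (EuclideanSpace.single i (1:ℝ)) x)).fderiv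
  rw [this]
  simp

lemma lap_continuous {n : ℕ} {f : EuclideanSpace ℝ (Fin n) → ℝ} (hf : ContDiff ℝ 2 f) :
    Continuous (lap f) := by
  have hf1 : ContDiff ℝ 1 (fderiv ℝ f) := hf.fderiv_right (by norm_num)
  have hG : Continuous (fderiv ℝ (fderiv ℝ f)) := hf1.continuous_fderiv (by norm_num)
  have : lap f = fun x => ∑ i : Fin n, fderiv ℝ (fderiv ℝ f) x (EuclideanSpace.single i 1)
      (EuclideanSpace.single i 1) := funext (lap_eq hf)
  rw [this]; fun_prop

/-- Discrete Laplacian. -/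
noncomputable def dlap {n : ℕ} (r : ℝ) (f : EuclideanSpace ℝ (Fin n) → ℝ)
    (x : EuclideanSpace ℝ (Fin n)) : ℝ :=
  ∑ i : Fin n, (f (x + r • EuclideanSpace.single i 1) + f (x - r • EuclideanSpace.single i 1) - 2 * f x)

lemma dlap_taylor {n : ℕ} {f : EuclideanSpace ℝ (Fin n) → ℝ} (hf : ContDiff ℝ 2 f)
    {K : Set (EuclideanSpace ℝ (Fin n))} (hK : IsCompact K) {ε : ℝ} (hε : 0 < ε) :
    ∃ r0 > 0, ∀ r, 0 < r → r ≤ r0 → ∀ x ∈ K, |dlap r f x - r ^ 2 * lap f x| ≤ ε * r ^ 2 := by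
  obtain ⟨r0, hr0, H⟩ := taylor2 hf hK (ε := ε / (2 * (n + 1))) (by positivity)
  refine ⟨r0, hr0, fun r hr hrr x hx => ?_⟩
  rw [lap_eq hf, Finset.mul_sum, dlap, ← Finset.sum_sub_distrib]
  have key : ∀ i : Fin n, |f (x + r • EuclideanSpace.single i 1) + f (x - r • EuclideanSpace.single i 1) - 2 * f x
      - r ^ 2 * fderiv ℝ (fderiv ℝ f) x (EuclideanSpace.single i 1) (EuclideanSpace.single i 1)|
      ≤ ε / (n + 1) * r ^ 2 := by
    intro i
    have hn : ‖r • (EuclideanSpace.single i 1 : EuclideanSpace ℝ (Fin n))‖ = r := by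
      simp [norm_smul, abs_of_pos hr]
    have h1 := H x hx (r • EuclideanSpace.single i 1) (by rw [hn]; exact hrr)
    have h2 := H x hx (-(r • EuclideanSpace.single i 1)) (by rw [norm_neg, hn]; exact hrr)
    rw [norm_neg] at h2
    rw [hn] at h1 h2
    simp only [map_neg, map_smul, neg_apply, smul_apply,
      smul_eq_mul, ← sub_eq_add_neg, neg_neg, mul_neg] at h1 h2
    rw [abs_le] at *
    have e : ε / (n + 1) * r ^ 2 = 2 * (ε / (2 * (n + 1)) * r ^ 2) := by field_simp
    rw [e]
    constructor <;> nlinarith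
  calc _ ≤ ∑ i : Fin n, ε / (n + 1) * r ^ 2 :=
        (Finset.abs_sum_le_sum_abs _ _).trans (Finset.sum_le_sum fun i _ => key i)
    _ = n * (ε / (n + 1) * r ^ 2) := by simp
    _ = (n / (n + 1)) * (ε * r ^ 2) := by field_simp
    _ ≤ 1 * (ε * r ^ 2) := by
        gcongr
        rw [div_le_one (by positivity)]; linarith
    _ = _ := one_mul _

lemma integral_add_sub_two {n : ℕ} {F G H : EuclideanSpace ℝ (Fin n) → ℝ} (hF : Integrable F)
    (hG : Integrable G) (hH : Integrable H) :
    ∫ x, (F x + G x - 2 * H x) = (∫ x, F x) + (∫ x, G x) - 2 * ∫ x, H x := by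
  have h1 : Integrable fun x => F x + G x := hF.add hG
  rw [integral_sub h1 (hH.const_mul 2), integral_add hF hG, integral_const_mul]

/-- Shifting the discrete Laplacian. -/
lemma dlap_shift {n : ℕ} {f φ : EuclideanSpace ℝ (Fin n) → ℝ} 
    (h : ∀ c, Integrable fun x => f x * φ (x + c)) (r : ℝ) :
    ∫ x, f x * dlap r φ x = ∫ x, dlap r f x * φ x := by
  have h' : ∀ c, Integrable fun x => f (x + c) * φ x := by
    intro c
    have := (h (-c)).comp_add_right c
    simpa using this
  have hs : ∀ c, ∫ x, f x * φ (x + c) = ∫ x, f (x - c) * φ x := by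
    intro c
    have := integral_add_right_eq_self (μ := volume) (fun x => f x * φ (x + c)) (-c)
    rw [← this]
    simp [sub_eq_add_neg]
  have h0 := h 0
  simp only [add_zero] at h0
  simp only [dlap, Finset.mul_sum, Finset.sum_mul]
  rw [integral_finsetSum, integral_finsetSum]
  · refine Finset.sum_congr rfl fun i _ => ?_
    set c := r • (EuclideanSpace.single i 1 : EuclideanSpace ℝ (Fin n))
    have a1 := h c
    have a2 := h (-c)
    have a3 := h' c
    have a4 := h' (-c)
    simp only [← sub_eq_add_neg] at a2 a4
    have e1 : (fun x => f x * (φ (x + c) + φ (x - c) - 2 * φ x)) =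
        fun x => f x * φ (x + c) + f x * φ (x - c) - 2 * (f x * φ x) := by ext; ring
    have e2 : (fun x => (f (x + c) + f (x - c) - 2 * f x) * φ x) =
        fun x => f (x + c) * φ x + f (x - c) * φ x - 2 * (f x * φ x) := by ext; ring
    rw [e1, e2, integral_add_sub_two a1 a2 h0, integral_add_sub_two a3 a4 h0, hs c]
    have := hs (-c)
    simp only [← sub_eq_add_neg, sub_neg_eq_add] at this
    rw [this]; ring
  all_goals
    intro i _
    set c := r • (EuclideanSpace.single i 1 : EuclideanSpace ℝ (Fin n))
    have a1 := h c
    have a2 := h (-c)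
    have a3 := h' c
    have a4 := h' (-c)
    simp only [← sub_eq_add_neg] at a2 a4
  · have e2 : (fun x => (f (x + c) + f (x - c) - 2 * f x) * φ x) =
        fun x => f (x + c) * φ x + f (x - c) * φ x - 2 * (f x * φ x) := by ext; ring
    rw [e2]
    exact (a3.add a4).sub (h0.const_mul 2)
  · have e1 : (fun x => f x * (φ (x + c) + φ (x - c) - 2 * φ x)) =
        fun x => f x * φ (x + c) + f x * φ (x - c) - 2 * (f x * φ x) := by ext; ring
    rw [e1]
    exact (a1.add a2).sub (h0.const_mul 2)


/-- Testing a pointwise (discrete) Laplacian bound against a nonnegative test function. -/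
lemma subharm_test {n : ℕ} {f φ : EuclideanSpace ℝ (Fin n) → ℝ} (hf : LocallyIntegrable f)
    (hφ : ContDiff ℝ 2 φ) (hc : HasCompactSupport φ) (h0 : ∀ x, 0 ≤ φ x) {a : ℝ}
    (H : ∀ ε > 0, ∃ r0 > 0, ∀ r, 0 < r → r ≤ r0 → ∀ x ∈ tsupport φ, (a - ε) * r ^ 2 ≤ dlap r f x) :
    a * ∫ x, φ x ≤ ∫ x, f x * lap φ x := by
  set K := Metric.cthickening 1 (tsupport φ) with hKdef
  have hK : IsCompact K := hc.isCompact.cthickening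
  have hKs : tsupport φ ⊆ K := Metric.self_subset_cthickening _
  have hφc : Continuous φ := hφ.continuous
  have hφi : Integrable φ := hφc.integrable_of_hasCompactSupport hc
  have hfK : IntegrableOn f K := hf.integrableOn_isCompact hK
  have hI : ∀ c, Integrable fun x => f x * φ (x + c) := by
    intro c
    have hcc : HasCompactSupport fun x => φ (x + c) := hc.comp_homeomorph (Homeomorph.addRight c)
    have := hf.integrable_smul_left_of_hasCompactSupport (hφc.comp (continuous_id.add_const c)) hcc
    simpa [mul_comm] using this
  have hlc : Continuous (lap φ) := lap_continuous hφ
  have hl0 : ∀ x, x ∉ tsupport φ → lap φ x = 0 := by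
    intro x hx
    rw [lap_eq hφ]
    have h1 : x ∉ tsupport (fderiv ℝ φ) := fun h => hx (tsupport_fderiv_subset ℝ h)
    have h2 : x ∉ tsupport (fderiv ℝ (fderiv ℝ φ)) := fun h => h1 (tsupport_fderiv_subset ℝ h)
    rw [image_eq_zero_of_notMem_tsupport h2]
    simp
  have hIl : Integrable fun x => f x * lap φ x := by
    have hcl : HasCompactSupport (lap φ) := HasCompactSupport.of_support_subset_isCompact hc.isCompact
      (fun x hx => by by_contra h; exact hx (hl0 x h))
    have := hf.integrable_smul_left_of_hasCompactSupport hlc hcl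
    simpa [mul_comm] using this
  have key : ∀ ε > 0, (a - ε) * ∫ x, φ x ≤ (∫ x, f x * lap φ x) + ε * ∫ x in K, |f x| := by
    intro ε hε
    obtain ⟨r1, hr1, H1⟩ := H ε hε
    obtain ⟨r2, hr2, H2⟩ := dlap_taylor hφ hK hε
    set r := min (min r1 r2) 1 with hr
    have hr0 : 0 < r := by positivity
    have hr1' : r ≤ r1 := (min_le_left _ _).trans (min_le_left _ _)
    have hr2' : r ≤ r2 := (min_le_left _ _).trans (min_le_right _ _)
    have hr3' : r ≤ 1 := min_le_right _ _
    have hd0 : ∀ x, x ∉ K → dlap r φ x = 0 := by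
      intro x hx
      have hz : ∀ y, dist x y ≤ 1 → φ y = 0 := by
        intro y hy
        by_contra h
        exact hx (Metric.mem_cthickening_of_dist_le x y 1 _ (subset_tsupport φ h) hy)
      unfold dlap
      apply Finset.sum_eq_zero
      intro i _
      rw [hz _ (by simp [norm_smul, abs_of_pos hr0, hr3']), hz _ (by
        simp [norm_smul, abs_of_pos hr0, hr3']), hz x (by simp)]
      simp
    have hdl : Continuous (dlap r φ) := by
      unfold dlap
      fun_prop
    have hId : Integrable fun x => f x * dlap r φ x := by
      have hcl : HasCompactSupport (dlap r φ) := HasCompactSupport.of_support_subset_isCompact hK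
        (fun x hx => by by_contra h; exact hx (hd0 x h))
      have := hf.integrable_smul_left_of_hasCompactSupport hdl hcl
      simpa [mul_comm] using this
    have hIdf : Integrable fun x => dlap r f x * φ x := by
      have h' : ∀ c, Integrable fun x => f (x + c) * φ x := by
        intro c
        have := (hI (-c)).comp_add_right c
        simpa using this
      simp only [dlap, Finset.sum_mul]
      apply integrable_finsetSum
      intro i _
      set c := r • (EuclideanSpace.single i 1 : EuclideanSpace ℝ (Fin n))
      have a3 := h' c
      have a4 := h' (-c)
      have a0 := h' 0
      simp only [← sub_eq_add_neg, add_zero] at a4 a0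
      have e2 : (fun x => (f (x + c) + f (x - c) - 2 * f x) * φ x) =
          fun x => f (x + c) * φ x + f (x - c) * φ x - 2 * (f x * φ x) := by ext; ring
      rw [e2]
      exact (a3.add a4).sub (a0.const_mul 2)
    have A : (a - ε) * r ^ 2 * ∫ x, φ x ≤ ∫ x, dlap r f x * φ x := by
      rw [← integral_const_mul]
      apply integral_mono (hφi.const_mul _) hIdf
      intro x
      by_cases hx : x ∈ tsupport φ
      · exact mul_le_mul_of_nonneg_right (H1 r hr0 hr1' x hx) (h0 x)
      · simp [image_eq_zero_of_notMem_tsupport hx]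
    rw [← dlap_shift hI r] at A
    have B : ∫ x, f x * dlap r φ x ≤ r ^ 2 * (∫ x, f x * lap φ x) + r ^ 2 * (ε * ∫ x in K, |f x|) := by
      have hfa : Integrable (K.indicator fun x => |f x|) :=
        (show IntegrableOn (fun x => |f x|) K volume from hfK.abs).integrable_indicator hK.measurableSet
      rw [← integral_const_mul, ← integral_indicator hK.measurableSet, ← integral_const_mul,
        ← integral_const_mul, ← integral_add (hIl.const_mul _)
          ((hfa.const_mul _).const_mul _)]
      apply integral_mono hId ((hIl.const_mul _).add
          ((hfa.const_mul _).const_mul _))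
      intro x
      rw [Pi.add_apply]
      beta_reduce
      by_cases hx : x ∈ K
      · rw [indicator_of_mem hx]
        have h1 := H2 r hr0 hr2' x hx
        have h2 : f x * (dlap r φ x - r ^ 2 * lap φ x) ≤ |f x| * (ε * r ^ 2) := by
          refine (le_abs_self _).trans ?_
          rw [abs_mul]; gcongr
        linarith
      · rw [indicator_of_notMem hx, hd0 x hx, hl0 x (fun h => hx (hKs h))]
        simp
    have hr2p : 0 < r ^ 2 := by positivity
    have C := A.trans B
    rw [← mul_add] at C
    have : r ^ 2 * ((a - ε) * ∫ x, φ x) ≤ r ^ 2 * ((∫ x, f x * lap φ x) + ε * ∫ x in K, |f x|) := by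
      linarith
    exact le_of_mul_le_mul_left this hr2p
  set A := ∫ x, φ x
  set B := ∫ x, f x * lap φ x
  set D := ∫ x in K, |f x|
  have l1 : Tendsto (fun ε : ℝ => (a - ε) * A) (𝓝[>] 0) (𝓝 ((a - 0) * A)) :=
    (Continuous.tendsto (by fun_prop) 0).mono_left nhdsWithin_le_nhds
  have l2 : Tendsto (fun ε : ℝ => B + ε * D) (𝓝[>] 0) (𝓝 (B + 0 * D)) :=
    (Continuous.tendsto (by fun_prop) 0).mono_left nhdsWithin_le_nhds
  have := le_of_tendsto_of_tendsto l1 l2 (eventually_nhdsWithin_of_forall fun ε hε => key ε hε)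
  simpa using this

lemma dlap_neg {n : ℕ} (r : ℝ) (f : EuclideanSpace ℝ (Fin n) → ℝ) (x) :
    dlap r (fun y => - f y) x = - dlap r f x := by
  unfold dlap
  rw [← Finset.sum_neg_distrib]
  refine Finset.sum_congr rfl fun i _ => by ring

/-- Green identity against compactly supported test functions. -/
lemma harm_test {n : ℕ} {f φ : EuclideanSpace ℝ (Fin n) → ℝ} (hf : ContDiff ℝ 2 f)
    (hφ : ContDiff ℝ 2 φ) (hc : HasCompactSupport φ) (h0 : ∀ x, 0 ≤ φ x) {a : ℝ}
    (H : ∀ x ∈ tsupport φ, lap f x = a) :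
    ∫ x, f x * lap φ x = a * ∫ x, φ x := by
  have hcont : Continuous f := hf.continuous
  apply le_antisymm
  · have := subharm_test (f := fun x => - f x) (hcont.neg.locallyIntegrable) hφ hc h0 (a := -a) (by
      intro ε hε
      obtain ⟨r0, hr0, h⟩ := dlap_taylor hf hc.isCompact hε
      refine ⟨r0, hr0, fun r hr hrr x hx => ?_⟩
      have := h r hr hrr x hx
      rw [H x hx, abs_le] at this
      rw [dlap_neg]; linarith [this.2])
    simp only [neg_mul, integral_neg] at this
    linarith
  · apply subharm_test hcont.locallyIntegrable hφ hc h0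
    intro ε hε
    obtain ⟨r0, hr0, h⟩ := dlap_taylor hf hc.isCompact hε
    refine ⟨r0, hr0, fun r hr hrr x hx => ?_⟩
    have := h r hr hrr x hx
    rw [H x hx, abs_le] at this
    linarith [this.1]


abbrev EE (n : ℕ) := EuclideanSpace ℝ (Fin n)

lemma haus_const (m : ℕ) : ∃ κ : ℝ≥0, κ ≠ 0 ∧ (μH[(m:ℝ)] : Measure (EE m)) = κ • volume := by
  have h1 : (μH[(m:ℝ)] : Measure (EE m)).IsAddHaarMeasure := by
    have := isAddHaarMeasure_hausdorffMeasure (E := EE m)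
    rwa [finrank_euclideanSpace_fin] at this
  refine ⟨(μH[(m:ℝ)] : Measure (EE m)).addHaarScalarFactor volume, ?_,
    Measure.isAddLeftInvariant_eq_smul _ _⟩
  exact (Measure.addHaarScalarFactor_pos_of_isAddHaarMeasure _ _).ne'

/-- The standard splitting. -/
noncomputable def splitStd (m : ℕ) : EE m × ℝ ≃ₜ EE (m + 1) where
  toFun p := WithLp.toLp 2 (Fin.cons p.2 p.1 : Fin (m+1) → ℝ)
  invFun x := (WithLp.toLp 2 (fun j => x j.succ), x 0)
  left_inv p := by
    ext
    · simp
    · simp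
  right_inv x := by
    ext i
    refine Fin.cases ?_ (fun j => ?_) i <;> simp
  continuous_toFun := by
    apply (PiLp.continuous_toLp 2 _).comp
    apply continuous_pi
    intro i
    refine Fin.cases ?_ (fun j => ?_) i
    · simp only [Fin.cons_zero]; fun_prop
    · simp only [Fin.cons_succ]; fun_prop
  continuous_invFun := by
    fun_prop

lemma splitStd_mp (m : ℕ) : MeasurePreserving (splitStd m) (volume.prod volume) volume := by
  have h1 := (volume_preserving_piFinSuccAbove (fun _ : Fin (m+1) => ℝ) 0).symm
  have h2 : MeasurePreserving (fun p : EE m × ℝ => ((p.2, WithLp.ofLp p.1) : ℝ × (Fin m → ℝ)))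
      (volume.prod volume) (volume.prod volume) := by
    have a := (PiLp.volume_preserving_ofLp (Fin m)).prod (MeasurePreserving.id (volume : Measure ℝ))
    exact Measure.measurePreserving_swap.comp a
  have h3 := (PiLp.volume_preserving_toLp (Fin (m+1))).comp (h1.comp h2)
  have hfun : ⇑(splitStd m) = WithLp.toLp 2 ∘
      ⇑(MeasurableEquiv.piFinSuccAbove (fun _ : Fin (m+1) => ℝ) 0).symm ∘
        fun p : EE m × ℝ => (p.2, p.1.ofLp) := by
    funext p
    have : (MeasurableEquiv.piFinSuccAbove (fun _ : Fin (m+1) => ℝ) 0).symm (p.2, WithLp.ofLp p.1) =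
        (Fin.cons p.2 (WithLp.ofLp p.1) : Fin (m+1) → ℝ) := Fin.insertNth_zero' _ _
    simp only [Function.comp]
    rw [this]; rfl
  rw [hfun]
  exact h3

lemma split_exists {m : ℕ} (e : EE (m+1)) (he : ‖e‖ = 1) :
    ∃ Λ : EE m × ℝ ≃ₜ EE (m + 1), MeasurePreserving Λ (volume.prod volume) volume ∧
      Isometry (fun z => Λ (z, 0)) ∧ ∀ z t, ⟪Λ (z, t), e⟫_ℝ = t := by
  set f : EE (m+1) := EuclideanSpace.single 0 1 with hf
  have hfn : ‖f‖ = 1 := by simp [hf]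
  let R : EE (m+1) ≃ₗᵢ[ℝ] EE (m+1) := (ℝ ∙ (f - e))ᗮ.reflection
  have hR : R f = e := Submodule.reflection_sub (by rw [hfn, he])
  refine ⟨(splitStd m).trans R.toHomeomorph, ?_, ?_, ?_⟩
  · exact R.measurePreserving.comp (splitStd_mp m)
  · apply R.isometry.comp
    apply Isometry.of_dist_eq
    intro x y
    rw [EuclideanSpace.dist_eq, EuclideanSpace.dist_eq, Fin.sum_univ_succ]
    simp [splitStd]
  · intro z t
    have : ((splitStd m).trans R.toHomeomorph) (z, t) = R (splitStd m (z,t)) := rfl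
    rw [this, ← hR, LinearIsometryEquiv.inner_map_map]
    simp [hf, splitStd, EuclideanSpace.inner_single_right]

lemma flat_limit {m : ℕ} {H : EE m × ℝ × ℝ → ℝ} (hH : Continuous H) (hc : HasCompactSupport H) :
    Tendsto (fun s : ℝ => s⁻¹ * ∫ p : EE m × ℝ, (if 0 < p.2 then H (p.1, p.2, p.2 / s) else 0))
      (𝓝[>] 0) (𝓝 (∫ y : EE m, ∫ τ in Ioi (0:ℝ), H (y, 0, τ))) := by
  obtain ⟨M, hM⟩ := hH.bounded_above_of_compact_support hc
  set μ : Measure (EE m × ℝ) := (volume : Measure (EE m)).prod (volume.restrict (Ioi 0)) with hμ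
  -- compact boxes
  obtain ⟨Q, hQ, hQH⟩ : ∃ Q : ℝ, 0 < Q ∧ ∀ y t τ, (Q < ‖y‖ ∨ Q < |t| ∨ Q < |τ|) → H (y, t, τ) = 0 := by
    obtain ⟨Q, hQ⟩ := hc.isCompact.isBounded.exists_norm_le
    refine ⟨|Q| + 1, by positivity, fun y t τ h => ?_⟩
    by_contra h0
    have h1 := hQ (y, t, τ) (subset_tsupport _ h0)
    have h2 := (norm_fst_le (y, t, τ)).trans h1
    have h3 := (norm_snd_le (y, t, τ)).trans h1
    have h4 := (norm_fst_le (t, τ)).trans h3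
    have h5 := (norm_snd_le (t, τ)).trans h3
    simp only [Real.norm_eq_abs] at h2 h4 h5
    have := le_abs_self Q
    rcases h with h | h | h <;> linarith
  have scal : ∀ s : ℝ, 0 < s →
      s⁻¹ * ∫ p : EE m × ℝ, (if 0 < p.2 then H (p.1, p.2, p.2 / s) else 0)
        = ∫ p, H (p.1, s * p.2, p.2) ∂μ := by
    intro s hs
    have i1 : Integrable (fun p : EE m × ℝ => H (p.1, p.2, p.2 / s)) (volume.prod volume) := by
      apply Continuous.integrable_of_hasCompactSupport (by fun_prop)
      apply HasCompactSupport.of_support_subset_isCompact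
        ((isCompact_closedBall (0:EE m) Q).prod (isCompact_closedBall (0:ℝ) Q))
      intro p hp
      by_contra h
      apply hp
      apply hQH
      simp only [mem_prod, mem_closedBall_zero_iff, not_and_or, not_le, Real.norm_eq_abs] at h
      rcases h with h | h
      · exact Or.inl h
      · exact Or.inr (Or.inl h)
    have i2 : Integrable (fun p : EE m × ℝ => H (p.1, s * p.2, p.2)) (volume.prod volume) := by
      apply Continuous.integrable_of_hasCompactSupport (by fun_prop)
      apply HasCompactSupport.of_support_subset_isCompact
        ((isCompact_closedBall (0:EE m) Q).prod (isCompact_closedBall (0:ℝ) Q))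
      intro p hp
      by_contra h
      apply hp
      apply hQH
      simp only [mem_prod, mem_closedBall_zero_iff, not_and_or, not_le, Real.norm_eq_abs] at h
      rcases h with h | h
      · exact Or.inl h
      · exact Or.inr (Or.inr h)
    have i1' : Integrable (fun p : EE m × ℝ => H (p.1, p.2, p.2 / s)) μ := by
      apply i1.mono_measure
      exact Measure.prod_mono le_rfl Measure.restrict_le_self
    have i2' : Integrable (fun p : EE m × ℝ => H (p.1, s * p.2, p.2)) μ := by
      apply i2.mono_measure
      exact Measure.prod_mono le_rfl Measure.restrict_le_self
    have e1 : ∫ p : EE m × ℝ, (if 0 < p.2 then H (p.1, p.2, p.2 / s) else 0)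
        = ∫ p, H (p.1, p.2, p.2 / s) ∂μ := by
      have : μ = (volume.prod volume).restrict (univ ×ˢ Ioi 0) := by
        rw [← Measure.prod_restrict, Measure.restrict_univ]
      rw [this, ← integral_indicator (MeasurableSet.univ.prod measurableSet_Ioi), Measure.volume_eq_prod]
      congr 1; ext p
      simp [indicator_apply]
    rw [e1, hμ, integral_prod _ i1', integral_prod _ i2', ← integral_const_mul]
    congr 1; ext y
    have := integral_comp_mul_left_Ioi (fun t => H (y, t, t / s)) 0 hs
    simp only [mul_zero, smul_eq_mul] at this
    rw [← this]
    congr 1; ext t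
    rw [mul_div_cancel_left₀ _ hs.ne']
  have e2 : ∫ y : EE m, ∫ τ in Ioi (0:ℝ), H (y, 0, τ) = ∫ p, H (p.1, 0, p.2) ∂μ := by
    rw [hμ, integral_prod]
    have : Integrable (fun p : EE m × ℝ => H (p.1, 0, p.2)) (volume.prod volume) := by
      apply Continuous.integrable_of_hasCompactSupport (by fun_prop)
      apply HasCompactSupport.of_support_subset_isCompact
        ((isCompact_closedBall (0:EE m) Q).prod (isCompact_closedBall (0:ℝ) Q))
      intro p hp
      by_contra h
      apply hp
      apply hQH
      simp only [mem_prod, mem_closedBall_zero_iff, not_and_or, not_le, Real.norm_eq_abs] at h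
      rcases h with h | h
      · exact Or.inl h
      · exact Or.inr (Or.inr h)
    apply this.mono_measure
    exact Measure.prod_mono le_rfl Measure.restrict_le_self
  rw [e2]
  have main : Tendsto (fun s : ℝ => ∫ p, H (p.1, s * p.2, p.2) ∂μ) (𝓝[>] 0)
      (𝓝 (∫ p, H (p.1, 0, p.2) ∂μ)) := by
    set B : Set (EE m × ℝ) := Metric.closedBall 0 Q ×ˢ Metric.closedBall 0 Q with hB
    have hBc : IsCompact B := (isCompact_closedBall (0:EE m) Q).prod (isCompact_closedBall (0:ℝ) Q)
    apply tendsto_integral_filter_of_dominated_convergence (B.indicator fun _ => M)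
    · exact Eventually.of_forall fun s => (show Continuous fun p : EE m × ℝ => H (p.1, s * p.2, p.2) by
        fun_prop).aestronglyMeasurable
    · refine Eventually.of_forall fun s => ae_of_all _ fun p => ?_
      by_cases hp : p ∈ B
      · rw [indicator_of_mem hp]; exact hM _
      · rw [indicator_of_notMem hp, hQH]
        · simp
        · simp only [hB, mem_prod, mem_closedBall_zero_iff, not_and_or, not_le, Real.norm_eq_abs] at hp
          rcases hp with h | h
          · exact Or.inl h
          · exact Or.inr (Or.inr h)
    · rw [integrable_indicator_iff hBc.measurableSet]
      have : IntegrableOn (fun _ : EE m × ℝ => M) B (volume.prod volume) :=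
        integrableOn_const (hBc.measure_lt_top.ne)
      exact this.mono_measure (Measure.prod_mono le_rfl Measure.restrict_le_self)
    · refine ae_of_all _ fun p => ?_
      have : Continuous fun s : ℝ => H (p.1, s * p.2, p.2) := by fun_prop
      have := this.tendsto 0
      simp only [zero_mul] at this
      exact this.mono_left nhdsWithin_le_nhds
  refine main.congr' ?_
  filter_upwards [self_mem_nhdsWithin] with s hs
  exact (scal s hs).symm


lemma grad_inner {n : ℕ} {U : EE n → ℝ} (x v : EE n) : ⟪gradient U x, v⟫_ℝ = fderiv ℝ U x v := by
  rw [gradient]; simp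

lemma grad_cont {n : ℕ} {U : EE n → ℝ} (hU : ContDiff ℝ 1 U) : Continuous (gradient U) := by
  have := hU.continuous_fderiv (by norm_num)
  have h2 : gradient U = fun x => (InnerProductSpace.toDual ℝ (EE n)).symm (fderiv ℝ U x) := rfl
  rw [h2]; exact (LinearIsometryEquiv.continuous _).comp this

lemma chart_exists {m : ℕ} {Ω : Set (EE (m+1))} (hΩc : IsClosed Ω)
    (hcl : frontier Ω ⊆ closure (interior Ω)) {U : EE (m+1) → ℝ} (hU : ContDiff ℝ 1 U)
    (hpos : ∀ x ∈ interior Ω, 0 < U x) (h0 : ∀ x ∈ frontier Ω, U x = 0) {y0 : EE (m+1)}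
    (hy0 : y0 ∈ frontier Ω) (hg : gradient U y0 ≠ 0) {K : ℝ≥0} (hK : 1 < K) :
    ∃ (e : EE (m+1)) (Ψ : OpenPartialHomeomorph (EE (m+1)) (EE (m+1))),
      ‖e‖ = 1 ∧ y0 ∈ Ψ.source ∧ (∀ x, ⟪Ψ x, e⟫_ℝ = U x / ‖gradient U y0‖) ∧
      Bornology.IsBounded Ψ.target ∧ LipschitzOnWith K Ψ Ψ.source ∧
      LipschitzOnWith K Ψ.symm Ψ.target ∧ Differentiable ℝ Ψ ∧
      Continuous (fun x => |(fderiv ℝ Ψ x).det|) ∧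
      (∀ x ∈ Ψ.source, (K:ℝ)⁻¹ ≤ |(fderiv ℝ Ψ x).det| ∧ |(fderiv ℝ Ψ x).det| ≤ K ∧
        ‖gradient U x‖ ≤ K * ‖gradient U y0‖ ∧ ‖gradient U y0‖ ≤ K * ‖gradient U x‖) ∧
      (∀ x ∈ Ψ.source, x ∈ interior Ω ↔ 0 < U x) ∧ (∀ x ∈ Ψ.source, x ∈ frontier Ω ↔ U x = 0) := by
  have hgc := grad_cont hU
  set g0 := ‖gradient U y0‖ with hg0
  have hg0p : 0 < g0 := norm_pos_iff.2 hg
  set e := g0⁻¹ • gradient U y0 with he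
  have hen : ‖e‖ = 1 := by
    rw [he, norm_smul, norm_inv, Real.norm_eq_abs, abs_of_pos hg0p, ← hg0, inv_mul_cancel₀ hg0p.ne']
  set F : EE (m+1) → EE (m+1) := fun x => x + (U x / g0 - ⟪x, e⟫_ℝ) • e with hF
  have hFe : ∀ x, ⟪F x, e⟫_ℝ = U x / g0 := by
    intro x
    simp only [hF, inner_add_left, inner_smul_left, real_inner_self_eq_norm_sq, hen]
    simp
  have hFc : ContDiff ℝ 1 F := by
    apply contDiff_id.add
    have h1 : ContDiff ℝ 1 fun x => U x / g0 - ⟪x, e⟫_ℝ :=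
      (hU.div_const _).sub (contDiff_id.inner ℝ contDiff_const)
    exact h1.smul contDiff_const
  have hFd : Differentiable ℝ F := hFc.differentiable (by norm_num)
  have hF1 : HasFDerivAt F (ContinuousLinearMap.id ℝ (EE (m+1))) y0 := by
    have hUd : HasFDerivAt U (fderiv ℝ U y0) y0 := (hU.differentiable (by norm_num) y0).hasFDerivAt
    have hi : HasFDerivAt (fun x : EE (m+1) => ⟪x, e⟫_ℝ) (innerSL ℝ e) y0 := by
      have := (innerSL ℝ e).hasFDerivAt (x := y0)
      refine this.congr_of_eventuallyEq (Eventually.of_forall fun x => ?_)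
      simp [real_inner_comm]
    have := (hasFDerivAt_id y0).add (((hUd.const_mul g0⁻¹).sub hi).smul_const e)
    have e2 : F = fun x => id x + (g0⁻¹ * U x - ⟪x, e⟫_ℝ) • e := by
      funext x; simp only [hF, id, div_eq_inv_mul]
    rw [e2]
    refine this.congr_fderiv ?_
    ext v : 1
    simp only [add_apply, ContinuousLinearMap.smulRight_apply, sub_apply, smul_apply, smul_eq_mul, innerSL_apply_apply, he, inner_smul_left, grad_inner]
    simp
  have hF1' : fderiv ℝ F y0 = ContinuousLinearMap.id ℝ (EE (m+1)) := hF1.fderiv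
  have hstrict : HasStrictFDerivAt F (ContinuousLinearEquiv.refl ℝ (EE (m+1)) : EE (m+1) →L[ℝ] EE (m+1)) y0 := by
    have := hFc.contDiffAt.hasStrictFDerivAt (x := y0) (by norm_num)
    rw [hF1'] at this
    exact this
  have hdet : Continuous fun x => |(fderiv ℝ F x).det| :=
    (ContinuousLinearMap.continuous_det.comp (hFc.continuous_fderiv (by norm_num))).abs
  have hKr : (1:ℝ) < K := by exact_mod_cast hK
  have hKi : (K:ℝ)⁻¹ < 1 := inv_lt_one_of_one_lt₀ hKr
  set c : ℝ≥0 := 1 - K⁻¹ with hc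
  have hc' : (c:ℝ) = 1 - (K:ℝ)⁻¹ := by
    rw [hc, NNReal.coe_sub]
    · simp
    · exact_mod_cast hKi.le
  have hcpos : 0 < c := by
    have : (0:ℝ) < c := by rw [hc']; linarith
    exact_mod_cast this
  have hc1 : (c:ℝ) < 1 := by rw [hc']; have : 0 < (K:ℝ)⁻¹ := by positivity
                             linarith
  obtain ⟨s, hs, hap⟩ := hstrict.approximates_deriv_on_nhds (Or.inr hcpos)
  -- open conditions
  have ev : ∀ᶠ x in 𝓝 y0, x ∈ s ∧ ((K:ℝ)⁻¹ < |(fderiv ℝ F x).det| ∧ |(fderiv ℝ F x).det| < K ∧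
        ‖gradient U x‖ < K * g0 ∧ g0 < K * ‖gradient U x‖) := by
    have d0 : |(fderiv ℝ F y0).det| = 1 := by
      rw [hF1']
      simp [ContinuousLinearMap.det]
    refine (show ∀ᶠ x in 𝓝 y0, x ∈ s from hs).and ?_
    have t1 := hdet.tendsto y0
    rw [d0] at t1
    have t2 := hgc.norm.tendsto y0
    rw [← hg0] at t2
    refine (t1.eventually_const_lt hKi).and ((t1.eventually_lt_const hKr).and
      ((t2.eventually_lt_const (by nlinarith)).and ?_))
    exact (t2.const_mul (K:ℝ)).eventually_const_lt (by nlinarith)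
  obtain ⟨N, hN, hNo, hyN⟩ := eventually_nhds_iff.1 ev
  have hap' : ApproximatesLinearOn F (ContinuousLinearEquiv.refl ℝ (EE (m+1)) : EE (m+1) →L[ℝ] EE (m+1)) N c :=
    hap.mono_set (fun x hx => (hN x hx).1)
  have hcc : Subsingleton (EE (m+1)) ∨
      c < ‖((ContinuousLinearEquiv.refl ℝ (EE (m+1))).symm : EE (m+1) →L[ℝ] EE (m+1))‖₊⁻¹ := by
    right
    have : ‖((ContinuousLinearEquiv.refl ℝ (EE (m+1))).symm : EE (m+1) →L[ℝ] EE (m+1))‖₊ = 1 := by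
      have : ((ContinuousLinearEquiv.refl ℝ (EE (m+1))).symm : EE (m+1) →L[ℝ] EE (m+1))
        = ContinuousLinearMap.id ℝ _ := rfl
      rw [this]
      exact NNReal.eq ContinuousLinearMap.norm_id
    rw [this, inv_one]; exact_mod_cast hc1
  set Ψ1 := hap'.toOpenPartialHomeomorph F N hcc hNo with hΨ1
  have hyT : F y0 ∈ Ψ1.target := Ψ1.map_source hyN
  obtain ⟨ρ, hρ, hball⟩ := Metric.isOpen_iff.1 Ψ1.open_target _ hyT
  set B := Metric.ball (F y0) ρ with hB
  set Ψ := (Ψ1.symm.restrOpen B Metric.isOpen_ball).symm with hΨ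
  have hΨF : ∀ x, Ψ x = F x := fun x => rfl
  have htar : Ψ.target = B := by
    simp only [hΨ, OpenPartialHomeomorph.symm_target, OpenPartialHomeomorph.restrOpen_source,
      OpenPartialHomeomorph.symm_source]
    exact inter_eq_right.2 hball
  have hsrc : Ψ.source ⊆ N := by
    intro x hx
    have h1 : Ψ x ∈ B := htar ▸ Ψ.map_source hx
    have h2 : Ψ.symm (Ψ x) = x := Ψ.left_inv hx
    rw [← h2]
    exact Ψ1.map_target (hball h1)
  have hyS : y0 ∈ Ψ.source := by
    have h1 : F y0 ∈ Ψ.target := by rw [htar]; exact Metric.mem_ball_self hρ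
    have h2 := Ψ.map_target h1
    have h3 : Ψ.symm (F y0) = y0 := Ψ1.left_inv hyN
    rwa [h3] at h2
  have bd : ∀ x ∈ N, ∀ y ∈ N, ‖(F x - F y) - (x - y)‖ ≤ c * ‖x - y‖ := by
    intro x hx y hy
    exact hap' x hx y hy
  have hcon := Ψ.continuousOn_symm
  have hIntr : ∀ x ∈ Ψ.source, 0 < U x → x ∈ interior Ω := by
    -- connectivity
    set P : Set (EE (m+1)) := B ∩ {z | 0 < ⟪z, e⟫_ℝ} with hP
    have hPc : IsPreconnected P := by
      apply Convex.isPreconnected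
      apply (convex_ball _ _).inter
      exact convex_halfSpace_gt ⟨fun a b => inner_add_left _ _ _, fun c x => by simp [inner_smul_left]⟩ 0
    have hQc : IsPreconnected (Ψ.symm '' P) := hPc.image _ (hcon.mono (by rw [htar]; exact inter_subset_left))
    have hQ : ∀ x, x ∈ Ψ.symm '' P ↔ x ∈ Ψ.source ∧ 0 < U x := by
      intro x
      constructor
      · rintro ⟨z, ⟨hz, hz2⟩, rfl⟩
        rw [← htar] at hz
        refine ⟨Ψ.map_target hz, ?_⟩
        have h1 : F (Ψ.symm z) = z := Ψ.right_inv hz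
        have h2 := hFe (Ψ.symm z)
        rw [h1] at h2
        have : 0 < U (Ψ.symm z) / g0 := h2 ▸ hz2
        exact (div_pos_iff_of_pos_right hg0p).1 this
      · rintro ⟨hx, hx2⟩
        refine ⟨Ψ x, ⟨htar ▸ Ψ.map_source hx, ?_⟩, Ψ.left_inv hx⟩
        change 0 < ⟪F x, e⟫_ℝ
        rw [hFe]; positivity
    have hsub : Ψ.symm '' P ⊆ interior Ω := by
      apply hQc.subset_left_of_subset_union isOpen_interior hΩc.isOpen_compl
      · exact disjoint_left.2 fun x hx hx2 => hx2 (interior_subset hx)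
      · intro x hx
        by_cases hxi : x ∈ interior Ω
        · exact Or.inl hxi
        · right
          intro hxΩ
          have : x ∈ frontier Ω := ⟨subset_closure hxΩ, hxi⟩
          have h3 := ((hQ x).1 hx).2
          rw [h0 x this] at h3
          exact lt_irrefl _ h3
      · obtain ⟨x, hx1, hx2⟩ := mem_closure_iff.1 (hcl hy0) Ψ.source Ψ.open_source hyS
        exact ⟨x, (hQ x).2 ⟨hx1, hpos x hx2⟩, hx2⟩
    intro x hx hx2
    exact hsub ((hQ x).2 ⟨hx, hx2⟩)
  have hfr : ∀ x ∈ Ψ.source, U x = 0 → x ∈ frontier Ω := by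
    intro x hx hx0
    have hni : x ∉ interior Ω := fun h => by have := hpos x h; rw [hx0] at this; exact lt_irrefl _ this
    refine ⟨?_, hni⟩
    apply closure_mono (interior_subset)
    -- x is a limit of points with U positive
    have hz : F x ∈ B := htar ▸ Ψ.map_source hx
    have t1 : Tendsto (fun t : ℝ => F x + t • e) (𝓝[>] 0) (𝓝 (F x)) := by
      have : Continuous fun t : ℝ => F x + t • e := by fun_prop
      have := this.tendsto 0
      simp only [zero_smul, add_zero] at this
      exact this.mono_left nhdsWithin_le_nhds
    have t2 : Tendsto (fun t : ℝ => Ψ.symm (F x + t • e)) (𝓝[>] 0) (𝓝 x) := by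
      have h1 : ContinuousAt Ψ.symm (F x) := Ψ.continuousAt_symm (htar ▸ hz)
      have h2 : Ψ.symm (F x) = x := Ψ.left_inv hx
      have := h1.tendsto.comp t1
      rw [h2] at this
      exact this
    apply mem_closure_of_tendsto t2
    have t3 := t1.eventually (Metric.isOpen_ball.mem_nhds hz)
    filter_upwards [t3, self_mem_nhdsWithin] with t ht ht0
    have htt : F x + t • e ∈ Ψ.target := by rw [htar]; exact ht
    apply hIntr _ (Ψ.map_target htt)
    have h1 : F (Ψ.symm (F x + t • e)) = F x + t • e := Ψ.right_inv htt
    have h2 := hFe (Ψ.symm (F x + t • e))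
    rw [h1, inner_add_left, hFe, hx0, inner_smul_left, real_inner_self_eq_norm_sq, hen] at h2
    simp at h2
    have : 0 < U (Ψ.symm (F x + t • e)) / g0 := h2 ▸ ht0
    exact (div_pos_iff_of_pos_right hg0p).1 this
  refine ⟨e, Ψ, hen, hyS, hFe, ?_, ?_, ?_, hFd, hdet, ?_, ?_, ?_⟩
  · rw [htar]; exact Metric.isBounded_ball
  · apply LipschitzOnWith.of_dist_le_mul
    intro x hx y hy
    have := bd x (hsrc hx) y (hsrc hy)
    change dist (F x) (F y) ≤ _
    rw [dist_eq_norm, dist_eq_norm]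
    have h1 : ‖F x - F y‖ ≤ ‖(F x - F y) - (x - y)‖ + ‖x - y‖ := by
      simpa using norm_add_le ((F x - F y) - (x - y)) (x - y)
    have h2 : 1 + (c:ℝ) ≤ K := by
      rw [hc']
      have : (K:ℝ) * (K:ℝ)⁻¹ = 1 := mul_inv_cancel₀ (by positivity)
      nlinarith
    nlinarith [norm_nonneg (x - y)]
  · apply LipschitzOnWith.of_dist_le_mul
    intro z hz z' hz'
    have h1 : F (Ψ.symm z) = z := Ψ.right_inv hz
    have h2 : F (Ψ.symm z') = z' := Ψ.right_inv hz'
    have := bd _ (hsrc (Ψ.map_target hz)) _ (hsrc (Ψ.map_target hz'))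
    rw [h1, h2] at this
    rw [dist_eq_norm, dist_eq_norm]
    set a := Ψ.symm z - Ψ.symm z'
    have h3 : ‖a‖ ≤ ‖(z - z') - a‖ + ‖z - z'‖ := by
      have := norm_sub_le (z - z') ((z - z') - a)
      simp only [sub_sub_cancel] at this
      linarith
    have h4 : (K:ℝ)⁻¹ * ‖a‖ ≤ ‖z - z'‖ := by
      rw [hc'] at this
      linarith
    rwa [inv_mul_le_iff₀ (by positivity)] at h4
  · intro x hx
    have := (hN x (hsrc hx)).2
    exact ⟨this.1.le, this.2.1.le, this.2.2.1.le, this.2.2.2.le⟩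
  · exact fun x hx => ⟨hpos x, hIntr x hx⟩
  · exact fun x hx => ⟨h0 x, hfr x hx⟩


structure IsChart {m : ℕ} (Ω : Set (EE (m+1))) (U : EE (m+1) → ℝ) (K : ℝ≥0) (g0 : ℝ)
    (e : EE (m+1)) (Ψ : OpenPartialHomeomorph (EE (m+1)) (EE (m+1))) : Prop where
  g0pos : 0 < g0
  he : ‖e‖ = 1
  hin : ∀ x, ⟪Ψ x, e⟫_ℝ = U x / g0
  hbd : Bornology.IsBounded Ψ.target
  hL : LipschitzOnWith K Ψ Ψ.source
  hL' : LipschitzOnWith K Ψ.symm Ψ.target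
  hd : Differentiable ℝ Ψ
  hJ : Continuous (fun x => |(fderiv ℝ Ψ x).det|)
  hb : ∀ x ∈ Ψ.source, (K:ℝ)⁻¹ ≤ |(fderiv ℝ Ψ x).det| ∧ |(fderiv ℝ Ψ x).det| ≤ K ∧
        ‖gradient U x‖ ≤ K * g0 ∧ g0 ≤ K * ‖gradient U x‖
  hIntr : ∀ x ∈ Ψ.source, x ∈ interior Ω ↔ 0 < U x
  hfr : ∀ x ∈ Ψ.source, x ∈ frontier Ω ↔ U x = 0

/-- the parametrization of the boundary piece and the measure comparison -/
lemma chart_meas {m : ℕ} {Ω : Set (EE (m+1))} {U : EE (m+1) → ℝ} {K : ℝ≥0} {g0 : ℝ}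
    {e : EE (m+1)} {Ψ : OpenPartialHomeomorph (EE (m+1)) (EE (m+1))} (hc : IsChart Ω U K g0 e Ψ)
    {κ : ℝ≥0} (hκ : (μH[(m:ℝ)] : Measure (EE m)) = κ • volume)
    {Λ : EE m × ℝ ≃ₜ EE (m+1)} (hΛi : Isometry (fun z => Λ (z, 0)))
    (hΛe : ∀ z t, ⟪Λ (z, t), e⟫_ℝ = t) :
    ∃ (D : Set (EE m)), D = {y | Λ (y, 0) ∈ Ψ.target} ∧ IsOpen D ∧ volume D < ∞ ∧
      ∃ ν3 : Measure (EE (m+1)), ν3 = Measure.map (fun y => Ψ.symm (Λ (y,0))) (volume.restrict D) ∧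
      AEMeasurable (fun y => Ψ.symm (Λ (y,0))) (volume.restrict D) ∧
      (μH[(m:ℝ)]).restrict (frontier Ω ∩ Ψ.source) ≤ (K ^ m * κ) • ν3 ∧
      κ • ν3 ≤ (K ^ m) • (μH[(m:ℝ)]).restrict (frontier Ω ∩ Ψ.source) := by
  have hΛc : Continuous (fun z : EE m => Λ (z, 0)) := hΛi.continuous
  set D : Set (EE m) := {y | Λ (y, 0) ∈ Ψ.target} with hD
  have hDo : IsOpen D := Ψ.open_target.preimage hΛc
  have hDb : Bornology.IsBounded D := by
    exact hΛi.antilipschitz.isBounded_preimage hc.hbd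
  set σ : EE m → EE (m+1) := fun y => Ψ.symm (Λ (y,0)) with hσ
  have hσc : ContinuousOn σ D := Ψ.continuousOn_symm.comp hΛc.continuousOn (fun y hy => hy)
  have hσm : AEMeasurable σ (volume.restrict D) := hσc.aemeasurable hDo.measurableSet
  have hfc : IsClosed (frontier Ω) := isClosed_frontier
  have hSm : MeasurableSet (frontier Ω ∩ Ψ.source) :=
    hfc.measurableSet.inter Ψ.open_source.measurableSet
  have hσS : ∀ y ∈ D, σ y ∈ frontier Ω ∩ Ψ.source := by
    intro y hy
    have h1 : σ y ∈ Ψ.source := Ψ.map_target hy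
    refine ⟨(hc.hfr _ h1).2 ?_, h1⟩
    have h2 := hc.hin (σ y)
    have h3 : Ψ (σ y) = Λ (y, 0) := Ψ.right_inv hy
    rw [h3, hΛe] at h2
    have := (div_eq_zero_iff.1 h2.symm)
    exact this.resolve_right hc.g0pos.ne'
  have hsurj : ∀ x ∈ frontier Ω ∩ Ψ.source, ∃ y ∈ D, Λ (y, 0) = Ψ x ∧ σ y = x := by
    rintro x ⟨hx1, hx2⟩
    have h0 := (hc.hfr x hx2).1 hx1
    have h2 := hc.hin x
    rw [h0, zero_div] at h2
    obtain ⟨p, hp⟩ := Λ.surjective (Ψ x)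
    have h3 : p.2 = 0 := by rw [← hΛe p.1 p.2, Prod.mk.eta, hp, h2]
    have h4 : Λ (p.1, 0) = Ψ x := by rw [← h3, Prod.mk.eta, hp]
    refine ⟨p.1, ?_, h4, ?_⟩
    · change Λ (p.1, 0) ∈ Ψ.target
      rw [h4]; exact Ψ.map_source hx2
    · change Ψ.symm (Λ (p.1, 0)) = x
      rw [h4]; exact Ψ.left_inv hx2
  have hm0 : (0:ℝ) ≤ m := Nat.cast_nonneg m
  have hσL : LipschitzOnWith K σ D := by
    have := hc.hL'.comp (f := fun z : EE m => Λ (z,0)) (hΛi.lipschitz.lipschitzOnWith (s := D)) (fun y hy => hy)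
    rw [mul_one] at this
    exact this
  have key : ∀ A : Set (EE (m+1)), MeasurableSet A →
      Measure.map σ (volume.restrict D) A = volume (σ ⁻¹' A ∩ D) := by
    intro A hA
    rw [Measure.map_apply_of_aemeasurable hσm hA, Measure.restrict_apply₀']
    exact hDo.measurableSet.nullMeasurableSet
  refine ⟨D, rfl, hDo, hDb.measure_lt_top, Measure.map σ (volume.restrict D), rfl, hσm, ?_, ?_⟩
  · rw [Measure.le_iff]
    intro A hA
    rw [Measure.restrict_apply hA, Measure.smul_apply, key A hA]
    have e1 : A ∩ (frontier Ω ∩ Ψ.source) ⊆ σ '' (σ ⁻¹' A ∩ D) := by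
      rintro x ⟨hxA, hx⟩
      obtain ⟨y, hy, -, hyx⟩ := hsurj x hx
      exact ⟨y, ⟨by rw [mem_preimage, hyx]; exact hxA, hy⟩, hyx⟩
    refine (measure_mono e1).trans ?_
    refine ((hσL.mono inter_subset_right).hausdorffMeasure_image_le hm0).trans ?_
    rw [hκ, Measure.smul_apply]
    simp only [ENNReal.smul_def, smul_eq_mul, ENNReal.rpow_natCast]
    push_cast
    rw [mul_assoc]
  · rw [Measure.le_iff]
    intro A hA
    rw [Measure.smul_apply, Measure.smul_apply, Measure.restrict_apply hA, key A hA]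
    have e2 : κ • volume (σ ⁻¹' A ∩ D) = μH[(m:ℝ)] (σ ⁻¹' A ∩ D) := by
      rw [hκ, Measure.smul_apply]
    rw [e2, ← hΛi.hausdorffMeasure_image (Or.inl hm0)]
    have e1 : (fun z => Λ (z, 0)) '' (σ ⁻¹' A ∩ D) ⊆ Ψ '' (A ∩ (frontier Ω ∩ Ψ.source)) := by
      rintro _ ⟨y, ⟨hy1, hy2⟩, rfl⟩
      exact ⟨σ y, ⟨hy1, hσS y hy2⟩, Ψ.right_inv hy2⟩
    refine (measure_mono e1).trans ?_
    refine ((hc.hL.mono (fun x hx => hx.2.2)).hausdorffMeasure_image_le hm0).trans ?_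
    simp only [ENNReal.smul_def, smul_eq_mul, ENNReal.rpow_natCast]
    push_cast
    rfl


lemma chart_flat {m : ℕ} {Ω : Set (EE (m+1))} {U : EE (m+1) → ℝ} {K : ℝ≥0} (hK : 1 < K) {g0 : ℝ}
    {e : EE (m+1)} {Ψ : OpenPartialHomeomorph (EE (m+1)) (EE (m+1))} (hc : IsChart Ω U K g0 e Ψ)
    {Λ : EE m × ℝ ≃ₜ EE (m+1)} (hΛm : MeasurePreserving Λ (volume.prod volume) volume)
    (hΛe : ∀ z t, ⟪Λ (z, t), e⟫_ℝ = t)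
    {F : EE (m+1) → ℝ → ℝ} (hF : Continuous (Function.uncurry F)) {C : Set (EE (m+1))}
    (hCc : IsCompact C) (hCs : C ⊆ Ψ.source) (hFC : ∀ x ∉ C, ∀ t, F x t = 0) {T : ℝ} (hT : 0 < T)
    (hFT : ∀ x t, T ≤ |t| → F x t = 0) :
    Tendsto (fun s : ℝ => s⁻¹ * ∫ x in interior Ω, F x (U x / s)) (𝓝[>] 0)
      (𝓝 (∫ y in {y | Λ (y, 0) ∈ Ψ.target}, (∫ t in (0:ℝ)..T, F (Ψ.symm (Λ (y,0))) t) /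
        (|(fderiv ℝ Ψ (Ψ.symm (Λ (y,0)))).det| * g0))) := by
  classical
  have hg0 := hc.g0pos
  set J : EE (m+1) → ℝ := fun x => |(fderiv ℝ Ψ x).det| with hJ
  have hJc : Continuous J := hc.hJ
  have hJp : ∀ x ∈ Ψ.source, 0 < J x := fun x hx =>
    lt_of_lt_of_le (by have : (0:ℝ) < K := by exact_mod_cast (zero_lt_one.trans hK)
                       positivity) (hc.hb x hx).1
  set G : EE (m+1) × ℝ → ℝ := fun q =>
    if q.1 ∈ Ψ.target then F (Ψ.symm q.1) (g0 * q.2) / J (Ψ.symm q.1) else 0 with hG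
  set C' : Set (EE (m+1)) := Ψ '' C with hC'
  have hC'c : IsCompact C' := hCc.image_of_continuousOn (Ψ.continuousOn.mono hCs)
  have hC't : C' ⊆ Ψ.target := by rintro _ ⟨x, hx, rfl⟩; exact Ψ.map_source (hCs hx)
  have hGz : ∀ q : EE (m+1) × ℝ, q ∉ C' ×ˢ Icc (-(T/g0)) (T/g0) → G q = 0 := by
    intro q hq
    simp only [hG]
    split_ifs with h
    · by_cases h1 : q.1 ∈ C'
      · have h2 : q.2 ∉ Icc (-(T/g0)) (T/g0) := fun h2 => hq ⟨h1, h2⟩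
        rw [hFT, zero_div]
        rw [abs_mul, abs_of_pos hg0]
        have h3 : T / g0 < |q.2| := by
          by_contra hh
          exact h2 (abs_le.1 (not_lt.1 hh))
        rw [div_lt_iff₀ hg0] at h3
        linarith
      · rw [hFC, zero_div]
        intro h2
        exact h1 ⟨_, h2, Ψ.right_inv h⟩
    · rfl
  have hcpt : IsCompact (C' ×ˢ Icc (-(T/g0)) (T/g0)) := hC'c.prod isCompact_Icc
  have hGs : HasCompactSupport G := HasCompactSupport.intro hcpt hGz
  have hGts : tsupport G ⊆ Ψ.target ×ˢ univ := by
    have : tsupport G ⊆ C' ×ˢ Icc (-(T/g0)) (T/g0) := by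
      apply closure_minimal _ hcpt.isClosed
      intro q hq
      by_contra h
      exact hq (hGz q h)
    exact this.trans (prod_mono hC't (subset_univ _))
  have hGc : Continuous G := by
    apply ContinuousOn.continuous_of_tsupport_subset (s := Ψ.target ×ˢ univ) _
      (Ψ.open_target.prod isOpen_univ) hGts
    have h1 : ContinuousOn (fun q : EE (m+1) × ℝ => Ψ.symm q.1) (Ψ.target ×ˢ univ) :=
      Ψ.continuousOn_symm.comp continuousOn_fst (fun q hq => hq.1)
    have h2 : ContinuousOn (fun q : EE (m+1) × ℝ => F (Ψ.symm q.1) (g0 * q.2) / J (Ψ.symm q.1))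
        (Ψ.target ×ˢ univ) := by
      apply ContinuousOn.div
      · exact hF.comp_continuousOn (h1.prodMk (continuous_const.mul continuous_snd).continuousOn)
      · exact hJc.comp_continuousOn h1
      · intro q hq
        exact (hJp _ (Ψ.map_target hq.1)).ne'
    refine h2.congr ?_
    intro q hq
    simp only [hG]
    rw [if_pos hq.1]
  set A : EE m × ℝ × ℝ ≃ₜ EE (m+1) × ℝ :=
    (Homeomorph.prodAssoc (EE m) ℝ ℝ).symm.trans (Λ.prodCongr (Homeomorph.refl ℝ)) with hA
  have hAv : ∀ y t τ, A (y, t, τ) = (Λ (y, t), τ) := fun y t τ => rfl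
  have hH : Continuous (G ∘ A) := hGc.comp A.continuous
  have hHc : HasCompactSupport (G ∘ A) := hGs.comp_homeomorph A
  have lim := flat_limit hH hHc
  have e1 : ∀ s : ℝ, 0 < s → (∫ p : EE m × ℝ, (if 0 < p.2 then (G ∘ A) (p.1, p.2, p.2 / s) else 0))
      = ∫ x in interior Ω, F x (U x / s) := by
    intro s hs
    have h1 : (∫ p : EE m × ℝ, (if 0 < p.2 then (G ∘ A) (p.1, p.2, p.2 / s) else 0))
        = ∫ p : EE m × ℝ, (fun z => if 0 < ⟪z, e⟫_ℝ then G (z, ⟪z, e⟫_ℝ / s) else 0) (Λ p) := by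
      congr 1
      funext p
      have : ⟪Λ p, e⟫_ℝ = p.2 := hΛe p.1 p.2
      simp only [Function.comp, hAv, this]
    rw [h1, show (volume : Measure (EE m × ℝ)) = volume.prod volume from rfl,
      hΛm.integral_comp Λ.measurableEmbedding
      (fun z => if 0 < ⟪z, e⟫_ℝ then G (z, ⟪z, e⟫_ℝ / s) else 0)]
    have h2 : (∫ z, (if 0 < ⟪z, e⟫_ℝ then G (z, ⟪z, e⟫_ℝ / s) else 0))
        = ∫ z in Ψ '' Ψ.source, (if 0 < ⟪z, e⟫_ℝ then G (z, ⟪z, e⟫_ℝ / s) else 0) := by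
      symm
      apply setIntegral_eq_integral_of_forall_compl_eq_zero
      intro z hz
      rw [Ψ.image_source_eq_target] at hz
      simp only [hG, if_neg hz, ite_self]
    rw [h2, integral_image_eq_integral_abs_det_fderiv_smul volume Ψ.open_source.measurableSet
      (fun x _ => (hc.hd x).hasFDerivAt.hasFDerivWithinAt) Ψ.injOn]
    have h3 : ∀ x ∈ Ψ.source, |(fderiv ℝ Ψ x).det| •
        (if 0 < ⟪Ψ x, e⟫_ℝ then G (Ψ x, ⟪Ψ x, e⟫_ℝ / s) else 0)
        = (interior Ω).indicator (fun x => F x (U x / s)) x := by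
      intro x hx
      rw [hc.hin]
      by_cases hU : 0 < U x
      · rw [if_pos (by positivity), indicator_of_mem ((hc.hIntr x hx).2 hU)]
        simp only [hG]
        rw [if_pos (Ψ.map_source hx), Ψ.left_inv hx, smul_eq_mul]
        change J x * _ = _
        rw [mul_div_cancel₀ _ (hJp x hx).ne']
        congr 1
        field_simp
      · rw [if_neg, indicator_of_notMem (fun h => hU ((hc.hIntr x hx).1 h)), smul_zero]
        rwa [div_pos_iff_of_pos_right hg0]
    rw [setIntegral_congr_fun Ψ.open_source.measurableSet h3]
    rw [setIntegral_eq_integral_of_forall_compl_eq_zero, integral_indicator isOpen_interior.measurableSet]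
    intro x hx
    rw [indicator_apply]
    split_ifs
    · exact hFC x (fun h => hx (hCs h)) _
    · rfl
  have e2 : (∫ y : EE m, ∫ τ in Ioi (0:ℝ), (G ∘ A) (y, 0, τ))
      = ∫ y in {y | Λ (y, 0) ∈ Ψ.target}, (∫ t in (0:ℝ)..T, F (Ψ.symm (Λ (y,0))) t) /
        (|(fderiv ℝ Ψ (Ψ.symm (Λ (y,0)))).det| * g0) := by
    have hDm : MeasurableSet {y | Λ (y, 0) ∈ Ψ.target} :=
      (Ψ.open_target.preimage (Λ.continuous.comp (by fun_prop : Continuous fun y : EE m => (y, (0:ℝ))))).measurableSet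
    rw [← integral_indicator hDm]
    congr 1
    funext y
    rw [indicator_apply]
    simp only [Function.comp, hAv]
    split_ifs with h
    · have h' : Λ (y, 0) ∈ Ψ.target := h
      simp only [hG, if_pos h']
      rw [integral_div]
      have h4 := integral_comp_mul_left_Ioi (fun t => F (Ψ.symm (Λ (y,0))) t) 0 hg0
      rw [h4, mul_zero]
      have h5 : ∫ t in Ioi (0:ℝ), F (Ψ.symm (Λ (y,0))) t = ∫ t in (0:ℝ)..T, F (Ψ.symm (Λ (y,0))) t := by
        rw [intervalIntegral.integral_of_le hT.le]
        apply setIntegral_eq_of_subset_of_forall_sdiff_eq_zero measurableSet_Ioi Ioc_subset_Ioi_self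
        intro t ht
        apply hFT
        have h6 : 0 < t := ht.1
        rw [abs_of_pos h6]
        by_contra h7
        exact ht.2 ⟨h6, (not_le.1 h7).le⟩
      rw [h5, smul_eq_mul]
      have := (hJp _ (Ψ.map_target h')).ne'
      change _ / J (Ψ.symm (Λ (y, 0))) = _ / (J (Ψ.symm (Λ (y, 0))) * g0)
      field_simp
    · have h' : Λ (y, 0) ∉ Ψ.target := h
      simp only [hG, if_neg h']
      simp
  rw [← e2]
  refine lim.congr' ?_
  filter_upwards [self_mem_nhdsWithin] with s hs
  rw [e1 s hs]

lemma chart_limit {m : ℕ} {Ω : Set (EE (m+1))} {U : EE (m+1) → ℝ} (hU : ContDiff ℝ 1 U)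
    {K : ℝ≥0} (hK : 1 < K) {g0 : ℝ}
    {e : EE (m+1)} {Ψ : OpenPartialHomeomorph (EE (m+1)) (EE (m+1))} (hc : IsChart Ω U K g0 e Ψ)
    {κ : ℝ≥0} (hκ : (μH[(m:ℝ)] : Measure (EE m)) = κ • volume) :
    (μH[(m:ℝ)]) (frontier Ω ∩ Ψ.source) < ∞ ∧
    ∀ F : EE (m+1) → ℝ → ℝ, Continuous (Function.uncurry F) → (∀ x t, 0 ≤ F x t) →
      ∀ C : Set (EE (m+1)), IsCompact C → C ⊆ Ψ.source → (∀ x ∉ C, ∀ t, F x t = 0) →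
      ∀ T : ℝ, 0 < T → (∀ x t, T ≤ |t| → F x t = 0) →
      ∃ ℓ : ℝ, Tendsto (fun s : ℝ => s⁻¹ * ∫ x in interior Ω, F x (U x / s)) (𝓝[>] 0) (𝓝 ℓ) ∧
        κ * ℓ ≤ K ^ (m+2) * ∫ x in frontier Ω, (∫ t in (0:ℝ)..T, F x t) / ‖gradient U x‖ ∂μH[(m:ℝ)] ∧
        ∫ x in frontier Ω, (∫ t in (0:ℝ)..T, F x t) / ‖gradient U x‖ ∂μH[(m:ℝ)]
          ≤ K ^ (m+2) * (κ * ℓ) := by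
  obtain ⟨Λ, hΛm, hΛi, hΛe⟩ := split_exists e hc.he
  obtain ⟨D, hD, hDo, hDf, ν3, hν3, hσm, hle1, hle2⟩ := chart_meas hc hκ hΛi hΛe
  have hDfin : IsFiniteMeasure (volume.restrict D) := ⟨by rwa [Measure.restrict_apply_univ]⟩
  have hν3f : IsFiniteMeasure ν3 := by rw [hν3]; infer_instance
  set ν1 := (μH[(m:ℝ)]).restrict (frontier Ω ∩ Ψ.source) with hν1
  have hν1f : IsFiniteMeasure ν1 := by
    have : IsFiniteMeasure ((K ^ m * κ) • ν3) := inferInstance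
    exact isFiniteMeasure_of_le _ hle1
  have hKr : (1:ℝ) < K := by exact_mod_cast hK
  have hK0 : (0:ℝ) < K := by linarith
  refine ⟨?_, ?_⟩
  · have := measure_lt_top ν1 univ
    rwa [hν1, Measure.restrict_apply_univ] at this
  intro F hF hF0 C hCc hCs hFC T hT hFT
  have hgc := grad_cont hU
  have lim := chart_flat hK hc hΛm hΛe hF hCc hCs hFC hT hFT
  rw [← hD] at lim
  set Φ : EE (m+1) → ℝ := fun x => ∫ t in (0:ℝ)..T, F x t with hΦ
  have hΦc : Continuous Φ := intervalIntegral.continuous_parametric_intervalIntegral_of_continuous' hF 0 T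
  have hΦ0 : ∀ x, 0 ≤ Φ x := fun x => intervalIntegral.integral_nonneg hT.le (fun t _ => hF0 x t)
  have hΦC : ∀ x ∉ C, Φ x = 0 := by
    intro x hx
    simp only [hΦ, hFC x hx]
    simp
  obtain ⟨M, hM⟩ := hΦc.bounded_above_of_compact_support (HasCompactSupport.intro hCc hΦC)
  set f1 : EE (m+1) → ℝ := fun x => Φ x / ‖gradient U x‖ with hf1
  set f2 : EE (m+1) → ℝ := fun x => Φ x / (|(fderiv ℝ Ψ x).det| * g0) with hf2
  have hg0 := hc.g0pos
  have hf1m : Measurable f1 := hΦc.measurable.div hgc.norm.measurable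
  have hf2m : Measurable f2 := hΦc.measurable.div (hc.hJ.measurable.mul_const _)
  have hf10 : ∀ x, 0 ≤ f1 x := fun x => div_nonneg (hΦ0 x) (norm_nonneg _)
  have hf20 : ∀ x, 0 ≤ f2 x := fun x => div_nonneg (hΦ0 x) (by positivity)
  have hcmp : ∀ x, f1 x ≤ K ^ 2 * f2 x ∧ f2 x ≤ K ^ 2 * f1 x ∧ f1 x ≤ M * K / g0 := by
    intro x
    by_cases hx : x ∈ C
    · obtain ⟨b1, b2, b3, b4⟩ := hc.hb x (hCs hx)
      simp only [hf1, hf2]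
      set J := |(fderiv ℝ Ψ x).det|
      set g := ‖gradient U x‖
      have hJ : 0 < J := lt_of_lt_of_le (by positivity) b1
      have hg : 0 < g := by
        by_contra h
        have : g = 0 := le_antisymm (not_lt.1 h) (norm_nonneg _)
        rw [this, mul_zero] at b4
        linarith
      have hΦM : Φ x ≤ M := (le_abs_self _).trans (hM x)
      have b1' : 1 ≤ K * J := by
        rwa [inv_le_iff_one_le_mul₀' hK0] at b1
      refine ⟨?_, ?_, ?_⟩
      · rw [← mul_div_assoc, div_le_div_iff₀ hg (by positivity)]
        have : J * g0 ≤ K ^ 2 * g := by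
          calc J * g0 ≤ K * (K * g) := mul_le_mul b2 b4 hg0.le hK0.le
            _ = K ^ 2 * g := by ring
        nlinarith [hΦ0 x]
      · rw [← mul_div_assoc, div_le_div_iff₀ (by positivity) hg]
        have : g ≤ K ^ 2 * (J * g0) := by
          calc g ≤ K * g0 := b3
            _ ≤ (K * J) * (K * g0) := by nlinarith [mul_pos hK0 hg0]
            _ = _ := by ring
        nlinarith [hΦ0 x]
      · rw [div_le_div_iff₀ hg hg0]
        calc Φ x * g0 ≤ M * (K * g) := mul_le_mul hΦM b4 hg0.le (le_trans (hΦ0 x) hΦM)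
          _ = _ := by ring
    · have h0 := hΦC x hx
      have hM0 : 0 ≤ M := (norm_nonneg _).trans (hM x)
      simp only [hf1, hf2, h0]
      simp
      positivity
  have i1 : ∀ (ν : Measure (EE (m+1))) [IsFiniteMeasure ν], Integrable f1 ν := by
    intro ν _
    refine Integrable.of_bound hf1m.aestronglyMeasurable (M * K / g0) (Eventually.of_forall fun x => ?_)
    rw [Real.norm_eq_abs, abs_of_nonneg (hf10 x)]
    exact (hcmp x).2.2
  have i2 : ∀ (ν : Measure (EE (m+1))) [IsFiniteMeasure ν], Integrable f2 ν := by
    intro ν _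
    refine ((i1 ν).const_mul (K^2:ℝ)).mono' hf2m.aestronglyMeasurable (Eventually.of_forall fun x => ?_)
    rw [Real.norm_eq_abs, abs_of_nonneg (hf20 x)]
    exact (hcmp x).2.1
  have eℓ : (∫ y in D, Φ (Ψ.symm (Λ (y,0))) / (|(fderiv ℝ Ψ (Ψ.symm (Λ (y,0)))).det| * g0))
      = ∫ x, f2 x ∂ν3 := by
    rw [hν3, integral_map hσm hf2m.aestronglyMeasurable]
  rw [eℓ] at lim
  have eI : ∫ x in frontier Ω, f1 x ∂μH[(m:ℝ)] = ∫ x, f1 x ∂ν1 := by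
    rw [hν1]
    have hm2 : MeasurableSet (frontier Ω) := isClosed_frontier.measurableSet
    apply setIntegral_eq_of_subset_of_forall_sdiff_eq_zero hm2 inter_subset_left
    intro x hx
    have : x ∉ C := fun h => hx.2 ⟨hx.1, hCs h⟩
    simp only [hf1, hΦC x this, zero_div]
  refine ⟨_, lim, ?_, ?_⟩
  · rw [eI]
    have a1 : ∫ x, f2 x ∂ν3 ≤ K ^ 2 * ∫ x, f1 x ∂ν3 := by
      rw [← integral_const_mul]
      exact integral_mono (i2 ν3) ((i1 ν3).const_mul _) (fun x => (hcmp x).2.1)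
    have a2 : κ * ∫ x, f1 x ∂ν3 ≤ K ^ m * ∫ x, f1 x ∂ν1 := by
      have := integral_mono_measure hle2 (Eventually.of_forall hf10) (i1 _)
      rw [integral_smul_nnreal_measure, integral_smul_nnreal_measure] at this
      simpa [NNReal.smul_def] using this
    calc (κ:ℝ) * ∫ x, f2 x ∂ν3 ≤ κ * (K ^ 2 * ∫ x, f1 x ∂ν3) := by gcongr
      _ = K ^ 2 * (κ * ∫ x, f1 x ∂ν3) := by ring
      _ ≤ K ^ 2 * (K ^ m * ∫ x, f1 x ∂ν1) := by gcongr
      _ = _ := by ring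
  · rw [eI]
    have a1 : ∫ x, f1 x ∂ν3 ≤ K ^ 2 * ∫ x, f2 x ∂ν3 := by
      rw [← integral_const_mul]
      exact integral_mono (i1 ν3) ((i2 ν3).const_mul _) (fun x => (hcmp x).1)
    have a2 : ∫ x, f1 x ∂ν1 ≤ K ^ m * κ * ∫ x, f1 x ∂ν3 := by
      have := integral_mono_measure hle1 (Eventually.of_forall hf10) (i1 _)
      rw [integral_smul_nnreal_measure] at this
      simpa [NNReal.smul_def] using this
    calc ∫ x, f1 x ∂ν1 ≤ K ^ m * κ * ∫ x, f1 x ∂ν3 := a2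
      _ ≤ K ^ m * κ * (K ^ 2 * ∫ x, f2 x ∂ν3) := by gcongr
      _ = _ := by ring


structure Dom {m : ℕ} (Ω : Set (EE (m+1))) (U : EE (m+1) → ℝ) : Prop where
  cpt : IsCompact Ω
  conv : Convex ℝ Ω
  ne : (interior Ω).Nonempty
  hU : ContDiff ℝ 2 U
  pos : ∀ x ∈ interior Ω, 0 < U x
  zero : ∀ x ∈ frontier Ω, U x = 0
  grad : ∀ x ∈ frontier Ω, gradient U x ≠ 0

namespace Dom
variable {m : ℕ} {Ω : Set (EE (m+1))} {U : EE (m+1) → ℝ}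

lemma hU1 (h : Dom Ω U) : ContDiff ℝ 1 U := h.hU.of_le (by norm_num)
lemma Uc (h : Dom Ω U) : Continuous U := h.hU.continuous
lemma gc (h : Dom Ω U) : Continuous (gradient U) := grad_cont h.hU1
lemma closed (h : Dom Ω U) : IsClosed Ω := h.cpt.isClosed
lemma frsub (h : Dom Ω U) : frontier Ω ⊆ Ω := h.closed.frontier_subset
lemma frcpt (h : Dom Ω U) : IsCompact (frontier Ω) := h.cpt.of_isClosed_subset isClosed_frontier h.frsub
lemma mem_cases (_h : Dom Ω U) {x : EE (m+1)} (hx : x ∈ Ω) : x ∈ interior Ω ∨ x ∈ frontier Ω := by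
  by_cases hi : x ∈ interior Ω
  · exact Or.inl hi
  · exact Or.inr ⟨subset_closure hx, hi⟩
lemma nonneg (h : Dom Ω U) {x : EE (m+1)} (hx : x ∈ Ω) : 0 ≤ U x := by
  rcases h.mem_cases hx with hi | hi
  · exact (h.pos x hi).le
  · exact (h.zero x hi).ge
lemma int_of_pos (h : Dom Ω U) {x : EE (m+1)} (hx : x ∈ Ω) (hp : 0 < U x) : x ∈ interior Ω := by
  rcases h.mem_cases hx with hi | hi
  · exact hi
  · rw [h.zero x hi] at hp; exact absurd hp (lt_irrefl _)
lemma fr_of_zero (h : Dom Ω U) {x : EE (m+1)} (hx : x ∈ Ω) (hp : U x = 0) : x ∈ frontier Ω := by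
  rcases h.mem_cases hx with hi | hi
  · have := h.pos x hi; rw [hp] at this; exact absurd this (lt_irrefl _)
  · exact hi

lemma chart (h : Dom Ω U) {y0 : EE (m+1)} (hy : y0 ∈ frontier Ω) {K : ℝ≥0} (hK : 1 < K) :
    ∃ (g0 : ℝ) (e : EE (m+1)) (Ψ : OpenPartialHomeomorph (EE (m+1)) (EE (m+1))),
      IsChart Ω U K g0 e Ψ ∧ y0 ∈ Ψ.source := by
  obtain ⟨e, Ψ, h1, h2, h3, h4, h5, h6, h7, h8, h9, h10, h11⟩ := chart_exists h.closed
    (by rw [h.conv.closure_interior_eq_closure_of_nonempty_interior h.ne]; exact frontier_subset_closure)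
    h.hU1 h.pos h.zero hy (h.grad y0 hy) hK
  exact ⟨_, e, Ψ, ⟨norm_pos_iff.2 (h.grad y0 hy), h1, h3, h4, h5, h6, h7, h8, h9, h10, h11⟩, h2⟩

lemma charts (h : Dom Ω U) {K : ℝ≥0} (hK : 1 < K) :
    ∃ (N : ℕ) (g0 : Fin N → ℝ) (e : Fin N → EE (m+1))
      (Ψ : Fin N → OpenPartialHomeomorph (EE (m+1)) (EE (m+1))),
      (∀ i, IsChart Ω U K (g0 i) (e i) (Ψ i)) ∧ frontier Ω ⊆ ⋃ i, (Ψ i).source := by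
  haveI : Nonempty (OpenPartialHomeomorph (EE (m+1)) (EE (m+1))) := ⟨OpenPartialHomeomorph.refl _⟩
  choose! g0 e Ψ hc hs using fun y (hy : y ∈ frontier Ω) => h.chart hy hK
  obtain ⟨t, ht, hcov⟩ := h.frcpt.elim_nhds_subcover (fun y => (Ψ y).source)
    (fun y hy => (Ψ y).open_source.mem_nhds (hs y hy))
  let E := t.equivFin.symm
  refine ⟨t.card, fun i => g0 (E i), fun i => e (E i), fun i => Ψ (E i), fun i => hc _ (ht _ (E i).2), ?_⟩
  intro x hx
  obtain ⟨y, hy, hxy⟩ := mem_iUnion₂.1 (hcov hx)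
  refine mem_iUnion.2 ⟨E.symm ⟨y, hy⟩, ?_⟩
  simpa using hxy

lemma frfin (h : Dom Ω U) : (μH[(m:ℝ)]) (frontier Ω) < ∞ := by
  obtain ⟨κ, hκ0, hκ⟩ := haus_const m
  obtain ⟨N, g0, e, Ψ, hc, hcov⟩ := h.charts (K := 2) (by norm_num)
  have : frontier Ω ⊆ ⋃ i, (frontier Ω ∩ (Ψ i).source) := by
    rw [← inter_iUnion]; exact subset_inter subset_rfl hcov
  refine (measure_mono this).trans_lt ((measure_iUnion_le _).trans_lt ?_)
  rw [tsum_fintype]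
  exact ENNReal.sum_lt_top.2 fun i _ => (chart_limit h.hU1 (by norm_num) (hc i) hκ).1

lemma frint (h : Dom Ω U) {f : EE (m+1) → ℝ} (hf : ContinuousOn f (frontier Ω)) :
    IntegrableOn f (frontier Ω) (μH[(m:ℝ)]) := by
  obtain ⟨M, hM⟩ := h.frcpt.exists_bound_of_continuousOn hf
  have : IsFiniteMeasure ((μH[(m:ℝ)]).restrict (frontier Ω)) :=
    ⟨by rw [Measure.restrict_apply_univ]; exact h.frfin⟩
  refine Integrable.of_bound (hf.aestronglyMeasurable h.frcpt.measurableSet) M ?_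
  exact (ae_restrict_mem h.frcpt.measurableSet).mono hM

lemma intint (h : Dom Ω U) {f : EE (m+1) → ℝ} (hf : ContinuousOn f Ω) :
    IntegrableOn f (interior Ω) :=
  (hf.integrableOn_compact h.cpt).mono_set interior_subset

lemma gdiv (h : Dom Ω U) {f : EE (m+1) → ℝ} (hf : ContinuousOn f (frontier Ω)) :
    ContinuousOn (fun x => f x / ‖gradient U x‖) (frontier Ω) :=
  hf.div h.gc.norm.continuousOn (fun x hx => norm_ne_zero_iff.2 (h.grad x hx))

lemma layerK (h : Dom Ω U) {K : ℝ≥0} (hK : 1 < K)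
    {κ : ℝ≥0} (hκ : (μH[(m:ℝ)] : Measure (EE m)) = κ • volume)
    {F : EE (m+1) → ℝ → ℝ} (hF : Continuous (Function.uncurry F)) (hF0 : ∀ x t, 0 ≤ F x t)
    {T : ℝ} (hT : 0 < T) (hFT : ∀ x t, T ≤ |t| → F x t = 0) :
    ∃ ℓ : ℝ, Tendsto (fun s : ℝ => s⁻¹ * ∫ x in interior Ω, F x (U x / s)) (𝓝[>] 0) (𝓝 ℓ) ∧
        κ * ℓ ≤ K ^ (m+2) * ∫ x in frontier Ω, (∫ t in (0:ℝ)..T, F x t) / ‖gradient U x‖ ∂μH[(m:ℝ)] ∧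
        ∫ x in frontier Ω, (∫ t in (0:ℝ)..T, F x t) / ‖gradient U x‖ ∂μH[(m:ℝ)]
          ≤ K ^ (m+2) * (κ * ℓ) := by
  obtain ⟨N, g0, e, Ψ, hc, hcov⟩ := h.charts hK
  have hO : IsOpen (⋃ i, (Ψ i).source) := isOpen_iUnion fun i => (Ψ i).open_source
  obtain ⟨u0, hu0, hu⟩ : ∃ u0 > 0, ∀ x ∈ Ω, U x ≤ u0 → x ∈ ⋃ i, (Ψ i).source := by
    have hKc : IsCompact (Ω \ ⋃ i, (Ψ i).source) := h.cpt.diff hO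
    rcases (Ω \ ⋃ i, (Ψ i).source).eq_empty_or_nonempty with he | hne
    · refine ⟨1, one_pos, fun x hx _ => ?_⟩
      by_contra hh
      have : x ∈ (Ω \ ⋃ i, (Ψ i).source) := ⟨hx, hh⟩
      rw [he] at this; exact this
    · obtain ⟨x0, hx0, hmin⟩ := hKc.exists_isMinOn hne h.Uc.continuousOn
      have hx0p : 0 < U x0 := by
        rcases h.mem_cases hx0.1 with hi | hi
        · exact h.pos _ hi
        · exact absurd (hcov hi) hx0.2
      refine ⟨U x0 / 2, by positivity, fun x hx hxu => ?_⟩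
      by_contra hh
      have : U x0 ≤ U x := hmin (⟨hx, hh⟩ : x ∈ (Ω \ ⋃ i, (Ψ i).source))
      linarith
  set t : Set (EE (m+1)) := Ω ∩ {x | U x ≤ u0} with ht
  have htc : IsCompact t := h.cpt.inter_right (isClosed_le h.Uc continuous_const)
  obtain ⟨f, hf1, hf2, hf3, hf4⟩ := exists_continuous_sum_one_of_isOpen_isCompact
    (fun i => (Ψ i).open_source) htc (fun x hx => hu x hx.1 hx.2)
  have hsum : ∀ x ∈ t, ∑ i, f i x = 1 := fun x hx => by simpa using hf2 hx
  have hFi : ∀ i, Continuous (Function.uncurry (fun x t => f i x * F x t)) := fun i =>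
    ((f i).continuous.comp continuous_fst).mul hF
  choose ℓ hl1 hl2 hl3 using fun i => (chart_limit h.hU1 hK (hc i) hκ).2 (fun x t => f i x * F x t)
    (hFi i)
    (fun x t => mul_nonneg (hf3 i x).1 (hF0 x t)) (tsupport (f i)) (hf4 i) (hf1 i)
    (fun x hx t => by rw [image_eq_zero_of_notMem_tsupport hx, zero_mul]) T hT
    (fun x t ht => by rw [hFT x t ht, mul_zero])
  have hΦc : ∀ i, Continuous fun x => ∫ t in (0:ℝ)..T, f i x * F x t := fun i =>
    intervalIntegral.continuous_parametric_intervalIntegral_of_continuous' (hFi i) 0 T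
  have eI : ∫ x in frontier Ω, (∫ t in (0:ℝ)..T, F x t) / ‖gradient U x‖ ∂μH[(m:ℝ)]
      = ∑ i, ∫ x in frontier Ω, (∫ t in (0:ℝ)..T, f i x * F x t) / ‖gradient U x‖ ∂μH[(m:ℝ)] := by
    rw [← integral_finsetSum _ (fun i _ => h.frint (h.gdiv (hΦc i).continuousOn))]
    apply setIntegral_congr_fun h.frcpt.measurableSet
    intro x hx
    simp only
    rw [← Finset.sum_div]
    congr 1
    simp_rw [intervalIntegral.integral_const_mul]
    rw [← Finset.sum_mul, hsum x ⟨h.frsub hx, by simp [h.zero x hx, hu0.le]⟩, one_mul]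
  refine ⟨∑ i, ℓ i, ?_, ?_, ?_⟩
  · have := tendsto_finsetSum Finset.univ (fun i _ => hl1 i)
    refine this.congr' ?_
    have hsmall : ∀ᶠ s : ℝ in 𝓝[>] 0, s < u0 / T :=
      mem_nhdsWithin_of_mem_nhds (Iio_mem_nhds (by positivity))
    filter_upwards [self_mem_nhdsWithin, hsmall] with s hs hs2
    have hs' : 0 < s := hs
    rw [← Finset.mul_sum]
    congr 1
    rw [← integral_finsetSum]
    · apply setIntegral_congr_fun isOpen_interior.measurableSet
      intro x hx
      simp only
      rw [← Finset.sum_mul]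
      by_cases hxu : U x ≤ u0
      · rw [hsum x ⟨interior_subset hx, hxu⟩, one_mul]
      · rw [hFT x, mul_zero]
        have hp := h.pos x hx
        rw [abs_of_pos (by positivity), le_div_iff₀ hs']
        rw [lt_div_iff₀ hT] at hs2
        push Not at hxu
        linarith
    · intro i _
      apply h.intint
      have : Continuous fun x => (x, U x / s) := by
        have := h.Uc
        fun_prop
      exact ((hFi i).comp this).continuousOn
  · rw [eI, Finset.mul_sum, Finset.mul_sum]
    exact Finset.sum_le_sum fun i _ => hl2 i
  · rw [eI, Finset.mul_sum, Finset.mul_sum]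
    exact Finset.sum_le_sum fun i _ => hl3 i

lemma layer_nonneg (h : Dom Ω U)
    {κ : ℝ≥0} (hκ0 : κ ≠ 0) (hκ : (μH[(m:ℝ)] : Measure (EE m)) = κ • volume)
    {F : EE (m+1) → ℝ → ℝ} (hF : Continuous (Function.uncurry F)) (hF0 : ∀ x t, 0 ≤ F x t)
    {T : ℝ} (hT : 0 < T) (hFT : ∀ x t, T ≤ |t| → F x t = 0) :
    Tendsto (fun s : ℝ => s⁻¹ * ∫ x in interior Ω, F x (U x / s)) (𝓝[>] 0)
      (𝓝 ((κ:ℝ)⁻¹ * ∫ x in frontier Ω, (∫ t in (0:ℝ)..T, F x t) / ‖gradient U x‖ ∂μH[(m:ℝ)])) := by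
  obtain ⟨ℓ, hl, -, -⟩ := h.layerK (K := 2) (by norm_num) hκ hF hF0 hT hFT
  set I := ∫ x in frontier Ω, (∫ t in (0:ℝ)..T, F x t) / ‖gradient U x‖ ∂μH[(m:ℝ)]
  have hK : ∀ k : ℝ, 1 < k → κ * ℓ ≤ k ^ (m+2) * I ∧ I ≤ k ^ (m+2) * (κ * ℓ) := by
    intro k hk
    obtain ⟨ℓ', hl', h1, h2⟩ := h.layerK (K := ⟨k, by linarith⟩) (by exact_mod_cast hk) hκ hF hF0 hT hFT
    rw [tendsto_nhds_unique hl hl']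
    exact ⟨h1, h2⟩
  have lim : ∀ a : ℝ, Tendsto (fun k : ℝ => k ^ (m+2) * a) (𝓝[>] 1) (𝓝 a) := by
    intro a
    have : Continuous fun k : ℝ => k ^ (m+2) * a := by fun_prop
    have := this.tendsto 1
    simp only [one_pow, one_mul] at this
    exact this.mono_left nhdsWithin_le_nhds
  have e : κ * ℓ = I := by
    apply le_antisymm
    · exact ge_of_tendsto (lim I) (by filter_upwards [self_mem_nhdsWithin] with k hk using (hK k hk).1)
    · exact ge_of_tendsto (lim _) (by filter_upwards [self_mem_nhdsWithin] with k hk using (hK k hk).2)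
  have hκr : (κ:ℝ) ≠ 0 := by exact_mod_cast hκ0
  rwa [← e, inv_mul_cancel_left₀ hκr]

lemma layer (h : Dom Ω U) : ∃ c : ℝ, 0 < c ∧ ∀ (F : EE (m+1) → ℝ → ℝ), Continuous (Function.uncurry F) →
    ∀ T : ℝ, 0 < T → (∀ x t, T ≤ t → F x t = 0) →
    Tendsto (fun s : ℝ => s⁻¹ * ∫ x in interior Ω, F x (U x / s)) (𝓝[>] 0)
      (𝓝 (c * ∫ x in frontier Ω, (∫ t in (0:ℝ)..T, F x t) / ‖gradient U x‖ ∂μH[(m:ℝ)])) := by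
  obtain ⟨κ, hκ0, hκ⟩ := haus_const m
  refine ⟨(κ:ℝ)⁻¹, inv_pos.2 (by exact_mod_cast (pos_iff_ne_zero.2 hκ0)), ?_⟩
  intro F hF T hT hFT
  set χ : ℝ → ℝ := fun t => max 0 (min 1 (t / T + 1)) with hχ
  have hχc : Continuous χ := by fun_prop
  have hχ1 : ∀ t, 0 ≤ t → χ t = 1 := by
    intro t ht
    have : 0 ≤ t / T := by positivity
    simp only [hχ]
    rw [min_eq_left (by linarith), max_eq_right zero_le_one]
  have hχ0 : ∀ t, t ≤ -T → χ t = 0 := by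
    intro t ht
    have : t / T ≤ -1 := by rw [div_le_iff₀ hT]; linarith
    simp only [hχ]
    rw [min_eq_right (by linarith), max_eq_left (by linarith)]
  set P : EE (m+1) → ℝ → ℝ := fun x t => χ t * max (F x t) 0
  set Q : EE (m+1) → ℝ → ℝ := fun x t => χ t * max (-F x t) 0
  have hP : Continuous (Function.uncurry P) := by
    have : Continuous fun p : EE (m+1) × ℝ => χ p.2 * max (Function.uncurry F p) 0 := by fun_prop
    exact this
  have hQ : Continuous (Function.uncurry Q) := by
    have : Continuous fun p : EE (m+1) × ℝ => χ p.2 * max (-Function.uncurry F p) 0 := by fun_prop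
    exact this
  have hχn : ∀ t, 0 ≤ χ t := fun t => le_max_left _ _
  have hv : ∀ x t, T ≤ |t| → P x t = 0 ∧ Q x t = 0 := by
    intro x t ht
    rcases le_abs.1 ht with h1 | h1
    · simp [P, Q, hFT x t h1]
    · simp [P, Q, hχ0 t (by linarith)]
  have lP := h.layer_nonneg hκ0 hκ hP (fun x t => mul_nonneg (hχn t) (le_max_right _ _)) hT (fun x t ht => (hv x t ht).1)
  have lQ := h.layer_nonneg hκ0 hκ hQ (fun x t => mul_nonneg (hχn t) (le_max_right _ _)) hT (fun x t ht => (hv x t ht).2)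
  have hPQ : ∀ x t, 0 ≤ t → P x t - Q x t = F x t := by
    intro x t ht
    simp only [P, Q, hχ1 t ht, one_mul]
    rcases le_total 0 (F x t) with h1 | h1
    · rw [max_eq_left h1, max_eq_right (by linarith), sub_zero]
    · rw [max_eq_right h1, max_eq_left (by linarith)]; ring
  have hPc : Continuous fun x => ∫ t in (0:ℝ)..T, P x t :=
    intervalIntegral.continuous_parametric_intervalIntegral_of_continuous' hP 0 T
  have hQc : Continuous fun x => ∫ t in (0:ℝ)..T, Q x t :=
    intervalIntegral.continuous_parametric_intervalIntegral_of_continuous' hQ 0 T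
  have l := lP.sub lQ
  rw [← mul_sub, ← integral_sub (h.frint (h.gdiv hPc.continuousOn)) (h.frint (h.gdiv hQc.continuousOn))] at l
  have e2 : ∀ x, (∫ t in (0:ℝ)..T, P x t) / ‖gradient U x‖ - (∫ t in (0:ℝ)..T, Q x t) / ‖gradient U x‖
      = (∫ t in (0:ℝ)..T, F x t) / ‖gradient U x‖ := by
    intro x
    have iP : Continuous (P x) := hP.comp (Continuous.prodMk_right x)
    have iQ : Continuous (Q x) := hQ.comp (Continuous.prodMk_right x)
    rw [← sub_div, ← intervalIntegral.integral_sub (iP.intervalIntegrable _ _) (iQ.intervalIntegrable _ _)]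
    congr 1
    apply intervalIntegral.integral_congr
    intro t ht
    rw [uIcc_of_le hT.le] at ht
    exact hPQ x t ht.1
  simp_rw [e2] at l
  refine l.congr' ?_
  filter_upwards [self_mem_nhdsWithin] with s hs
  have hs' : 0 < s := hs
  have hcU : Continuous fun x => (x, U x / s) := by
    have := h.Uc
    fun_prop
  have i1 : IntegrableOn (fun x => P x (U x / s)) (interior Ω) := h.intint (hP.comp hcU).continuousOn
  have i2 : IntegrableOn (fun x => Q x (U x / s)) (interior Ω) := h.intint (hQ.comp hcU).continuousOn
  rw [← mul_sub, ← integral_sub i1 i2]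
  congr 1
  apply setIntegral_congr_fun isOpen_interior.measurableSet
  intro x hx
  have := h.pos x hx
  exact hPQ x _ (by positivity)

end Dom


/-- maximality of a pair near a point -/
def PMax {n : ℕ} (O : Set (EE n)) (a b : EE n → ℝ) (x0 x1 : EE n) : Prop :=
  ∀ h, x0 + h ∈ O → 0 < a (x0 + h) → x1 - h ∈ O → 0 < b (x1 - h) →
    √(a (x0 + h)) + √(b (x1 - h)) ≤ √(a x0) + √(b x1)

lemma line_deriv {n : ℕ} {a : EE n → ℝ} {x0 : EE n} (ha : DifferentiableAt ℝ a x0) (c : EE n) :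
    HasDerivAt (fun t : ℝ => a (x0 + t • c)) (fderiv ℝ a x0 c) 0 := by
  have h1 : HasDerivAt (fun t : ℝ => x0 + t • c) c 0 := by
    simpa using ((hasDerivAt_id (0:ℝ)).smul_const c).const_add x0
  have h2 : HasFDerivAt a (fderiv ℝ a x0) (x0 + (0:ℝ) • c) := by simpa using ha.hasFDerivAt
  exact h2.comp_hasDerivAt (0:ℝ) h1

lemma PMax.pos {n : ℕ} {O : Set (EE n)} (hO : IsOpen O) {a b : EE n → ℝ} (ha : Differentiable ℝ a)
    (hb : Differentiable ℝ b) {x0 x1 : EE n} (h : PMax O a b x0 x1) (h0 : x0 ∈ O) (h1 : x1 ∈ O)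
    (hb1 : 0 < b x1) (hg : fderiv ℝ a x0 ≠ 0) : a x0 ≠ 0 := by
  intro ha0
  obtain ⟨e, he⟩ : ∃ e, 0 < fderiv ℝ a x0 e := by
    have : ∃ e, fderiv ℝ a x0 e ≠ 0 := by
      by_contra hh
      push Not at hh
      exact hg (ContinuousLinearMap.ext hh)
    obtain ⟨e, he⟩ := this
    rcases lt_or_gt_of_ne he with h2 | h2
    · exact ⟨-e, by rw [map_neg]; linarith⟩
    · exact ⟨e, h2⟩
  set d := fderiv ℝ a x0 e
  have d1 := line_deriv (ha x0) e
  have d2 : HasDerivAt (fun t : ℝ => √(b (x1 - t • e))) (fderiv ℝ b x1 (-e) / (2 * √(b x1))) 0 := by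
    have := (line_deriv (hb x1) (-e)).sqrt (by simpa using hb1.ne')
    simpa [sub_eq_add_neg] using this
  set f' := fderiv ℝ b x1 (-e) / (2 * √(b x1))
  have t1 := d1.tendsto_slope_zero_right.eventually_const_lt (half_lt_self he)
  have t2 := d2.tendsto_slope_zero_right.eventually_const_lt (sub_one_lt f')
  have c1 : Tendsto (fun t : ℝ => x0 + t • e) (𝓝[>] 0) (𝓝 x0) := by
    have : Continuous fun t : ℝ => x0 + t • e := by fun_prop
    have := this.tendsto 0
    simp only [zero_smul, add_zero] at this
    exact this.mono_left nhdsWithin_le_nhds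
  have c2 : Tendsto (fun t : ℝ => x1 - t • e) (𝓝[>] 0) (𝓝 x1) := by
    have : Continuous fun t : ℝ => x1 - t • e := by fun_prop
    have := this.tendsto 0
    simp only [zero_smul, sub_zero] at this
    exact this.mono_left nhdsWithin_le_nhds
  have t3 := c1.eventually (hO.mem_nhds h0)
  have t4 := c2.eventually (hO.mem_nhds h1)
  have t5 := (hb.continuous.continuousAt.tendsto.comp c2).eventually_const_lt hb1
  have key : ∀ᶠ t : ℝ in 𝓝[>] 0, d / 2 ≤ (f' - 1) ^ 2 * t := by
    filter_upwards [t1, t2, t3, t4, t5, self_mem_nhdsWithin] with t u1 u2 u3 u4 u5 u6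
    have ht : 0 < t := u6
    simp only [zero_add, zero_smul, add_zero, sub_zero, smul_eq_mul, ha0] at u1 u2
    rw [inv_mul_eq_div, lt_div_iff₀ ht] at u1 u2
    have hap : 0 < a (x0 + t • e) := by nlinarith
    have := h (t • e) u3 hap u4 u5
    rw [ha0, Real.sqrt_zero] at this
    have h3 : √(a (x0 + t • e)) ≤ (1 - f') * t := by nlinarith
    have h4 : a (x0 + t • e) = √(a (x0 + t • e)) ^ 2 := (Real.sq_sqrt hap.le).symm
    have h5 : √(a (x0 + t • e)) ^ 2 ≤ ((1 - f') * t) ^ 2 := by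
      apply pow_le_pow_left₀ (Real.sqrt_nonneg _) h3
    have h6 : d / 2 * t ≤ ((f' - 1) ^ 2 * t) * t := by nlinarith
    exact le_of_mul_le_mul_right h6 ht
  have lim : Tendsto (fun t : ℝ => (f' - 1) ^ 2 * t) (𝓝[>] 0) (𝓝 0) := by
    have : Continuous fun t : ℝ => (f' - 1) ^ 2 * t := by fun_prop
    have := this.tendsto 0
    simp only [mul_zero] at this
    exact this.mono_left nhdsWithin_le_nhds
  have := ge_of_tendsto lim key
  linarith

lemma PMax.foc {n : ℕ} {O : Set (EE n)} (hO : IsOpen O) {a b : EE n → ℝ} (ha : Differentiable ℝ a)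
    (hb : Differentiable ℝ b) {x0 x1 : EE n} (h : PMax O a b x0 x1) (h0 : x0 ∈ O) (h1 : x1 ∈ O)
    (ha0 : 0 < a x0) (hb1 : 0 < b x1) (c : EE n) :
    fderiv ℝ a x0 c / √(a x0) = fderiv ℝ b x1 c / √(b x1) := by
  have d1 : HasDerivAt (fun t : ℝ => √(a (x0 + t • c))) (fderiv ℝ a x0 c / (2 * √(a x0))) 0 := by
    have := (line_deriv (ha x0) c).sqrt (by simpa using ha0.ne')
    simpa using this
  have d2 : HasDerivAt (fun t : ℝ => √(b (x1 - t • c))) (fderiv ℝ b x1 (-c) / (2 * √(b x1))) 0 := by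
    have := (line_deriv (hb x1) (-c)).sqrt (by simpa using hb1.ne')
    simpa [sub_eq_add_neg] using this
  have c1 : ContinuousAt (fun t : ℝ => x0 + t • c) 0 := by fun_prop
  have c2 : ContinuousAt (fun t : ℝ => x1 - t • c) 0 := by fun_prop
  have hmax : IsLocalMax (fun t : ℝ => √(a (x0 + t • c)) + √(b (x1 - t • c))) 0 := by
    have t3 := c1.eventually (hO.mem_nhds (by simpa using h0))
    have t4 := c2.eventually (hO.mem_nhds (by simpa using h1))
    have t5 : ∀ᶠ t : ℝ in 𝓝 0, 0 < a (x0 + t • c) := by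
      have : ContinuousAt (fun t : ℝ => a (x0 + t • c)) 0 := ha.continuous.continuousAt.comp c1
      exact this.eventually_const_lt (by simpa using ha0)
    have t6 : ∀ᶠ t : ℝ in 𝓝 0, 0 < b (x1 - t • c) := by
      have : ContinuousAt (fun t : ℝ => b (x1 - t • c)) 0 := hb.continuous.continuousAt.comp c2
      exact this.eventually_const_lt (by simpa using hb1)
    filter_upwards [t3, t4, t5, t6] with t u3 u4 u5 u6
    simpa using h (t • c) u3 u5 u4 u6
  have := hmax.hasDerivAt_eq_zero (d1.add d2)
  rw [map_neg] at this
  have p1 : √(a x0) ≠ 0 := (Real.sqrt_pos.2 ha0).ne'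
  have p2 : √(b x1) ≠ 0 := (Real.sqrt_pos.2 hb1).ne'
  field_simp at this ⊢
  linarith

structure Pair {n : ℕ} (O A B : Set (EE n)) (a b : EE n → ℝ) : Prop where
  Oo : IsOpen O
  Ac : IsCompact A
  Bc : IsCompact B
  AO : A ⊆ O
  BO : B ⊆ O
  hA : ∀ x ∈ O, 0 ≤ a x → x ∈ A
  hB : ∀ x ∈ O, 0 ≤ b x → x ∈ B
  hA0 : ∀ x ∈ A, 0 ≤ a x
  hB0 : ∀ x ∈ B, 0 ≤ b x
  ha : ContDiff ℝ 2 a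
  hb : ContDiff ℝ 2 b
  la : ∀ x ∈ A, lap a x = -2
  lb : ∀ x ∈ B, lap b x = -2
  ga : ∀ x ∈ A, a x = 0 → fderiv ℝ a x ≠ 0
  gb : ∀ x ∈ B, b x = 0 → fderiv ℝ b x ≠ 0

noncomputable def qf {n : ℕ} (a b : EE n → ℝ) (p : EE n × EE n) : ℝ :=
  ((√(a p.1) + √(b p.2)) / 2) ^ 2

noncomputable def Vf {n : ℕ} (A B : Set (EE n)) (a b : EE n → ℝ) (x : EE n) : ℝ :=
  sSup (insert 0 (qf a b '' {p | p.1 ∈ A ∧ p.2 ∈ B ∧ (1/2:ℝ) • (p.1 + p.2) = x}))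

namespace Pair
variable {n : ℕ} {O A B : Set (EE n)} {a b : EE n → ℝ}

lemma da (h : Pair O A B a b) : Differentiable ℝ a := h.ha.differentiable (by norm_num)
lemma db (h : Pair O A B a b) : Differentiable ℝ b := h.hb.differentiable (by norm_num)
lemma qc (h : Pair O A B a b) : Continuous (qf a b) := by
  have h1 := h.ha.continuous
  have h2 := h.hb.continuous
  unfold qf
  fun_prop

lemma swap (h : Pair O A B a b) : Pair O B A b a :=
  ⟨h.Oo, h.Bc, h.Ac, h.BO, h.AO, h.hB, h.hA, h.hB0, h.hA0, h.hb, h.ha, h.lb, h.la, h.gb, h.ga⟩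

lemma bdd (h : Pair O A B a b) : ∃ M, 0 ≤ M ∧ ∀ p, p.1 ∈ A → p.2 ∈ B → qf a b p ≤ M := by
  obtain ⟨M, hM⟩ := (h.Ac.prod h.Bc).exists_bound_of_continuousOn h.qc.continuousOn
  refine ⟨max M 0, le_max_right _ _, fun p h1 h2 => ?_⟩
  exact (le_abs_self _).trans ((hM p ⟨h1, h2⟩).trans (le_max_left _ _))

lemma bddAbove (h : Pair O A B a b) (x : EE n) :
    BddAbove (insert 0 (qf a b '' {p | p.1 ∈ A ∧ p.2 ∈ B ∧ (1/2:ℝ) • (p.1 + p.2) = x})) := by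
  obtain ⟨M, hM0, hM⟩ := h.bdd
  refine ⟨M, ?_⟩
  rintro _ (rfl | ⟨p, hp, rfl⟩)
  · exact hM0
  · exact hM p hp.1 hp.2.1

lemma V_nonneg (h : Pair O A B a b) (x : EE n) : 0 ≤ Vf A B a b x :=
  le_csSup (h.bddAbove x) (mem_insert _ _)

lemma le_V (h : Pair O A B a b) {x0 x1 : EE n} (h0 : x0 ∈ A) (h1 : x1 ∈ B) :
    qf a b (x0, x1) ≤ Vf A B a b ((1/2:ℝ) • (x0 + x1)) :=
  le_csSup (h.bddAbove _) (mem_insert_of_mem _ ⟨(x0, x1), ⟨h0, h1, rfl⟩, rfl⟩)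

lemma V_att (h : Pair O A B a b) {x : EE n} (hx : 0 < Vf A B a b x) :
    ∃ x0 ∈ A, ∃ x1 ∈ B, (1/2:ℝ) • (x0 + x1) = x ∧ Vf A B a b x = qf a b (x0, x1) := by
  have hc : IsCompact {p : EE n × EE n | p.1 ∈ A ∧ p.2 ∈ B ∧ (1/2:ℝ) • (p.1 + p.2) = x} := by
    have h1 : {p : EE n × EE n | p.1 ∈ A ∧ p.2 ∈ B ∧ (1/2:ℝ) • (p.1 + p.2) = x}
      = (A ×ˢ B) ∩ {p | (1/2:ℝ) • (p.1 + p.2) = x} := by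
      ext p; simp [and_assoc]
    rw [h1]
    exact (h.Ac.prod h.Bc).inter_right (isClosed_eq (by fun_prop) continuous_const)
  have hc2 : IsCompact (insert 0 (qf a b '' {p | p.1 ∈ A ∧ p.2 ∈ B ∧ (1/2:ℝ) • (p.1 + p.2) = x})) :=
    (hc.image h.qc).insert 0
  have hm := hc2.sSup_mem (insert_nonempty _ _)
  rcases hm with hm | ⟨p, ⟨hp1, hp2, hp3⟩, hp⟩
  · have : Vf A B a b x = 0 := hm
    rw [this] at hx; exact absurd hx (lt_irrefl _)
  · exact ⟨p.1, hp1, p.2, hp2, hp3, hp.symm⟩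

lemma isCompact_ge (h : Pair O A B a b) {t : ℝ} (ht : 0 < t) : IsCompact {x | t ≤ Vf A B a b x} := by
  have : {x | t ≤ Vf A B a b x} = (fun p : EE n × EE n => (1/2:ℝ) • (p.1 + p.2)) ''
      ((A ×ˢ B) ∩ {p | t ≤ qf a b p}) := by
    ext x
    constructor
    · intro hx
      obtain ⟨x0, h0, x1, h1, h2, h3⟩ := h.V_att (ht.trans_le hx)
      exact ⟨(x0, x1), ⟨⟨h0, h1⟩, by change t ≤ _; rw [← h3]; exact hx⟩, h2⟩
    · rintro ⟨p, ⟨⟨h0, h1⟩, h2⟩, rfl⟩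
      exact le_trans h2 (h.le_V h0 h1)
  rw [this]
  refine ((h.Ac.prod h.Bc).inter_right (isClosed_le continuous_const h.qc)).image (by fun_prop)

lemma V_meas (h : Pair O A B a b) : Measurable (Vf A B a b) := by
  apply measurable_of_Ici
  intro t
  rcases le_or_gt t 0 with ht | ht
  · have : Vf A B a b ⁻¹' Ici t = univ := by
      ext x; simp [ht.trans (h.V_nonneg x)]
    rw [this]; exact MeasurableSet.univ
  · exact (h.isCompact_ge ht).measurableSet

lemma V_le (h : Pair O A B a b) : ∃ M, 0 ≤ M ∧ ∀ x, Vf A B a b x ≤ M := by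
  obtain ⟨M, hM0, hM⟩ := h.bdd
  refine ⟨M, hM0, fun x => ?_⟩
  rcases (h.V_nonneg x).eq_or_lt with h0 | h0
  · rw [← h0]; exact hM0
  · obtain ⟨x0, h0, x1, h1, h2, h3⟩ := h.V_att h0
    rw [h3]; exact hM _ h0 h1

/-- compact set of candidate maximizing pairs -/
def ZS (O A B : Set (EE n)) (a b : EE n → ℝ) (η : ℝ) : Set (EE n × EE n) :=
  {p | p.1 ∈ A ∧ p.2 ∈ B ∧ η ≤ qf a b p ∧ PMax O a b p.1 p.2}

lemma ZS_compact (h : Pair O A B a b) (η : ℝ) : IsCompact (ZS O A B a b η) := by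
  have e : ZS O A B a b η = (A ×ˢ B) ∩ ({p | η ≤ qf a b p} ∩ {p | PMax O a b p.1 p.2}) := by
    ext p; simp [ZS, and_assoc]
  rw [e]
  apply (h.Ac.prod h.Bc).inter_right
  have ac := h.ha.continuous
  have bc := h.hb.continuous
  apply (isClosed_le continuous_const h.qc).inter
  have e2 : {p : EE n × EE n | PMax O a b p.1 p.2} = ⋂ k : EE n,
      {p | (p.1 + k ∈ O ∧ 0 < a (p.1 + k) ∧ p.2 - k ∈ O ∧ 0 < b (p.2 - k)) →
        √(a (p.1 + k)) + √(b (p.2 - k)) ≤ √(a p.1) + √(b p.2)} := by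
    ext p; simp [PMax, mem_iInter]
  rw [e2]
  apply isClosed_iInter
  intro k
  have o1 : IsOpen {p : EE n × EE n | p.1 + k ∈ O ∧ 0 < a (p.1 + k) ∧ p.2 - k ∈ O ∧ 0 < b (p.2 - k)} := by
    have q1 : IsOpen {p : EE n × EE n | p.1 + k ∈ O} := h.Oo.preimage (by fun_prop)
    have q2 : IsOpen {p : EE n × EE n | 0 < a (p.1 + k)} := isOpen_lt continuous_const (by fun_prop)
    have q3 : IsOpen {p : EE n × EE n | p.2 - k ∈ O} := h.Oo.preimage (by fun_prop)
    have q4 : IsOpen {p : EE n × EE n | 0 < b (p.2 - k)} := isOpen_lt continuous_const (by fun_prop)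
    exact q1.and (q2.and (q3.and q4))
  exact isClosed_imp o1 (isClosed_le (by fun_prop) (by fun_prop))

lemma ZS_pos (h : Pair O A B a b) {η : ℝ} (hη : 0 < η) {p : EE n × EE n} (hp : p ∈ ZS O A B a b η) :
    0 < a p.1 ∧ 0 < b p.2 := by
  obtain ⟨h0, h1, h2, h3⟩ := hp
  have hq : ¬ (a p.1 = 0 ∧ b p.2 = 0) := by
    rintro ⟨u, v⟩
    simp [qf, u, v] at h2
    linarith
  have h3' : PMax O b a p.2 p.1 := by
    intro k u1 u2 u3 u4
    have := h3 (-k) (by simpa [sub_eq_add_neg] using u3) (by simpa [sub_eq_add_neg] using u4)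
      (by simpa using u1) (by simpa using u2)
    simp only [sub_neg_eq_add, ← sub_eq_add_neg] at this
    linarith
  have a0 := h.hA0 _ h0
  have b0 := h.hB0 _ h1
  have hane : a p.1 ≠ 0 := by
    intro ha0
    have hb1 : 0 < b p.2 := lt_of_le_of_ne b0 (fun hh => hq ⟨ha0, hh.symm⟩)
    exact h3.pos h.Oo h.da h.db (h.AO h0) (h.BO h1) hb1 (h.ga _ h0 ha0) ha0
  have hap : 0 < a p.1 := lt_of_le_of_ne a0 hane.symm
  refine ⟨hap, lt_of_le_of_ne b0 ?_⟩
  intro hb0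
  exact h3'.pos h.Oo h.db h.da (h.BO h1) (h.AO h0) hap (h.gb _ h1 hb0.symm) hb0.symm

lemma V_ZS (h : Pair O A B a b) {η : ℝ} (hη : 0 < η) {x : EE n} (hx : η ≤ Vf A B a b x) :
    ∃ p ∈ ZS O A B a b η, (1/2:ℝ) • (p.1 + p.2) = x ∧ Vf A B a b x = qf a b p := by
  obtain ⟨x0, h0, x1, h1, h2, h3⟩ := h.V_att (hη.trans_le hx)
  refine ⟨(x0, x1), ⟨h0, h1, h3 ▸ hx, ?_⟩, h2, h3⟩
  intro k u1 u2 u3 u4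
  have := h.le_V (h.hA _ u1 u2.le) (h.hB _ u3 u4.le)
  have e : (1/2:ℝ) • (x0 + k + (x1 - k)) = x := by rw [← h2]; congr 1; abel
  rw [e, h3] at this
  simp only [qf] at this
  have h5 := sq_le_sq.1 this
  rw [abs_of_nonneg (by positivity), abs_of_nonneg (by positivity)] at h5
  linarith

end Pair


lemma sqrt_am {X Y : ℝ} (hX : 1/2 ≤ X) (hY : 1/2 ≤ Y) : (X + Y) / 2 - (X - Y) ^ 2 ≤ √(X * Y) := by
  rcases le_or_gt ((X + Y) / 2 - (X - Y) ^ 2) 0 with h | h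
  · exact h.trans (Real.sqrt_nonneg _)
  · apply Real.le_sqrt_of_sq_le
    have h1 : 0 ≤ (X - Y) ^ 2 := sq_nonneg _
    nlinarith [mul_nonneg h1 (by nlinarith : (0:ℝ) ≤ (X + Y) - (X - Y) ^ 2 - 1/4)]

lemma q_lower {W0 W1 a' b' : ℝ} (h0 : 0 < W0) (h1 : 0 < W1) (ha : W0 ^ 2 / 2 ≤ a')
    (hb : W1 ^ 2 / 2 ≤ b') :
    (W0 + W1) * (a' / W0 + b' / W1) / 4 - W0 * W1 * (a' / W0 ^ 2 - b' / W1 ^ 2) ^ 2 / 2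
      ≤ ((√a' + √b') / 2) ^ 2 := by
  have hX : 1/2 ≤ a' / W0 ^ 2 := by rw [le_div_iff₀ (by positivity)]; linarith
  have hY : 1/2 ≤ b' / W1 ^ 2 := by rw [le_div_iff₀ (by positivity)]; linarith
  have ha0 : 0 ≤ a' := le_trans (by positivity) ha
  have hb0 : 0 ≤ b' := le_trans (by positivity) hb
  have h := sqrt_am hX hY
  have e1 : √a' * √b' = W0 * W1 * √(a' / W0 ^ 2 * (b' / W1 ^ 2)) := by
    rw [← Real.sqrt_mul ha0, div_mul_div_comm, Real.sqrt_div' _ (by positivity), ← mul_pow,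
      Real.sqrt_sq (by positivity)]
    field_simp
  have e2 : ((√a' + √b') / 2) ^ 2 = (a' + b' + 2 * (√a' * √b')) / 4 := by
    have := Real.sq_sqrt ha0
    have := Real.sq_sqrt hb0
    nlinarith
  rw [e2, e1]
  have h2 := mul_le_mul_of_nonneg_left h (by positivity : 0 ≤ W0 * W1)
  have e3 : (W0 + W1) * (a' / W0 + b' / W1) = a' + b' + W0 * W1 * (a' / W0 ^ 2 + b' / W1 ^ 2) := by
    field_simp
    ring
  rw [e3]
  nlinarith

lemma rem_bound {n : ℕ} {f : EE n → ℝ} {y h : EE n} {r ε' B0 : ℝ} (hr : 0 ≤ r) (hh : ‖h‖ ≤ 2 * r)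
    (hb' : ‖fderiv ℝ (fderiv ℝ f) y‖ ≤ B0)
    (ht : |f (y + h) - f y - fderiv ℝ f y h - (1/2) * fderiv ℝ (fderiv ℝ f) y h h| ≤ ε' * ‖h‖ ^ 2)
    (hε' : 0 ≤ ε') :
    |f (y + h) - f y - fderiv ℝ f y h| ≤ (B0 / 2 + ε') * (4 * r ^ 2) := by
  have n1 : |fderiv ℝ (fderiv ℝ f) y h h| ≤ B0 * ‖h‖ ^ 2 := by
    have h1 := ContinuousLinearMap.le_opNorm (fderiv ℝ (fderiv ℝ f) y) h
    have h2 := ContinuousLinearMap.le_opNorm (fderiv ℝ (fderiv ℝ f) y h) h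
    have h3 : ‖fderiv ℝ (fderiv ℝ f) y h‖ ≤ B0 * ‖h‖ :=
      h1.trans (mul_le_mul_of_nonneg_right hb' (norm_nonneg h))
    calc |fderiv ℝ (fderiv ℝ f) y h h| = ‖fderiv ℝ (fderiv ℝ f) y h h‖ := (Real.norm_eq_abs _).symm
      _ ≤ B0 * ‖h‖ * ‖h‖ := h2.trans (mul_le_mul_of_nonneg_right h3 (norm_nonneg h))
      _ = _ := by ring
  have n2 : ‖h‖ ^ 2 ≤ 4 * r ^ 2 := by nlinarith [norm_nonneg h]
  have hB : 0 ≤ B0 := (norm_nonneg (fderiv ℝ (fderiv ℝ f) y)).trans hb'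
  generalize fderiv ℝ (fderiv ℝ f) y h h = D at *
  generalize f (y + h) - f y - fderiv ℝ f y h = R at *
  have n3 : B0 * ‖h‖ ^ 2 ≤ B0 * (4 * r ^ 2) := mul_le_mul_of_nonneg_left n2 hB
  have n4 : ε' * ‖h‖ ^ 2 ≤ ε' * (4 * r ^ 2) := mul_le_mul_of_nonneg_left n2 hε'
  rw [abs_le] at ht n1 ⊢
  constructor <;> linarith

/-- one-direction lower bound -/
lemma dir_lower {n : ℕ} {a b V : EE n → ℝ} {x0 x1 c : EE n} {r ε' B0 c0 : ℝ}
    (hc : ‖c‖ = r) (hc0 : 0 < c0) (h0 : c0 ≤ √(a x0)) (h1 : c0 ≤ √(b x1)) (hB : 0 ≤ B0) (hε' : 0 ≤ ε')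
    (foc : fderiv ℝ a x0 c / √(a x0) = fderiv ℝ b x1 c / √(b x1))
    (hV : ∀ h k, ‖h‖ ≤ 2 * r → ‖k‖ ≤ 2 * r → qf a b (x0 + h, x1 + k) ≤ V ((1/2:ℝ) • (x0 + h + (x1 + k))))
    (ha2 : ∀ h, ‖h‖ ≤ 2 * r → a x0 / 2 ≤ a (x0 + h)) (hb2 : ∀ h, ‖h‖ ≤ 2 * r → b x1 / 2 ≤ b (x1 + h))
    (hTa : ∀ h, ‖h‖ ≤ 2 * r →
      |a (x0 + h) - a x0 - fderiv ℝ a x0 h - (1/2) * fderiv ℝ (fderiv ℝ a) x0 h h| ≤ ε' * ‖h‖ ^ 2)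
    (hTb : ∀ h, ‖h‖ ≤ 2 * r →
      |b (x1 + h) - b x1 - fderiv ℝ b x1 h - (1/2) * fderiv ℝ (fderiv ℝ b) x1 h h| ≤ ε' * ‖h‖ ^ 2)
    (hBa : ‖fderiv ℝ (fderiv ℝ a) x0‖ ≤ B0) (hBb : ‖fderiv ℝ (fderiv ℝ b) x1‖ ≤ B0)
    {W0 W1 lam mu : ℝ} (hW0 : W0 = √(a x0)) (hW1 : W1 = √(b x1)) (hlam : lam = 2 * W0 / (W0 + W1))
    (hmu : mu = 2 * W1 / (W0 + W1)) :
    (W0 + W1) * (a (x0 + lam • c) / W0 + b (x1 + mu • c) / W1) / 4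
      - W0 * W1 * ((8 * (B0 / 2 + ε') / c0 ^ 2) * r ^ 2) ^ 2 / 2
      ≤ V ((1/2:ℝ) • (x0 + x1) + c) := by
  have p0 : 0 < W0 := by rw [hW0]; linarith
  have p1 : 0 < W1 := by rw [hW1]; linarith
  have q0 : c0 ≤ W0 := hW0 ▸ h0
  have q1 : c0 ≤ W1 := hW1 ▸ h1
  have a0 : a x0 = W0 ^ 2 := by
    rw [hW0, Real.sq_sqrt]
    by_contra hh
    rw [Real.sqrt_eq_zero_of_nonpos (not_le.1 hh).le] at h0; linarith
  have b0 : b x1 = W1 ^ 2 := by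
    rw [hW1, Real.sq_sqrt]
    by_contra hh
    rw [Real.sqrt_eq_zero_of_nonpos (not_le.1 hh).le] at h1; linarith
  rw [← hW0, ← hW1] at foc
  have hr : 0 ≤ r := hc ▸ norm_nonneg c
  have l0 : 0 ≤ lam := by rw [hlam]; positivity
  have m0 : 0 ≤ mu := by rw [hmu]; positivity
  have lm : lam + mu = 2 := by rw [hlam, hmu]; field_simp
  have nl : ‖lam • c‖ ≤ 2 * r := by
    rw [norm_smul, Real.norm_eq_abs, abs_of_nonneg l0, hc]; nlinarith
  have nm : ‖mu • c‖ ≤ 2 * r := by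
    rw [norm_smul, Real.norm_eq_abs, abs_of_nonneg m0, hc]; nlinarith
  have hq := hV _ _ nl nm
  have e1 : (1/2:ℝ) • (x0 + lam • c + (x1 + mu • c)) = (1/2:ℝ) • (x0 + x1) + c := by
    have : x0 + lam • c + (x1 + mu • c) = x0 + x1 + (lam + mu) • c := by rw [add_smul]; abel
    rw [this, lm, smul_add, smul_smul]; norm_num
  rw [e1] at hq
  have ql := q_lower (a' := a (x0 + lam • c)) (b' := b (x1 + mu • c)) p0 p1
    (by rw [← a0]; exact ha2 _ nl) (by rw [← b0]; exact hb2 _ nm)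
  have ra := rem_bound hr nl hBa (hTa _ nl) hε'
  have rb := rem_bound hr nm hBb (hTb _ nm) hε'
  have lin : fderiv ℝ a x0 (lam • c) / W0 ^ 2 = fderiv ℝ b x1 (mu • c) / W1 ^ 2 := by
    rw [map_smul, map_smul, smul_eq_mul, smul_eq_mul, hlam, hmu]
    have : 2 * W0 / (W0 + W1) * (fderiv ℝ a x0) c / W0 ^ 2 = 2 / (W0 + W1) * (fderiv ℝ a x0 c / W0) := by
      field_simp
    rw [this, foc]
    field_simp
  set R0 := a (x0 + lam • c) - a x0 - fderiv ℝ a x0 (lam • c)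
  set R1 := b (x1 + mu • c) - b x1 - fderiv ℝ b x1 (mu • c)
  have diff : a (x0 + lam • c) / W0 ^ 2 - b (x1 + mu • c) / W1 ^ 2 = R0 / W0 ^ 2 - R1 / W1 ^ 2 := by
    have u1 : a (x0 + lam • c) = W0 ^ 2 + fderiv ℝ a x0 (lam • c) + R0 := by rw [← a0]; ring
    have u2 : b (x1 + mu • c) = W1 ^ 2 + fderiv ℝ b x1 (mu • c) + R1 := by rw [← b0]; ring
    rw [u1, u2, add_div, add_div, add_div, add_div, lin, div_self (by positivity), div_self (by positivity)]
    ring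
  have bnd : |R0 / W0 ^ 2 - R1 / W1 ^ 2| ≤ (8 * (B0 / 2 + ε') / c0 ^ 2) * r ^ 2 := by
    have v1 : |R0 / W0 ^ 2| ≤ (B0 / 2 + ε') * (4 * r ^ 2) / c0 ^ 2 := by
      rw [abs_div, abs_of_nonneg (by positivity : 0 ≤ W0 ^ 2)]
      exact div_le_div₀ (by positivity) ra (by positivity) (by gcongr)
    have v2 : |R1 / W1 ^ 2| ≤ (B0 / 2 + ε') * (4 * r ^ 2) / c0 ^ 2 := by
      rw [abs_div, abs_of_nonneg (by positivity : 0 ≤ W1 ^ 2)]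
      exact div_le_div₀ (by positivity) rb (by positivity) (by gcongr)
    calc _ ≤ |R0 / W0 ^ 2| + |R1 / W1 ^ 2| := abs_sub _ _
      _ ≤ (B0 / 2 + ε') * (4 * r ^ 2) / c0 ^ 2 + (B0 / 2 + ε') * (4 * r ^ 2) / c0 ^ 2 := add_le_add v1 v2
      _ = _ := by ring
  have sq : (R0 / W0 ^ 2 - R1 / W1 ^ 2) ^ 2 ≤ ((8 * (B0 / 2 + ε') / c0 ^ 2) * r ^ 2) ^ 2 := by
    rw [← sq_abs (R0 / W0 ^ 2 - R1 / W1 ^ 2)]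
    exact pow_le_pow_left₀ (abs_nonneg _) bnd 2
  rw [diff] at ql
  refine le_trans ?_ (ql.trans hq)
  have : 0 ≤ W0 * W1 := by positivity
  nlinarith

lemma sym_taylor {n : ℕ} {f : EE n → ℝ} {y c : EE n} {l r ε' : ℝ} (hε' : 0 ≤ ε')
    (hn : ‖l • c‖ ≤ 2 * r)
    (hT : ∀ h, ‖h‖ ≤ 2 * r →
      |f (y + h) - f y - fderiv ℝ f y h - (1/2) * fderiv ℝ (fderiv ℝ f) y h h| ≤ ε' * ‖h‖ ^ 2) :
    2 * f y + l ^ 2 * fderiv ℝ (fderiv ℝ f) y c c - 8 * ε' * r ^ 2 ≤ f (y + l • c) + f (y + l • (-c)) := by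
  have h1 := hT _ hn
  have h2 := hT (l • (-c)) (by rw [smul_neg, norm_neg]; exact hn)
  have n2 : ‖l • c‖ ^ 2 ≤ 4 * r ^ 2 := by nlinarith [norm_nonneg (l • c)]
  have e : ‖l • (-c)‖ = ‖l • c‖ := by rw [smul_neg, norm_neg]
  rw [e] at h2
  simp only [map_smul, map_neg, smul_apply, neg_apply,
    smul_eq_mul] at h1 h2
  have n4 : ε' * ‖l • c‖ ^ 2 ≤ ε' * (4 * r ^ 2) := mul_le_mul_of_nonneg_left n2 hε'
  rw [abs_le] at h1 h2
  linarith [h1.1, h2.1]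

/-- two-sided second difference bound -/
lemma dir2 {n : ℕ} {a b V : EE n → ℝ} {x0 x1 c : EE n} {r ε' B0 c0 M : ℝ}
    (hc : ‖c‖ = r) (hc0 : 0 < c0) (h0 : c0 ≤ √(a x0)) (h1 : c0 ≤ √(b x1)) (hB : 0 ≤ B0) (hε' : 0 ≤ ε')
    (hM0 : √(a x0) ≤ M) (hM1 : √(b x1) ≤ M)
    (foc : ∀ c, fderiv ℝ a x0 c / √(a x0) = fderiv ℝ b x1 c / √(b x1))
    (hV : ∀ h k, ‖h‖ ≤ 2 * r → ‖k‖ ≤ 2 * r → qf a b (x0 + h, x1 + k) ≤ V ((1/2:ℝ) • (x0 + h + (x1 + k))))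
    (ha2 : ∀ h, ‖h‖ ≤ 2 * r → a x0 / 2 ≤ a (x0 + h)) (hb2 : ∀ h, ‖h‖ ≤ 2 * r → b x1 / 2 ≤ b (x1 + h))
    (hTa : ∀ h, ‖h‖ ≤ 2 * r →
      |a (x0 + h) - a x0 - fderiv ℝ a x0 h - (1/2) * fderiv ℝ (fderiv ℝ a) x0 h h| ≤ ε' * ‖h‖ ^ 2)
    (hTb : ∀ h, ‖h‖ ≤ 2 * r →
      |b (x1 + h) - b x1 - fderiv ℝ b x1 h - (1/2) * fderiv ℝ (fderiv ℝ b) x1 h h| ≤ ε' * ‖h‖ ^ 2)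
    (hBa : ‖fderiv ℝ (fderiv ℝ a) x0‖ ≤ B0) (hBb : ‖fderiv ℝ (fderiv ℝ b) x1‖ ≤ B0)
    {x : EE n} (hx : (1/2:ℝ) • (x0 + x1) = x) (hVx : V x = qf a b (x0, x1)) :
    (√(a x0) * fderiv ℝ (fderiv ℝ a) x0 c c + √(b x1) * fderiv ℝ (fderiv ℝ b) x1 c c)
        / (√(a x0) + √(b x1))
      - (8 * M * ε' / c0 * r ^ 2 + M ^ 2 * ((8 * (B0 / 2 + ε') / c0 ^ 2) * r ^ 2) ^ 2)
      ≤ V (x + c) + V (x - c) - 2 * V x := by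
  have p0 : 0 < √(a x0) := by linarith
  have p1 : 0 < √(b x1) := by linarith
  have hr : 0 ≤ r := hc ▸ norm_nonneg c
  have d1 := dir_lower hc hc0 h0 h1 hB hε' (foc c) hV ha2 hb2 hTa hTb hBa hBb rfl rfl rfl rfl
  have d2 := dir_lower (c := -c) (by rw [norm_neg, hc]) hc0 h0 h1 hB hε' (foc (-c)) hV ha2 hb2 hTa hTb
    hBa hBb rfl rfl rfl rfl
  rw [hx] at d1 d2
  rw [← sub_eq_add_neg] at d2
  have a0 : a x0 = √(a x0) ^ 2 := by
    rw [Real.sq_sqrt]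
    by_contra hh
    rw [Real.sqrt_eq_zero_of_nonpos (not_le.1 hh).le] at h0; linarith
  have b0 : b x1 = √(b x1) ^ 2 := by
    rw [Real.sq_sqrt]
    by_contra hh
    rw [Real.sqrt_eq_zero_of_nonpos (not_le.1 hh).le] at h1; linarith
  have s0 : ‖(2 * √(a x0) / (√(a x0) + √(b x1))) • c‖ ≤ 2 * r := by
    rw [norm_smul, Real.norm_eq_abs, abs_of_nonneg (by positivity), hc]
    apply mul_le_mul_of_nonneg_right _ hr
    rw [div_le_iff₀ (by positivity)]; linarith
  have s1 : ‖(2 * √(b x1) / (√(a x0) + √(b x1))) • c‖ ≤ 2 * r := by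
    rw [norm_smul, Real.norm_eq_abs, abs_of_nonneg (by positivity), hc]
    apply mul_le_mul_of_nonneg_right _ hr
    rw [div_le_iff₀ (by positivity)]; linarith
  have t0 := sym_taylor hε' s0 hTa
  have t1 := sym_taylor hε' s1 hTb
  rw [hVx]
  simp only [qf]
  generalize fderiv ℝ (fderiv ℝ a) x0 c c = Da at *
  generalize fderiv ℝ (fderiv ℝ b) x1 c c = Db at *
  rw [show 2 * a x0 = 2 * √(a x0) ^ 2 from congrArg _ a0] at t0
  rw [show 2 * b x1 = 2 * √(b x1) ^ 2 from congrArg _ b0] at t1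
  generalize (8 * (B0 / 2 + ε') / c0 ^ 2) * r ^ 2 = K at *
  clear foc hTa hTb ha2 hb2 hV hBa hBb hVx a0 b0 s0 s1
  generalize √(a x0) = W0 at *
  generalize √(b x1) = W1 at *
  generalize a (x0 + (2 * W0 / (W0 + W1)) • c) = A1 at *
  generalize a (x0 + (2 * W0 / (W0 + W1)) • (-c)) = A2 at *
  generalize b (x1 + (2 * W1 / (W0 + W1)) • c) = B1 at *
  generalize b (x1 + (2 * W1 / (W0 + W1)) • (-c)) = B2 at *
  have t0' := div_le_div_of_nonneg_right t0 p0.le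
  have t1' := div_le_div_of_nonneg_right t1 p1.le
  have k1 : (W0 + W1) / 4 * (((2 * W0 ^ 2 + (2 * W0 / (W0 + W1)) ^ 2 * Da - 8 * ε' * r ^ 2) / W0) +
      ((2 * W1 ^ 2 + (2 * W1 / (W0 + W1)) ^ 2 * Db - 8 * ε' * r ^ 2) / W1)) ≤
      (W0 + W1) / 4 * ((A1 + A2) / W0 + (B1 + B2) / W1) :=
    mul_le_mul_of_nonneg_left (add_le_add t0' t1') (by positivity)
  have k2 : (W0 + W1) / 4 * (((2 * W0 ^ 2 + (2 * W0 / (W0 + W1)) ^ 2 * Da - 8 * ε' * r ^ 2) / W0) +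
      ((2 * W1 ^ 2 + (2 * W1 / (W0 + W1)) ^ 2 * Db - 8 * ε' * r ^ 2) / W1)) =
      (W0 + W1) ^ 2 / 2 + (W0 * Da + W1 * Db) / (W0 + W1)
        - (W0 + W1) / 4 * (8 * ε' * r ^ 2 / W0 + 8 * ε' * r ^ 2 / W1) := by
    field_simp
    ring
  have k3 : (W0 + W1) / 4 * (8 * ε' * r ^ 2 / W0 + 8 * ε' * r ^ 2 / W1) ≤ 8 * M * ε' / c0 * r ^ 2 := by
    have u : (W0 + W1) / 4 ≤ M / 2 := by linarith
    have u0 : 8 * ε' * r ^ 2 / W0 ≤ 8 * ε' * r ^ 2 / c0 :=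
      div_le_div_of_nonneg_left (by positivity) hc0 h0
    have u1 : 8 * ε' * r ^ 2 / W1 ≤ 8 * ε' * r ^ 2 / c0 :=
      div_le_div_of_nonneg_left (by positivity) hc0 h1
    calc _ ≤ M / 2 * (8 * ε' * r ^ 2 / c0 + 8 * ε' * r ^ 2 / c0) := by
          apply mul_le_mul u (add_le_add u0 u1) (by positivity) (by linarith)
      _ = _ := by ring
  have k4 : W0 * W1 * K ^ 2 ≤ M ^ 2 * K ^ 2 := by
    apply mul_le_mul_of_nonneg_right _ (sq_nonneg _)
    nlinarith
  have k5 : (W0 + W1) / 4 * ((A1 + A2) / W0 + (B1 + B2) / W1) =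
    (W0 + W1) * (A1 / W0 + B1 / W1) / 4 + (W0 + W1) * (A2 / W0 + B2 / W1) / 4 := by ring
  nlinarith


lemma side_const {n : ℕ} {a : EE n → ℝ} (ha : ContDiff ℝ 2 a) {K : Set (EE n)} (hK : IsCompact K)
    (hp : ∀ x ∈ K, 0 < a x) :
    ∃ c0 > 0, ∃ M ≥ 1, ∃ B0 ≥ 0, ∀ x ∈ K, c0 ≤ √(a x) ∧ √(a x) ≤ M ∧ ‖fderiv ℝ (fderiv ℝ a) x‖ ≤ B0 := by
  have hf1 : ContDiff ℝ 1 (fderiv ℝ a) := ha.fderiv_right (by norm_num)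
  have hG : Continuous (fderiv ℝ (fderiv ℝ a)) := hf1.continuous_fderiv (by norm_num)
  have hc := ha.continuous
  obtain ⟨C1, h1⟩ := hK.exists_bound_of_continuousOn (f := fun x => (√(a x))⁻¹)
    (ContinuousOn.inv₀ (by fun_prop) (fun x hx => (Real.sqrt_pos.2 (hp x hx)).ne'))
  obtain ⟨C2, h2⟩ := hK.exists_bound_of_continuousOn (f := fun x => √(a x)) (by fun_prop)
  obtain ⟨C3, h3⟩ := hK.exists_bound_of_continuousOn (f := fderiv ℝ (fderiv ℝ a)) hG.continuousOn
  refine ⟨(max C1 1)⁻¹, by positivity, max C2 1, le_max_right _ _, max C3 0, le_max_right _ _,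
    fun x hx => ⟨?_, ?_, ?_⟩⟩
  · have := h1 x hx
    have hs := Real.sqrt_pos.2 (hp x hx)
    rw [Real.norm_eq_abs, abs_of_pos (by positivity)] at this
    rw [inv_le_comm₀ (by positivity) hs]
    exact this.trans (le_max_left _ _)
  · have := h2 x hx
    rw [Real.norm_eq_abs, abs_of_nonneg (by positivity)] at this
    exact this.trans (le_max_left _ _)
  · exact (h3 x hx).trans (le_max_left _ _)

lemma side_nbhd {n : ℕ} {a : EE n → ℝ} (ha : ContDiff ℝ 2 a) {K O : Set (EE n)} (hK : IsCompact K)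
    (hO : IsOpen O) (hKO : K ⊆ O) (hp : ∀ x ∈ K, 0 < a x) {ε' : ℝ} (hε' : 0 < ε') :
    ∃ r0 > 0, ∀ x ∈ K, ∀ h, ‖h‖ ≤ r0 → x + h ∈ O ∧ a x / 2 ≤ a (x + h) ∧
      |a (x + h) - a x - fderiv ℝ a x h - (1/2) * fderiv ℝ (fderiv ℝ a) x h h| ≤ ε' * ‖h‖ ^ 2 := by
  obtain ⟨c0, hc0, M, hM, B0, hB0, H⟩ := side_const ha hK hp
  obtain ⟨d1, hd1, H1⟩ := hK.exists_cthickening_subset_open hO hKO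
  obtain ⟨d2, hd2, H2⟩ := unif_cont_compact' (G := a) ha.continuous hK (ε := c0 ^ 2 / 2) (by positivity)
  obtain ⟨d3, hd3, H3⟩ := taylor2 ha hK hε'
  refine ⟨min d1 (min d2 d3), by positivity, fun x hx h hh => ⟨?_, ?_, ?_⟩⟩
  · apply H1
    apply Metric.mem_cthickening_of_dist_le _ x _ _ hx
    simpa using hh.trans (min_le_left _ _)
  · have := H2 x hx (x + h) (by simpa using hh.trans ((min_le_right _ _).trans (min_le_left _ _)))
    have h2 : c0 ^ 2 ≤ a x := by
      rw [← Real.sq_sqrt (hp x hx).le]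
      exact pow_le_pow_left₀ hc0.le (H x hx).1 2
    rw [Real.norm_eq_abs, abs_le] at this
    linarith
  · exact H3 x hx h (hh.trans ((min_le_right _ _).trans (min_le_right _ _)))

lemma lap_zero_off {n : ℕ} {φ : EE n → ℝ} (hφ : ContDiff ℝ 2 φ) {x : EE n} (hx : x ∉ tsupport φ) :
    lap φ x = 0 := by
  rw [lap_eq hφ]
  have h1 : x ∉ tsupport (fderiv ℝ φ) := fun h => hx (tsupport_fderiv_subset ℝ h)
  have h2 : x ∉ tsupport (fderiv ℝ (fderiv ℝ φ)) := fun h => h1 (tsupport_fderiv_subset ℝ h)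
  rw [image_eq_zero_of_notMem_tsupport h2]
  simp

lemma lap_supp {n : ℕ} {φ : EE n → ℝ} (hφ : ContDiff ℝ 2 φ) (hc : HasCompactSupport φ) :
    HasCompactSupport (lap φ) := HasCompactSupport.of_support_subset_isCompact hc.isCompact
      (fun _ hx => by by_contra h; exact hx (lap_zero_off hφ h))

namespace Pair
variable {n : ℕ} {O A B : Set (EE n)} {a b : EE n → ℝ}

lemma dlap_V (h : Pair O A B a b) {η ε : ℝ} (hη : 0 < η) (hε : 0 < ε) :
    ∃ r0 > 0, ∀ r, 0 < r → r ≤ r0 → ∀ x, η ≤ Vf A B a b x →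
      (-2 - ε) * r ^ 2 ≤ dlap r (Vf A B a b) x := by
  have hZ := h.ZS_compact η
  set K0 := Prod.fst '' ZS O A B a b η with hK0
  set K1 := Prod.snd '' ZS O A B a b η with hK1
  have cK0 : IsCompact K0 := hZ.image continuous_fst
  have cK1 : IsCompact K1 := hZ.image continuous_snd
  have pK0 : ∀ x ∈ K0, 0 < a x := by rintro _ ⟨p, hp, rfl⟩; exact (h.ZS_pos hη hp).1
  have pK1 : ∀ x ∈ K1, 0 < b x := by rintro _ ⟨p, hp, rfl⟩; exact (h.ZS_pos hη hp).2
  have oK0 : K0 ⊆ O := by rintro _ ⟨p, hp, rfl⟩; exact h.AO hp.1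
  have oK1 : K1 ⊆ O := by rintro _ ⟨p, hp, rfl⟩; exact h.BO hp.2.1
  obtain ⟨c0, hc0, M0, hM0, B0, hB0, H0⟩ := side_const h.ha cK0 pK0
  obtain ⟨c1, hc1, M1, hM1, B1, hB1, H1⟩ := side_const h.hb cK1 pK1
  set c := min c0 c1
  set M := max M0 M1
  set B' := max B0 B1
  have hc : 0 < c := lt_min hc0 hc1
  have hM : 1 ≤ M := hM0.trans (le_max_left _ _)
  have hB : 0 ≤ B' := hB0.trans (le_max_left _ _)
  set ε' := min 1 (ε * c / (16 * (n + 1) * M)) with hε'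
  have e'0 : 0 < ε' := by positivity
  have e'1 : ε' ≤ 1 := min_le_left _ _
  have e'2 : 8 * M * ε' / c ≤ ε / (2 * (n + 1)) := by
    have : ε' ≤ ε * c / (16 * (n + 1) * M) := min_le_right _ _
    rw [le_div_iff₀ (by positivity)] at this
    rw [div_le_div_iff₀ hc (by positivity)]
    linarith
  obtain ⟨r1, hr1, N0⟩ := side_nbhd h.ha cK0 h.Oo oK0 pK0 e'0
  obtain ⟨r2, hr2, N1⟩ := side_nbhd h.hb cK1 h.Oo oK1 pK1 e'0
  set K := 8 * (B' / 2 + ε') / c ^ 2 with hK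
  have hK0 : 0 < K := by positivity
  set r3 := √(ε / (2 * (n + 1)) / (M ^ 2 * K ^ 2)) with hr3
  refine ⟨min (r1 / 2) (min (r2 / 2) r3), by positivity, fun r hr hrr x hx => ?_⟩
  have rr1 : 2 * r ≤ r1 := by have := hrr.trans (min_le_left _ _); linarith
  have rr2 : 2 * r ≤ r2 := by
    have := hrr.trans ((min_le_right _ _).trans (min_le_left _ _)); linarith
  have rr3 : M ^ 2 * K ^ 2 * r ^ 2 ≤ ε / (2 * (n + 1)) := by
    have : r ≤ r3 := hrr.trans ((min_le_right _ _).trans (min_le_right _ _))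
    have := (Real.le_sqrt hr.le (by positivity)).1 this
    rw [le_div_iff₀ (by positivity)] at this
    linarith
  obtain ⟨⟨x0, x1⟩, hp, hmid, hVx⟩ := h.V_ZS hη hx
  simp only at hmid
  have i0 : x0 ∈ K0 := ⟨_, hp, rfl⟩
  have i1 : x1 ∈ K1 := ⟨_, hp, rfl⟩
  have foc := PMax.foc h.Oo h.da h.db hp.2.2.2 (oK0 i0) (oK1 i1) (pK0 _ i0) (pK1 _ i1)
  simp only at foc
  have hx0 := pK0 _ i0
  have hx1 := pK1 _ i1
  have key : ∀ i : Fin n, r ^ 2 * ((√(a x0) * fderiv ℝ (fderiv ℝ a) x0 (EuclideanSpace.single i 1) (EuclideanSpace.single i 1)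
      + √(b x1) * fderiv ℝ (fderiv ℝ b) x1 (EuclideanSpace.single i 1) (EuclideanSpace.single i 1))
      / (√(a x0) + √(b x1))) - ε / (n + 1) * r ^ 2 ≤
      Vf A B a b (x + r • EuclideanSpace.single i 1) + Vf A B a b (x - r • EuclideanSpace.single i 1)
        - 2 * Vf A B a b x := by
    intro i
    have hn : ‖r • (EuclideanSpace.single i 1 : EE n)‖ = r := by
      simp [norm_smul, abs_of_pos hr]
    have d := dir2 (V := Vf A B a b) hn hc ((min_le_left _ _).trans (H0 _ i0).1)
      ((min_le_right _ _).trans (H1 _ i1).1) hB e'0.le ((H0 _ i0).2.1.trans (le_max_left _ _))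
      ((H1 _ i1).2.1.trans (le_max_right _ _)) foc
      (fun u v hu hv => h.le_V
        (h.hA _ (N0 _ i0 u (hu.trans rr1)).1 (le_trans (by linarith) (N0 _ i0 u (hu.trans rr1)).2.1))
        (h.hB _ (N1 _ i1 v (hv.trans rr2)).1 (le_trans (by linarith) (N1 _ i1 v (hv.trans rr2)).2.1)))
      (fun u hu => (N0 _ i0 u (hu.trans rr1)).2.1) (fun u hu => (N1 _ i1 u (hu.trans rr2)).2.1)
      (fun u hu => (N0 _ i0 u (hu.trans rr1)).2.2) (fun u hu => (N1 _ i1 u (hu.trans rr2)).2.2)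
      ((H0 _ i0).2.2.trans (le_max_left _ _)) ((H1 _ i1).2.2.trans (le_max_right _ _)) hmid hVx
    refine le_trans ?_ d
    rw [← hK]
    simp only [map_smul, smul_apply, smul_eq_mul]
    have e1 : 8 * M * ε' / c * r ^ 2 ≤ ε / (2 * (n + 1)) * r ^ 2 :=
      mul_le_mul_of_nonneg_right e'2 (sq_nonneg _)
    have e2 : M ^ 2 * (K * r ^ 2) ^ 2 ≤ ε / (2 * (n + 1)) * r ^ 2 := by
      calc _ = M ^ 2 * K ^ 2 * r ^ 2 * r ^ 2 := by ring
        _ ≤ _ := mul_le_mul_of_nonneg_right rr3 (sq_nonneg _)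
    have e3 : ε / (n + 1) * r ^ 2 = ε / (2 * (n + 1)) * r ^ 2 + ε / (2 * (n + 1)) * r ^ 2 := by
      field_simp; ring
    rw [e3]
    have e4 : ∀ p q u v w : ℝ, r ^ 2 * ((p * u + q * v) / w) = (p * (r * (r * u)) + q * (r * (r * v))) / w := by
      intros; ring
    rw [e4]
    linarith
  have hsum := Finset.sum_le_sum (fun i (_ : i ∈ Finset.univ) => key i)
  rw [dlap]
  refine le_trans ?_ hsum
  rw [Finset.sum_sub_distrib, ← Finset.mul_sum, ← Finset.sum_div, Finset.sum_add_distrib,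
    ← Finset.mul_sum, ← Finset.mul_sum, ← lap_eq h.ha, ← lap_eq h.hb, h.la _ hp.1, h.lb _ hp.2.1]
  have w0 : 0 < √(a x0) := Real.sqrt_pos.2 hx0
  have w1 : 0 < √(b x1) := Real.sqrt_pos.2 hx1
  have e5 : (√(a x0) * -2 + √(b x1) * -2) / (√(a x0) + √(b x1)) = -2 := by field_simp; ring
  rw [e5]
  simp only [Finset.sum_const, Finset.card_univ, Fintype.card_fin, nsmul_eq_mul]
  have e6 : (n:ℝ) * (ε / (n + 1) * r ^ 2) ≤ ε * r ^ 2 := by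
    have : (n:ℝ) * (ε / (n + 1)) ≤ ε := by
      rw [mul_div_assoc', div_le_iff₀ (by positivity)]; linarith
    nlinarith [sq_nonneg r]
  linarith

lemma V_supp (h : Pair O A B a b) {x : EE n} (hx : Vf A B a b x ≠ 0) :
    x ∈ (fun p : EE n × EE n => (1/2:ℝ) • (p.1 + p.2)) '' (A ×ˢ B) := by
  obtain ⟨x0, h0, x1, h1, h2, h3⟩ := h.V_att (lt_of_le_of_ne (h.V_nonneg x) (Ne.symm hx))
  exact ⟨(x0, x1), ⟨h0, h1⟩, h2⟩

lemma V_int (h : Pair O A B a b) : Integrable (Vf A B a b) := by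
  have hc : IsCompact ((fun p : EE n × EE n => (1/2:ℝ) • (p.1 + p.2)) '' (A ×ˢ B)) :=
    (h.Ac.prod h.Bc).image (by fun_prop)
  obtain ⟨M, hM0, hM⟩ := h.V_le
  have hi : IntegrableOn (Vf A B a b) ((fun p : EE n × EE n => (1/2:ℝ) • (p.1 + p.2)) '' (A ×ˢ B)) := by
    apply Measure.integrableOn_of_bounded (M := M) hc.measure_lt_top.ne h.V_meas.aestronglyMeasurable
    refine Eventually.of_forall fun x => ?_
    rw [Real.norm_eq_abs, abs_of_nonneg (h.V_nonneg x)]; exact hM x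
  exact (integrableOn_iff_integrable_of_support_subset (fun x hx => h.V_supp hx)).1 hi

lemma V_test (h : Pair O A B a b) {φ : EE n → ℝ} (hφ : ContDiff ℝ 2 φ) (hc : HasCompactSupport φ)
    (h0 : ∀ x, 0 ≤ φ x) : -2 * ∫ x, φ x ≤ ∫ x, Vf A B a b x * lap φ x := by
  have hlc := lap_continuous hφ
  have hls : HasCompactSupport (lap φ) := lap_supp hφ hc
  have hli : Integrable (lap φ) := hlc.integrable_of_hasCompactSupport hls
  obtain ⟨C, hC⟩ : ∃ C, ∀ x, ‖lap φ x‖ ≤ C := hls.exists_bound_of_continuous hlc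
  have hVi := h.V_int
  have hm : ∀ η > 0, -2 * ∫ x, φ x ≤ ∫ x, max (Vf A B a b x - η) 0 * lap φ x := by
    intro η hη
    have hmi : Integrable (fun x => max (Vf A B a b x - η) 0) := by
      refine hVi.mono' ((h.V_meas.sub_const η).max measurable_const).aestronglyMeasurable
        (Eventually.of_forall fun x => ?_)
      rw [Real.norm_eq_abs, abs_of_nonneg (le_max_right _ _)]
      exact max_le (by linarith) (h.V_nonneg x)
    apply subharm_test hmi.locallyIntegrable hφ hc h0
    intro ε hε
    obtain ⟨r0, hr0, H⟩ := h.dlap_V hη hε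
    refine ⟨r0, hr0, fun r hr hrr x _ => ?_⟩
    rcases le_or_gt η (Vf A B a b x) with hx | hx
    · refine (H r hr hrr x hx).trans ?_
      unfold dlap
      apply Finset.sum_le_sum
      intro i _
      have e : max (Vf A B a b x - η) 0 = Vf A B a b x - η := max_eq_left (by linarith)
      simp only [e]
      have := le_max_left (Vf A B a b (x + r • EuclideanSpace.single i 1) - η) 0
      have := le_max_left (Vf A B a b (x - r • EuclideanSpace.single i 1) - η) 0
      linarith
    · have e : max (Vf A B a b x - η) 0 = 0 := max_eq_right (by linarith)
      have : 0 ≤ dlap r (fun x => max (Vf A B a b x - η) 0) x := by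
        unfold dlap
        apply Finset.sum_nonneg
        intro i _
        simp only [e]
        have := le_max_right (Vf A B a b (x + r • EuclideanSpace.single i 1) - η) 0
        have := le_max_right (Vf A B a b (x - r • EuclideanSpace.single i 1) - η) 0
        linarith
      nlinarith [sq_nonneg r]
  have hprod : Integrable (fun x => Vf A B a b x * lap φ x) := by
    apply hVi.mul_bdd (c := C) hlc.aestronglyMeasurable (Eventually.of_forall hC)
  have hlim : Tendsto (fun η : ℝ => ∫ x, max (Vf A B a b x - η) 0 * lap φ x) (𝓝[>] 0)
      (𝓝 (∫ x, Vf A B a b x * lap φ x)) := by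
    apply tendsto_integral_filter_of_dominated_convergence (fun x => ‖Vf A B a b x * lap φ x‖)
    · refine Eventually.of_forall fun η => ?_
      exact (((h.V_meas.sub_const η).max measurable_const).mul hlc.measurable).aestronglyMeasurable
    · filter_upwards [self_mem_nhdsWithin] with η hη
      refine Eventually.of_forall fun x => ?_
      rw [norm_mul, norm_mul]
      apply mul_le_mul_of_nonneg_right _ (norm_nonneg _)
      rw [Real.norm_eq_abs, Real.norm_eq_abs, abs_of_nonneg (le_max_right _ _), abs_of_nonneg (h.V_nonneg x)]
      exact max_le (by have : 0 < η := hη; linarith) (h.V_nonneg x)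
    · exact hprod.norm
    · refine Eventually.of_forall fun x => ?_
      have : Tendsto (fun η : ℝ => max (Vf A B a b x - η) 0 * lap φ x) (𝓝 0) (𝓝 (max (Vf A B a b x - 0) 0 * lap φ x)) := by
        apply Continuous.tendsto; fun_prop
      rw [sub_zero, max_eq_left (h.V_nonneg x)] at this
      exact this.mono_left nhdsWithin_le_nhds
  exact ge_of_tendsto hlim (by filter_upwards [self_mem_nhdsWithin] with η hη using hm η hη)
end Pair


structure Core {m : ℕ} (Ω : Set (EE (m+1))) (U w b : EE (m+1) → ℝ) : Prop where
  dom : Dom Ω U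
  hw : ContDiff ℝ 2 w
  hb : Continuous b
  lU : ∀ x ∈ interior Ω, lap U x = -2
  lw : ∀ x ∈ interior Ω, lap w x = 0
  alg : ∀ y ∈ frontier Ω, ∀ p, fderiv ℝ U y p = - w y →
    fderiv ℝ (fderiv ℝ U) y p p + 2 * fderiv ℝ w y p ≤ - b y
  str : ∀ y ∈ frontier Ω, ∀ u, fderiv ℝ U y u = 0 → u ≠ 0 → fderiv ℝ (fderiv ℝ U) y u u < 0
  orth : ∫ x in frontier Ω, w x * ‖gradient U x‖ ∂μH[(m:ℝ)] = 0

/-- first difference quotient limit -/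
lemma lim_d1 {n : ℕ} {f : EE n → ℝ} (hf : ContDiff ℝ 2 f) {x q : ℕ → EE n} {y p : EE n} {ρ : ℕ → ℝ}
    (hx : Tendsto x atTop (𝓝 y)) (hq : Tendsto q atTop (𝓝 p)) (hρ : Tendsto ρ atTop (𝓝 0))
    (hρ0 : ∀ k, 0 < ρ k) :
    Tendsto (fun k => (f (x k + ρ k • q k) - f (x k)) / ρ k) atTop (𝓝 (fderiv ℝ f y p)) := by
  have hs : HasStrictFDerivAt f (fderiv ℝ f y) y := hf.hasStrictFDerivAt (by norm_num)
  have hpair : Tendsto (fun k => (x k + ρ k • q k, x k)) atTop (𝓝 (y, y)) := by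
    have h1 : Tendsto (fun k => x k + ρ k • q k) atTop (𝓝 (y + (0:ℝ) • p)) := hx.add (hρ.smul hq)
    rw [zero_smul, add_zero] at h1
    exact h1.prodMk_nhds hx
  have ho := hs.isLittleO.comp_tendsto hpair
  have ho2 : (fun k => f (x k + ρ k • q k) - f (x k) - fderiv ℝ f y (ρ k • q k)) =o[atTop] ρ := by
    have h2 : (fun k => ρ k • q k) =O[atTop] ρ := by
      have hb : (q) =O[atTop] (fun _ => (1:ℝ)) := hq.isBigO_one ℝ
      simpa using (Asymptotics.isBigO_refl ρ atTop).smul hb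
    refine (ho.congr_left ?_).trans_isBigO (h2.congr_left ?_)
    · intro k; simp [Function.comp]
    · intro k; simp [Function.comp]
  have h3 := (ho2.tendsto_div_nhds_zero).add (((fderiv ℝ f y).continuous.tendsto p).comp hq)
  rw [zero_add] at h3
  refine h3.congr fun k => ?_
  have := (hρ0 k).ne'
  simp only [Function.comp, map_smul, smul_eq_mul]
  field_simp
  ring

/-- second difference quotient limit -/
lemma lim_d2 {n : ℕ} {f : EE n → ℝ} (hf : ContDiff ℝ 2 f) {K : Set (EE n)} (hK : IsCompact K)
    {x q : ℕ → EE n} {y p : EE n} {ρ : ℕ → ℝ} (hxK : ∀ k, x k ∈ K)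
    (hx : Tendsto x atTop (𝓝 y)) (hq : Tendsto q atTop (𝓝 p)) (hρ : Tendsto ρ atTop (𝓝 0))
    (hρ0 : ∀ k, 0 < ρ k) (hq1 : ∀ k, ‖q k‖ ≤ 1) :
    Tendsto (fun k => (f (x k + ρ k • q k) + f (x k - ρ k • q k) - 2 * f (x k)) / ρ k ^ 2) atTop
      (𝓝 (fderiv ℝ (fderiv ℝ f) y p p)) := by
  have hf1 : ContDiff ℝ 1 (fderiv ℝ f) := hf.fderiv_right (by norm_num)
  have hG : Continuous (fderiv ℝ (fderiv ℝ f)) := hf1.continuous_fderiv (by norm_num)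
  have hD : Tendsto (fun k => fderiv ℝ (fderiv ℝ f) (x k) (q k) (q k)) atTop
      (𝓝 (fderiv ℝ (fderiv ℝ f) y p p)) := by
    have hc : Continuous (fun z : EE n × EE n => fderiv ℝ (fderiv ℝ f) z.1 z.2 z.2) := by fun_prop
    exact (hc.tendsto (y, p)).comp (hx.prodMk_nhds hq)
  have h0 : Tendsto (fun k => (f (x k + ρ k • q k) + f (x k - ρ k • q k) - 2 * f (x k)) / ρ k ^ 2
      - fderiv ℝ (fderiv ℝ f) (x k) (q k) (q k)) atTop (𝓝 0) := by
    rw [Metric.tendsto_nhds]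
    intro ε hε
    obtain ⟨r, hr, H⟩ := taylor2 hf hK (ε := ε / 4) (by positivity)
    filter_upwards [hρ.eventually (gt_mem_nhds hr)] with k hk
    have hn : ‖ρ k • q k‖ ≤ ρ k := by
      rw [norm_smul, Real.norm_eq_abs, abs_of_pos (hρ0 k)]
      nlinarith [hq1 k, hρ0 k]
    have h1 := H _ (hxK k) (ρ k • q k) (hn.trans hk.le)
    have h2 := H _ (hxK k) (-(ρ k • q k)) (by rw [norm_neg]; exact hn.trans hk.le)
    rw [norm_neg] at h2
    have n2 : ε / 4 * ‖ρ k • q k‖ ^ 2 ≤ ε / 4 * ρ k ^ 2 := by gcongr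
    simp only [map_smul, map_neg, smul_apply, neg_apply, smul_eq_mul, ← sub_eq_add_neg] at h1 h2
    rw [Real.dist_eq, sub_zero]
    have hp := hρ0 k
    have hp2 : 0 < ρ k ^ 2 := by positivity
    have e : (f (x k + ρ k • q k) + f (x k - ρ k • q k) - 2 * f (x k)) / ρ k ^ 2
      - fderiv ℝ (fderiv ℝ f) (x k) (q k) (q k) = (f (x k + ρ k • q k) + f (x k - ρ k • q k) - 2 * f (x k)
        - ρ k ^ 2 * fderiv ℝ (fderiv ℝ f) (x k) (q k) (q k)) / ρ k ^ 2 := by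
      field_simp
    rw [e, abs_div, abs_of_pos hp2, div_lt_iff₀ hp2]
    have : ε / 2 * ρ k ^ 2 < ε * ρ k ^ 2 := by nlinarith
    refine lt_of_le_of_lt ?_ this
    rw [abs_le] at h1 h2 ⊢
    constructor <;> linarith [h1.1, h1.2, h2.1, h2.2]
  simpa using h0.add hD

namespace Core
variable {m : ℕ} {Ω : Set (EE (m+1))} {U w b : EE (m+1) → ℝ}

lemma strict_mid (h : Core Ω U w b) {X0 X1 : EE (m+1)} (h0 : X0 ∈ Ω) (h1 : X1 ∈ Ω)
    (hy : (1/2:ℝ) • (X0 + X1) ∈ frontier Ω) : X0 = X1 := by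
  by_contra hne
  set y := (1/2:ℝ) • (X0 + X1) with hyd
  set u := (1/2:ℝ) • (X0 - X1) with hud
  have hu : u ≠ 0 := smul_ne_zero (by norm_num) (sub_ne_zero.2 hne)
  have hX0 : X0 = y + u := by rw [hyd, hud, ← smul_add]; simp [← two_smul ℝ X0, smul_smul]
  have hX1 : X1 = y - u := by
    rw [hyd, hud, ← smul_sub]
    have : X0 + X1 - (X0 - X1) = (2:ℝ) • X1 := by rw [two_smul]; abel
    rw [this, smul_smul]; norm_num
  have hseg : ∀ t : ℝ, |t| < 1 → y + t • u ∈ Ω := by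
    intro t ht
    rw [abs_lt] at ht
    have := h.dom.conv h0 h1 (show 0 ≤ (1 + t) / 2 by linarith) (show 0 ≤ (1 - t) / 2 by linarith) (by ring)
    convert this using 1
    rw [hX0, hX1]; module
  have hfr : ∀ t : ℝ, |t| < 1 → y + t • u ∈ frontier Ω := by
    intro t ht
    rcases h.dom.mem_cases (hseg t ht) with hi | hf
    · exfalso
      have ht' : |(-t)| < 1 := by rwa [abs_neg]
      have := h.dom.conv.combo_interior_self_mem_interior hi (hseg (-t) ht') (a := 1/2) (b := 1/2)
        (by norm_num) (by norm_num) (by norm_num)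
      have e : (1/2:ℝ) • (y + t • u) + (1/2:ℝ) • (y + (-t) • u) = y := by module
      rw [e] at this
      exact hy.2 this
    · exact hf
  have hz : ∀ t : ℝ, |t| < 1 → U (y + t • u) = 0 := fun t ht => h.dom.zero _ (hfr t ht)
  have hev : (fun t : ℝ => U (y + t • u)) =ᶠ[𝓝 0] fun _ => 0 := by
    filter_upwards [Metric.ball_mem_nhds (0:ℝ) one_pos] with t ht
    exact hz t (by simpa [Real.dist_eq] using ht)
  have hUd : Differentiable ℝ U := h.dom.hU.differentiable (by norm_num)
  have hd := line_deriv (hUd y) u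
  have hd0 : fderiv ℝ U y u = 0 := by
    have := hd.congr_of_eventuallyEq hev.symm
    exact this.unique (hasDerivAt_const _ _)
  have hlim := lim_d2 h.dom.hU h.dom.cpt (x := fun _ => y) (q := fun _ => (‖u‖⁻¹) • u) (y := y) (p := ‖u‖⁻¹ • u)
    (ρ := fun k => ‖u‖ / (k + 2)) (fun _ => h.dom.frsub hy) tendsto_const_nhds tendsto_const_nhds
    (by
      apply Tendsto.div_atTop tendsto_const_nhds
      exact tendsto_atTop_add_const_right _ _ tendsto_natCast_atTop_atTop)
    (fun k => by have := norm_pos_iff.2 hu; positivity)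
    (fun k => by rw [norm_smul, norm_inv, norm_norm, inv_mul_cancel₀ (norm_ne_zero_iff.2 hu)])
  have hn := norm_ne_zero_iff.2 hu
  have hz2 : ∀ k : ℕ, (U (y + (‖u‖ / (k + 2)) • ‖u‖⁻¹ • u) + U (y - (‖u‖ / (k + 2)) • ‖u‖⁻¹ • u) - 2 * U y) / (‖u‖ / (k + 2)) ^ 2 = 0 := by
    intro k
    have hb : |((k:ℝ) + 2)⁻¹| < 1 := by
      rw [abs_of_pos (by positivity)]
      apply inv_lt_one_of_one_lt₀
      have : (0:ℝ) ≤ k := Nat.cast_nonneg k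
      linarith
    have e1 : (‖u‖ / ((k:ℝ) + 2)) • ‖u‖⁻¹ • u = ((k:ℝ) + 2)⁻¹ • u := by
      rw [smul_smul]; congr 1; field_simp
    have e2 : y - ((k:ℝ) + 2)⁻¹ • u = y + (-((k:ℝ) + 2)⁻¹) • u := by rw [neg_smul]; abel
    rw [e1, e2, hz _ hb, hz _ (by rwa [abs_neg]), h.dom.zero _ hy]
    simp
  have := hlim.congr hz2
  have h3 := tendsto_nhds_unique this tendsto_const_nhds
  have h4 := h.str y hy (‖u‖⁻¹ • u) (by rw [map_smul, hd0, smul_zero]) (smul_ne_zero (inv_ne_zero hn) hu)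
  linarith

lemma layer_bound (h : Core Ω U w b) (C : ℝ) {ε : ℝ} (hε : 0 < ε) :
    ∃ κ > 0, ∃ s0 > 0, ∀ s, 0 < s → s < s0 → ∀ x0 ∈ Ω, ∀ x1 ∈ Ω,
      U ((1/2:ℝ) • (x0 + x1)) ≤ (C + κ) * s → C * s ≤ U x0 + s * w x0 → C * s ≤ U x1 - s * w x1 →
      (U x0 + s * w x0 + (U x1 - s * w x1)) / 2 ≤ U ((1/2:ℝ) • (x0 + x1))
        + s ^ 2 * (- b ((1/2:ℝ) • (x0 + x1)) / 2 + ε) := by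
  by_contra hcon
  push Not at hcon
  have hk : ∀ k : ℕ, (0:ℝ) < 1 / (k + 1) := fun k => by positivity
  choose s hs0 hs1 x0 hx0 x1 hx1 hU hA hB hV using fun k : ℕ => hcon (1 / (k + 1)) (hk k) (1 / (k + 1)) (hk k)
  set r : ℕ → EE (m+1) := fun k => (1/2:ℝ) • (x0 k - x1 k) with hr
  set x : ℕ → EE (m+1) := fun k => (1/2:ℝ) • (x0 k + x1 k) with hx
  set ρ : ℕ → ℝ := fun k => max (s k) ‖r k‖ with hρ
  have hρ0 : ∀ k, 0 < ρ k := fun k => lt_max_of_lt_left (hs0 k)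
  set q : ℕ → EE (m+1) := fun k => (ρ k)⁻¹ • r k with hq
  set σ : ℕ → ℝ := fun k => s k / ρ k with hσ
  have hq1 : ∀ k, ‖q k‖ ≤ 1 := by
    intro k
    rw [hq]; simp only
    rw [norm_smul, norm_inv, Real.norm_eq_abs, abs_of_pos (hρ0 k), inv_mul_le_iff₀ (hρ0 k), mul_one]
    exact le_max_right _ _
  have hσ1 : ∀ k, σ k ∈ Icc (0:ℝ) 1 := fun k =>
    ⟨div_nonneg (hs0 k).le (hρ0 k).le, (div_le_one (hρ0 k)).2 (le_max_left _ _)⟩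
  have hmax : ∀ k, max (σ k) ‖q k‖ = 1 := by
    intro k
    have e : ‖q k‖ = ‖r k‖ / ρ k := by
      rw [hq]; simp only
      rw [norm_smul, norm_inv, Real.norm_eq_abs, abs_of_pos (hρ0 k)]; ring
    rw [e, hσ]; simp only
    rw [max_div_div_right (hρ0 k).le]
    exact div_self (hρ0 k).ne'
  have hKc : IsCompact (Ω ×ˢ Ω ×ˢ Metric.closedBall (0:EE (m+1)) 1 ×ˢ Icc (0:ℝ) 1) :=
    h.dom.cpt.prod (h.dom.cpt.prod ((isCompact_closedBall _ _).prod isCompact_Icc))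
  obtain ⟨⟨X0, X1, Q, τ⟩, hmem, φ, hφ, hlim⟩ := hKc.tendsto_subseq (x := fun k => (x0 k, x1 k, q k, σ k))
    (fun k => ⟨hx0 k, hx1 k, by simpa using hq1 k, hσ1 k⟩)
  have l0 : Tendsto (fun k => x0 (φ k)) atTop (𝓝 X0) := (continuous_fst.tendsto _).comp hlim
  have hlim2 := (continuous_snd.tendsto _).comp hlim
  have l1 : Tendsto (fun k => x1 (φ k)) atTop (𝓝 X1) := (continuous_fst.tendsto _).comp hlim2
  have hlim3 := (continuous_snd.tendsto _).comp hlim2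
  have lq : Tendsto (fun k => q (φ k)) atTop (𝓝 Q) := (continuous_fst.tendsto _).comp hlim3
  have lσ : Tendsto (fun k => σ (φ k)) atTop (𝓝 τ) := (continuous_snd.tendsto _).comp hlim3
  have linv : Tendsto (fun k : ℕ => 1 / ((φ k : ℝ) + 1)) atTop (𝓝 0) :=
    (tendsto_one_div_add_atTop_nhds_zero_nat (𝕜 := ℝ)).comp hφ.tendsto_atTop
  have ls : Tendsto (fun k => s (φ k)) atTop (𝓝 0) :=
    squeeze_zero (fun k => (hs0 _).le) (fun k => (hs1 (φ k)).le) linv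
  have lx : Tendsto (fun k => x (φ k)) atTop (𝓝 ((1/2:ℝ) • (X0 + X1))) := (l0.add l1).const_smul _
  have hyΩ : (1/2:ℝ) • (X0 + X1) ∈ Ω := by
    have := h.dom.conv hmem.1 hmem.2.1 (show (0:ℝ) ≤ 1/2 by norm_num) (show (0:ℝ) ≤ 1/2 by norm_num) (by norm_num)
    rwa [← smul_add] at this
  have hyU : U ((1/2:ℝ) • (X0 + X1)) ≤ 0 := by
    have t1 := (h.dom.Uc.tendsto _).comp lx
    have t2 : Tendsto (fun k => (C + 1 / ((φ k : ℝ) + 1)) * s (φ k)) atTop (𝓝 ((C + 0) * 0)) :=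
      (linv.const_add C).mul ls
    rw [mul_zero] at t2
    exact le_of_tendsto_of_tendsto' t1 t2 (fun k => hU (φ k))
  have hyF : (1/2:ℝ) • (X0 + X1) ∈ frontier Ω :=
    h.dom.fr_of_zero hyΩ (le_antisymm hyU (h.dom.nonneg hyΩ))
  have hXX := h.strict_mid hmem.1 hmem.2.1 hyF
  simp only at hXX
  set y := (1/2:ℝ) • (X0 + X1) with hy
  have lr : Tendsto (fun k => r (φ k)) atTop (𝓝 0) := by
    have := (l0.sub l1).const_smul (1/2:ℝ)
    rwa [hXX, sub_self, smul_zero] at this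
  have lρ : Tendsto (fun k => ρ (φ k)) atTop (𝓝 0) := by
    have := ls.max lr.norm
    simpa using this
  have hrq : ∀ k, ρ k • q k = r k := fun k => by
    rw [hq]; simp only; rw [smul_smul, mul_inv_cancel₀ (hρ0 k).ne', one_smul]
  have e0 : ∀ k, x0 k = x k + ρ k • q k := fun k => by rw [hrq, hx, hr]; module
  have e1 : ∀ k, x1 k = x k - ρ k • q k := fun k => by rw [hrq, hx, hr]; module
  have es : ∀ k, s k = ρ k * σ k := fun k => by rw [hσ]; simp only; field_simp [(hρ0 k).ne']
  have hxΩ : ∀ k, x (φ k) ∈ Ω := fun k => by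
    have := h.dom.conv (hx0 (φ k)) (hx1 (φ k)) (show (0:ℝ) ≤ 1/2 by norm_num) (show (0:ℝ) ≤ 1/2 by norm_num) (by norm_num)
    rwa [← smul_add] at this
  have D1 := lim_d1 h.dom.hU lx lq lρ (fun k => hρ0 _)
  have D1' := lim_d1 h.dom.hU lx lq.neg lρ (fun k => hρ0 _)
  have W1 := lim_d1 h.hw lx lq lρ (fun k => hρ0 _)
  have W1' := lim_d1 h.hw lx lq.neg lρ (fun k => hρ0 _)
  have D2 := lim_d2 h.dom.hU h.dom.cpt hxΩ lx lq lρ (fun k => hρ0 _) (fun k => hq1 _)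
  have wX0 : Tendsto (fun k => w (x0 (φ k))) atTop (𝓝 (w y)) := by
    have : X0 = y := by rw [hy, ← hXX, ← two_smul ℝ X0, smul_smul]; norm_num
    rw [← this]
    exact (h.hw.continuous.tendsto _).comp l0
  have wX1 : Tendsto (fun k => w (x1 (φ k))) atTop (𝓝 (w y)) := by
    have : X1 = y := by rw [hy, hXX, ← two_smul ℝ X1, smul_smul]; norm_num
    rw [← this]
    exact (h.hw.continuous.tendsto _).comp l1
  -- first order conditions
  have F0 : - (τ * w y) ≤ fderiv ℝ U y Q := by
    have t : Tendsto (fun k => - (σ (φ k) * (w (x0 (φ k)) + 1 / ((φ k : ℝ) + 1)))) atTop (𝓝 (-(τ * (w y + 0)))) :=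
      (lσ.mul (wX0.add linv)).neg
    rw [add_zero] at t
    refine le_of_tendsto_of_tendsto' t D1 fun k => ?_
    rw [le_div_iff₀ (hρ0 _), ← e0]
    have a1 := hA (φ k)
    have a2 := hU (φ k)
    have a3 := es (φ k)
    have a4 : -(σ (φ k) * (w (x0 (φ k)) + 1 / ((φ k : ℝ) + 1))) * ρ (φ k)
      = - s (φ k) * (w (x0 (φ k)) + 1 / ((φ k : ℝ) + 1)) := by rw [a3]; ring
    rw [a4]
    simp only [hx]
    linarith
  have F1 : τ * w y ≤ - fderiv ℝ U y Q := by
    have t : Tendsto (fun k => (σ (φ k) * (w (x1 (φ k)) - 1 / ((φ k : ℝ) + 1)))) atTop (𝓝 ((τ * (w y - 0)))) :=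
      (lσ.mul (wX1.sub linv))
    rw [sub_zero] at t
    rw [← map_neg]
    refine le_of_tendsto_of_tendsto' t D1' fun k => ?_
    rw [le_div_iff₀ (hρ0 _), smul_neg, ← sub_eq_add_neg, ← e1]
    have a1 := hB (φ k)
    have a2 := hU (φ k)
    have a3 := es (φ k)
    have a4 : σ (φ k) * (w (x1 (φ k)) - 1 / ((φ k : ℝ) + 1)) * ρ (φ k)
      = s (φ k) * (w (x1 (φ k)) - 1 / ((φ k : ℝ) + 1)) := by rw [a3]; ring
    rw [a4]
    simp only [hx]
    linarith
  have F : fderiv ℝ U y Q = - (τ * w y) := by linarith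
  have G : τ ^ 2 * (- b y / 2 + ε) ≤ fderiv ℝ (fderiv ℝ U) y Q Q / 2 + τ * (fderiv ℝ w y Q - fderiv ℝ w y (-Q)) / 2 := by
    have t1 : Tendsto (fun k => (σ (φ k)) ^ 2 * (- b (x (φ k)) / 2 + ε)) atTop (𝓝 (τ ^ 2 * (- b y / 2 + ε))) :=
      (lσ.pow 2).mul (((((h.hb.tendsto _).comp lx).neg).div_const 2).add_const ε)
    have t2 := (D2.div_const 2).add ((lσ.mul (W1.sub W1')).div_const 2)
    refine le_of_tendsto_of_tendsto' t1 t2 fun k => ?_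
    have a1 := (hV (φ k)).le
    have p := hρ0 (φ k)
    rw [smul_neg, ← sub_eq_add_neg, ← e0, ← e1]
    have a3 := es (φ k)
    have key : (σ (φ k)) ^ 2 * (- b (x (φ k)) / 2 + ε) * ρ (φ k) ^ 2 ≤
      ((U (x0 (φ k)) + U (x1 (φ k)) - 2 * U (x (φ k))) / ρ (φ k) ^ 2 / 2 + σ (φ k) *
        ((w (x0 (φ k)) - w (x (φ k))) / ρ (φ k) - (w (x1 (φ k)) - w (x (φ k))) / ρ (φ k)) / 2) * ρ (φ k) ^ 2 := by
      have e : ((U (x0 (φ k)) + U (x1 (φ k)) - 2 * U (x (φ k))) / ρ (φ k) ^ 2 / 2 + σ (φ k) *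
        ((w (x0 (φ k)) - w (x (φ k))) / ρ (φ k) - (w (x1 (φ k)) - w (x (φ k))) / ρ (φ k)) / 2) * ρ (φ k) ^ 2
        = (U (x0 (φ k)) + U (x1 (φ k)) - 2 * U (x (φ k))) / 2 + (ρ (φ k) * σ (φ k)) * (w (x0 (φ k)) - w (x1 (φ k))) / 2 := by
        field_simp
        ring
      rw [e, ← a3]
      have e' : (σ (φ k)) ^ 2 * (- b (x (φ k)) / 2 + ε) * ρ (φ k) ^ 2 = s (φ k) ^ 2 * (- b (x (φ k)) / 2 + ε) := by
        rw [a3]; ring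
      rw [e']
      simp only [hx] at a1 ⊢
      linarith
    exact le_of_mul_le_mul_right key (by positivity)
  rw [map_neg] at G
  have hτ1 : max τ ‖Q‖ = 1 :=
    tendsto_nhds_unique (lσ.max lq.norm) (by simp only [hmax]; exact tendsto_const_nhds)
  have hτ0 : 0 ≤ τ := hmem.2.2.2.1
  rcases hτ0.eq_or_lt with ht | ht
  · rw [← ht] at F G hτ1
    have hQ : Q ≠ 0 := by rintro rfl; simp at hτ1
    have := h.str y hyF Q (by simpa using F) hQ
    simp at G
    linarith
  · have := h.alg y hyF (τ⁻¹ • Q) (by rw [map_smul, F, smul_eq_mul]; field_simp)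
    simp only [map_smul, smul_apply, smul_eq_mul] at this
    have h3 : τ ^ 2 * (τ⁻¹ * (τ⁻¹ * fderiv ℝ (fderiv ℝ U) y Q Q) + 2 * (τ⁻¹ * fderiv ℝ w y Q)) ≤ τ ^ 2 * (- b y) :=
      mul_le_mul_of_nonneg_left this (by positivity)
    have h4 : τ ^ 2 * (τ⁻¹ * (τ⁻¹ * fderiv ℝ (fderiv ℝ U) y Q Q) + 2 * (τ⁻¹ * fderiv ℝ w y Q)) =
      fderiv ℝ (fderiv ℝ U) y Q Q + 2 * τ * fderiv ℝ w y Q := by field_simp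
    have : 0 < τ ^ 2 * ε := by positivity
    nlinarith
end Core


structure IsChi (α β : ℝ) (χ χ1 χ2 : ℝ → ℝ) : Prop where
  c2 : ContDiff ℝ 2 χ
  d1 : ∀ t, HasDerivAt χ (χ1 t) t
  d2 : ∀ t, HasDerivAt χ1 (χ2 t) t
  c1' : Continuous χ1
  c2' : Continuous χ2
  zero : ∀ t, t ≤ α → χ t = 0
  nonneg : ∀ t, 0 ≤ χ t
  one0 : ∀ t, 0 ≤ χ1 t
  one1 : ∀ t, χ1 t ≤ 1
  onea : ∀ t, t ≤ α → χ1 t = 0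
  oneb : ∀ t, β ≤ t → χ1 t = 1
  two0 : ∀ t, 0 ≤ χ2 t
  twoa : ∀ t, t < α → χ2 t = 0
  twob : ∀ t, β ≤ t → χ2 t = 0

lemma chi_exists {α β : ℝ} (hab : α < β) : ∃ χ χ1 χ2, IsChi α β χ χ1 χ2 := by
  have hp : 0 < β - α := sub_pos.2 hab
  set χ1 : ℝ → ℝ := fun t => Real.smoothTransition ((t - α) / (β - α)) with h1
  have s1 : ContDiff ℝ 1 χ1 := (Real.smoothTransition.contDiff (n := 1)).comp (by fun_prop)
  have cc : Continuous χ1 := s1.continuous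
  have mono : Monotone χ1 := fun s t hst => Real.smoothTransition.monotone (by gcongr)
  have dd : ∀ t, HasDerivAt χ1 (deriv χ1 t) t := fun t =>
    (s1.differentiable (by norm_num) t).hasDerivAt
  have c2' : Continuous (deriv χ1) := s1.continuous_deriv (by norm_num)
  have D1 : ∀ t, HasDerivAt (fun t => ∫ u in α..t, χ1 u) (χ1 t) t := fun t =>
    intervalIntegral.integral_hasDerivAt_right (cc.intervalIntegrable _ _)
      (cc.stronglyMeasurableAtFilter _ _) cc.continuousAt
  have onea : ∀ t, t ≤ α → χ1 t = 0 := fun t ht =>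
    Real.smoothTransition.zero_of_nonpos (div_nonpos_of_nonpos_of_nonneg (by linarith) hp.le)
  have oneb : ∀ t, β ≤ t → χ1 t = 1 := fun t ht =>
    Real.smoothTransition.one_of_one_le ((one_le_div hp).2 (by linarith))
  have zz : ∀ t, t ≤ α → ∫ u in α..t, χ1 u = 0 := by
    intro t ht
    rw [intervalIntegral.integral_symm, neg_eq_zero]
    rw [intervalIntegral.integral_congr (g := fun _ => (0:ℝ))]
    · simp
    · intro u hu
      rw [uIcc_of_le ht] at hu
      exact onea u hu.2
  have tb : ∀ t, β < t → deriv χ1 t = 0 := by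
    intro t ht
    have : χ1 =ᶠ[𝓝 t] fun _ => 1 := by
      filter_upwards [lt_mem_nhds ht] with u hu using oneb u hu.le
    rw [this.deriv_eq]; simp
  refine ⟨fun t => ∫ u in α..t, χ1 u, χ1, deriv χ1, ?_, D1, dd, cc, c2', zz, ?_, fun t => Real.smoothTransition.nonneg _,
    fun t => Real.smoothTransition.le_one _, onea, oneb, fun t => mono.deriv_nonneg, ?_, ?_⟩
  · have : (2 : WithTop ℕ∞) = 1 + 1 := by norm_num
    rw [this, contDiff_succ_iff_deriv]
    refine ⟨fun t => (D1 t).differentiableAt, by simp, ?_⟩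
    have e : deriv (fun t => ∫ u in α..t, χ1 u) = χ1 := funext fun t => (D1 t).deriv
    rw [e]; exact s1
  · intro t
    rcases le_total t α with h | h
    · exact (zz t h).ge
    · exact intervalIntegral.integral_nonneg h fun u _ => Real.smoothTransition.nonneg _
  · intro t ht
    have : χ1 =ᶠ[𝓝 t] fun _ => 0 := by
      filter_upwards [gt_mem_nhds ht] with u hu using onea u (le_of_lt hu)
    rw [this.deriv_eq]; simp
  · intro t ht
    rcases ht.eq_or_lt with h | h
    · subst h
      have hcl : IsClosed {t | deriv χ1 t = 0} := isClosed_eq c2' continuous_const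
      have : Ioi β ⊆ {t | deriv χ1 t = 0} := fun t ht => tb t ht
      have h2 := hcl.closure_subset_iff.2 this
      rw [closure_Ioi] at h2
      exact h2 self_mem_Ici
    · exact tb t h

lemma IsChi.int {α β : ℝ} {χ χ1 χ2 : ℝ → ℝ} (h : IsChi α β χ χ1 χ2) (hα : 0 ≤ α) {T : ℝ} (hT : β ≤ T) :
    ∫ t in (0:ℝ)..T, χ2 t = 1 := by
  rw [intervalIntegral.integral_eq_sub_of_hasDerivAt (fun t _ => h.d2 t) (h.c2'.intervalIntegrable _ _),
    h.oneb T hT, h.onea 0 hα, sub_zero]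

lemma norm_grad_sq {n : ℕ} {U : EE n → ℝ} (x : EE n) :
    ∑ i, (fderiv ℝ U x (EuclideanSpace.single i 1)) ^ 2 = ‖gradient U x‖ ^ 2 := by
  rw [EuclideanSpace.norm_sq_eq]
  refine Finset.sum_congr rfl fun i _ => ?_
  have e : (gradient U x) i = fderiv ℝ U x (EuclideanSpace.single i 1) := by
    rw [← grad_inner, EuclideanSpace.inner_single_right]; simp
  rw [Real.norm_eq_abs, sq_abs, e]

lemma lap_congr {n : ℕ} {f g : EE n → ℝ} {x : EE n} (h : f =ᶠ[𝓝 x] g) : lap f x = lap g x := by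
  unfold lap
  refine Finset.sum_congr rfl fun i _ => ?_
  have : (fun y => fderiv ℝ f y (EuclideanSpace.single i 1)) =ᶠ[𝓝 x]
      fun y => fderiv ℝ g y (EuclideanSpace.single i 1) := by
    filter_upwards [h.fderiv (𝕜 := ℝ)] with y hy; rw [hy]
  rw [this.fderiv_eq]

lemma lap_comp {n : ℕ} {U : EE n → ℝ} (hU : ContDiff ℝ 2 U) {α β : ℝ} {χ χ1 χ2 : ℝ → ℝ}
    (hχ : IsChi α β χ χ1 χ2) {s : ℝ} (hs : 0 < s) (x : EE n) :
    lap (fun y => s * χ (U y / s)) x = χ1 (U x / s) * lap U x + s⁻¹ * χ2 (U x / s) * ‖gradient U x‖ ^ 2 := by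
  have hd : Differentiable ℝ U := hU.differentiable (by norm_num)
  have hf1 : ContDiff ℝ 1 (fderiv ℝ U) := hU.fderiv_right (by norm_num)
  have hd1 : Differentiable ℝ (fderiv ℝ U) := hf1.differentiable (by norm_num)
  have D : ∀ y, HasFDerivAt (fun y => s * χ (U y / s)) (χ1 (U y / s) • fderiv ℝ U y) y := by
    intro y
    have h1 : HasFDerivAt (fun y => U y / s) (s⁻¹ • fderiv ℝ U y) y := by
      simpa [div_eq_inv_mul] using (hd y).hasFDerivAt.const_mul s⁻¹
    have h2 := ((hχ.d1 (U y / s)).comp_hasFDerivAt y h1).const_mul s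
    refine h2.congr_fderiv ?_
    rw [smul_smul, smul_smul]; congr 1; field_simp
  rw [lap_eq hU, Finset.mul_sum, ← norm_grad_sq, Finset.mul_sum, ← Finset.sum_add_distrib]
  unfold lap
  refine Finset.sum_congr rfl fun i _ => ?_
  have e : (fun y => fderiv ℝ (fun y => s * χ (U y / s)) y (EuclideanSpace.single i 1)) =
    fun y => χ1 (U y / s) * fderiv ℝ U y (EuclideanSpace.single i 1) := by
    funext y; rw [(D y).fderiv]; simp
  rw [e]
  have h1 : HasFDerivAt (fun y => U y / s) (s⁻¹ • fderiv ℝ U x) x := by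
    simpa [div_eq_inv_mul] using (hd x).hasFDerivAt.const_mul s⁻¹
  have h2 := (hχ.d2 (U x / s)).comp_hasFDerivAt x h1
  have h3 := (hd1 x).hasFDerivAt.clm_apply (hasFDerivAt_const (EuclideanSpace.single i (1:ℝ)) x)
  have h4 := (h2.mul h3).fderiv
  have h5 : (fun y => χ1 (U y / s) * fderiv ℝ U y (EuclideanSpace.single i 1)) =
    ((χ1 ∘ fun y => U y / s) * fun y => fderiv ℝ U y (EuclideanSpace.single i 1)) := rfl
  rw [h5, h4]
  simp
  ring

lemma test_fn {m : ℕ} {Ω : Set (EE (m+1))} {U : EE (m+1) → ℝ} (h : Dom Ω U)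
    {α β : ℝ} {χ χ1 χ2 : ℝ → ℝ}
    (hχ : IsChi α β χ χ1 χ2) {s : ℝ} (hs : 0 < s) (hα : 0 < α) :
    ∃ φ : EE (m+1) → ℝ, ContDiff ℝ 2 φ ∧ HasCompactSupport φ ∧ (∀ x, 0 ≤ φ x) ∧ tsupport φ ⊆ interior Ω ∧
      ∀ x ∈ interior Ω, lap φ x = χ1 (U x / s) * lap U x + s⁻¹ * χ2 (U x / s) * ‖gradient U x‖ ^ 2 := by
  classical
  set φ : EE (m+1) → ℝ := fun x => if x ∈ Ω then s * χ (U x / s) else 0 with hφ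
  set K : Set (EE (m+1)) := {x | x ∈ Ω ∧ α * s ≤ U x} with hK
  have hKc : IsClosed K := h.closed.inter (isClosed_le continuous_const h.Uc)
  have hKcpt : IsCompact K := h.cpt.of_isClosed_subset hKc (fun x hx => hx.1)
  have hKi : K ⊆ interior Ω := fun x hx => h.int_of_pos hx.1 (lt_of_lt_of_le (by positivity) hx.2)
  have hz : ∀ x, x ∉ K → φ x = 0 := by
    intro x hx
    simp only [hφ]
    split_ifs with hΩ
    · have : U x < α * s := by by_contra hc; exact hx ⟨hΩ, not_lt.1 hc⟩
      rw [hχ.zero _ ((div_le_iff₀ hs).2 this.le), mul_zero]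
    · rfl
  have hts : tsupport φ ⊆ K := by
    apply hKc.closure_subset_iff.2
    intro x hx
    by_contra hc
    exact hx (hz x hc)
  have heq : ∀ x ∈ interior Ω, φ =ᶠ[𝓝 x] fun x => s * χ (U x / s) := by
    intro x hx
    filter_upwards [isOpen_interior.mem_nhds hx] with y hy
    simp [hφ, interior_subset hy]
  have hsm : ContDiff ℝ 2 (fun x => s * χ (U x / s)) :=
    contDiff_const.mul (hχ.c2.comp (h.hU.div_const s))
  refine ⟨φ, ?_, HasCompactSupport.of_support_subset_isCompact hKcpt (fun x hx => hts (subset_tsupport _ hx)), ?_,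
    hts.trans hKi, ?_⟩
  · rw [contDiff_iff_contDiffAt]
    intro x
    by_cases hx : x ∈ K
    · exact hsm.contDiffAt.congr_of_eventuallyEq (heq x (hKi hx))
    · have : φ =ᶠ[𝓝 x] fun _ => 0 := by
        filter_upwards [hKc.isOpen_compl.mem_nhds hx] with y hy using hz y hy
      exact contDiffAt_const.congr_of_eventuallyEq this
  · intro x
    simp only [hφ]
    split_ifs
    · exact mul_nonneg hs.le (hχ.nonneg _)
    · exact le_rfl
  · intro x hx
    rw [lap_congr (heq x hx), lap_comp h.hU hχ hs]


lemma lap_lin {n : ℕ} {U w : EE n → ℝ} (hU : ContDiff ℝ 2 U) (hw : ContDiff ℝ 2 w) (c s : ℝ) (x : EE n) :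
    lap (fun x => U x - c + s * w x) x = lap U x + s * lap w x := by
  have hU1 : Differentiable ℝ U := hU.differentiable (by norm_num)
  have hw1 : Differentiable ℝ w := hw.differentiable (by norm_num)
  have hU2 : Differentiable ℝ (fderiv ℝ U) := (hU.fderiv_right (m := 1) (by norm_num)).differentiable (by norm_num)
  have hw2 : Differentiable ℝ (fderiv ℝ w) := (hw.fderiv_right (m := 1) (by norm_num)).differentiable (by norm_num)
  have e : fderiv ℝ (fun x => U x - c + s * w x) = fun x => fderiv ℝ U x + s • fderiv ℝ w x := by
    funext x
    exact (((hU1 x).hasFDerivAt.sub_const c).add ((hw1 x).hasFDerivAt.const_mul s)).fderiv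
  have hf : ContDiff ℝ 2 (fun x => U x - c + s * w x) := (hU.sub contDiff_const).add (contDiff_const.mul hw)
  rw [lap_eq hf, lap_eq hU, lap_eq hw, e, Finset.mul_sum, ← Finset.sum_add_distrib]
  refine Finset.sum_congr rfl fun i _ => ?_
  have e2 : fderiv ℝ (fun x => fderiv ℝ U x + s • fderiv ℝ w x) x = fderiv ℝ (fderiv ℝ U) x + s • fderiv ℝ (fderiv ℝ w) x :=
    ((hU2 x).hasFDerivAt.add ((hw2 x).hasFDerivAt.const_smul s)).fderiv
  rw [e2]
  simp

lemma int_lin3 {X : Type*} [MeasurableSpace X] {μ : Measure X} {f g k : X → ℝ} (hf : Integrable f μ)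
    (hg : Integrable g μ) (hk : Integrable k μ) (a b c : ℝ) :
    ∫ x, (a * f x + b * g x + c * k x) ∂μ = a * ∫ x, f x ∂μ + b * ∫ x, g x ∂μ + c * ∫ x, k x ∂μ := by
  have h1 : Integrable (fun x => a * f x + b * g x) μ := (hf.const_mul a).add (hg.const_mul b)
  rw [integral_add h1 (hk.const_mul c), integral_add (hf.const_mul a) (hg.const_mul b),
    integral_const_mul, integral_const_mul, integral_const_mul]

lemma Dom.grad_lower {m : ℕ} {Ω : Set (EE (m+1))} {U : EE (m+1) → ℝ} (h : Dom Ω U) :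
    ∃ c0 > 0, ∀ x ∈ Ω, U x ≤ c0 → c0 ≤ ‖fderiv ℝ U x‖ := by
  have hc : Continuous (fun x => U x + ‖fderiv ℝ U x‖) :=
    h.Uc.add (h.hU.continuous_fderiv (by norm_num)).norm
  obtain ⟨x0, hx0, hmin⟩ := h.cpt.exists_isMinOn (h.ne.mono interior_subset) hc.continuousOn
  have hpos : 0 < U x0 + ‖fderiv ℝ U x0‖ := by
    rcases h.mem_cases hx0 with hi | hf
    · have := h.pos x0 hi; positivity
    · have h1 : fderiv ℝ U x0 ≠ 0 := by
        intro h0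
        apply h.grad x0 hf
        rw [gradient, h0, map_zero]
      have := h.zero x0 hf
      rw [this, zero_add]
      exact norm_pos_iff.2 h1
  refine ⟨(U x0 + ‖fderiv ℝ U x0‖) / 2, by positivity, fun x hx hU => ?_⟩
  have := hmin hx
  simp only [mem_ofPred_eq] at this
  linarith

lemma pair_side {m : ℕ} {Ω : Set (EE (m+1))} {U w : EE (m+1) → ℝ} (h : Dom Ω U) (hw : ContDiff ℝ 2 w)
    (lU : ∀ x ∈ interior Ω, lap U x = -2) (lw : ∀ x ∈ interior Ω, lap w x = 0)
    {C : ℝ} (hC : 1 ≤ C) (hwC : ∀ x ∈ Ω, |w x| ≤ C - 1) :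
    ∃ s1 > 0, ∀ s, 0 < s → s < s1 →
      IsCompact {x | x ∈ Ω ∧ 0 ≤ U x - C * s + s * w x} ∧
      {x | x ∈ Ω ∧ 0 ≤ U x - C * s + s * w x} ⊆ interior Ω ∧
      ContDiff ℝ 2 (fun x => U x - C * s + s * w x) ∧
      (∀ x ∈ {x | x ∈ Ω ∧ 0 ≤ U x - C * s + s * w x}, lap (fun x => U x - C * s + s * w x) x = -2) ∧
      (∀ x ∈ {x | x ∈ Ω ∧ 0 ≤ U x - C * s + s * w x}, U x - C * s + s * w x = 0 →
        fderiv ℝ (fun x => U x - C * s + s * w x) x ≠ 0) := by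
  obtain ⟨c0, hc0, hg⟩ := h.grad_lower
  obtain ⟨M, hM⟩ := h.cpt.exists_bound_of_continuousOn (f := fderiv ℝ w)
    (hw.continuous_fderiv (by norm_num)).continuousOn
  have hU1 : Differentiable ℝ U := h.hU.differentiable (by norm_num)
  have hw1 : Differentiable ℝ w := hw.differentiable (by norm_num)
  refine ⟨c0 / (2 * C + |M|), by positivity, fun s hs hs1 => ?_⟩
  have hs2 : s * (2 * C + |M|) < c0 := (lt_div_iff₀ (by positivity)).1 hs1
  have hsub : {x | x ∈ Ω ∧ 0 ≤ U x - C * s + s * w x} ⊆ interior Ω := by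
    rintro x ⟨hx, h0⟩
    have := abs_le.1 (hwC x hx)
    apply h.int_of_pos hx
    nlinarith [this.2]
  have hf : ContDiff ℝ 2 (fun x => U x - C * s + s * w x) :=
    (h.hU.sub contDiff_const).add (contDiff_const.mul hw)
  refine ⟨?_, hsub, hf, ?_, ?_⟩
  · exact h.cpt.of_isClosed_subset
      (h.closed.inter (isClosed_le continuous_const hf.continuous)) (fun x hx => hx.1)
  · intro x hx
    rw [lap_lin h.hU hw, lU x (hsub hx), lw x (hsub hx)]; ring
  · rintro x ⟨hx, -⟩ h0 hd
    have e2 : fderiv ℝ (fun x => U x - C * s + s * w x) x = fderiv ℝ U x + s • fderiv ℝ w x :=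
      (((hU1 x).hasFDerivAt.sub_const (C * s)).add ((hw1 x).hasFDerivAt.const_mul s)).fderiv
    rw [e2] at hd
    have hb := abs_le.1 (hwC x hx)
    have hpM : 0 ≤ s * |M| := by positivity
    have h1 : U x ≤ c0 := by nlinarith [hb.1]
    have h2 := hg x hx h1
    have h3 : fderiv ℝ U x = - (s • fderiv ℝ w x) := eq_neg_of_add_eq_zero_left hd
    rw [h3, norm_neg, norm_smul, Real.norm_of_nonneg hs.le] at h2
    have h4 : s * ‖fderiv ℝ w x‖ ≤ s * |M| :=
      mul_le_mul_of_nonneg_left ((hM x hx).trans (le_abs_self _)) hs.le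
    nlinarith

def SA {m : ℕ} (Ω : Set (EE (m+1))) (U w : EE (m+1) → ℝ) (C s : ℝ) : Set (EE (m+1)) :=
  {x | x ∈ Ω ∧ 0 ≤ U x - C * s + s * w x}

lemma Core.pair {m : ℕ} {Ω : Set (EE (m+1))} {U w b : EE (m+1) → ℝ} (h : Core Ω U w b)
    {C : ℝ} (hC : 1 ≤ C) (hwC : ∀ x ∈ Ω, |w x| ≤ C - 1) :
    ∃ s1 > 0, ∀ s, 0 < s → s < s1 →
      Pair (interior Ω) (SA Ω U w C s) (SA Ω U (fun x => - w x) C s)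
        (fun x => U x - C * s + s * w x) (fun x => U x - C * s + s * (- w x)) := by
  obtain ⟨s1, hs1, H1⟩ := pair_side h.dom h.hw h.lU h.lw hC hwC
  obtain ⟨s2, hs2, H2⟩ := pair_side h.dom (w := fun x => - w x) h.hw.neg h.lU (by
    intro x hx
    have := lap_lin (U := fun _ => (0:ℝ)) contDiff_const h.hw 0 (-1) x
    simp only [sub_zero, zero_add, neg_mul, one_mul] at this
    rw [this, h.lw x hx]
    simp [lap]) hC (fun x hx => by simpa using hwC x hx)
  refine ⟨min s1 s2, lt_min hs1 hs2, fun s hs hlt => ?_⟩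
  obtain ⟨a1, a2, a3, a4, a5⟩ := H1 s hs (hlt.trans_le (min_le_left _ _))
  obtain ⟨b1, b2, b3, b4, b5⟩ := H2 s hs (hlt.trans_le (min_le_right _ _))
  exact ⟨isOpen_interior, a1, b1, a2, b2, fun x hx hp => ⟨interior_subset hx, hp⟩,
    fun x hx hp => ⟨interior_subset hx, hp⟩, fun x hx => hx.2, fun x hx => hx.2, a3, b3, a4, b4, a5, b5⟩

lemma Pair.pl {n : ℕ} {O A B : Set (EE n)} {a b : EE n → ℝ} (h : Pair O A B a b)
    (ha : IntegrableOn (fun x => max (a x) 0) O) (hb : IntegrableOn (fun x => max (b x) 0) O) :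
    (∫ x in O, max (a x) 0) * (∫ x in O, max (b x) 0) ≤ (∫ x, Vf A B a b x) ^ 2 := by
  have key : ∀ a : EE n → ℝ, ContDiff ℝ 2 a → IntegrableOn (fun x => max (a x) 0) O →
      Measurable (fun x => ENNReal.ofReal (O.indicator (fun x => max (a x) 0) x)) ∧
      ∫⁻ x, ENNReal.ofReal (O.indicator (fun x => max (a x) 0) x) = ENNReal.ofReal (∫ x in O, max (a x) 0) := by
    intro a ha hi
    refine ⟨?_, ?_⟩
    · exact ((ha.continuous.max continuous_const).measurable.indicator h.Oo.measurableSet).ennreal_ofReal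
    · rw [← ofReal_integral_eq_lintegral_ofReal]
      · rw [integral_indicator h.Oo.measurableSet]
      · exact (integrable_indicator_iff h.Oo.measurableSet).2 hi
      · exact Eventually.of_forall fun x => indicator_nonneg (fun x _ => le_max_right _ _) x
  obtain ⟨ma, ia⟩ := key a h.ha ha
  obtain ⟨mb, ib⟩ := key b h.hb hb
  have iV : ∫⁻ x, ENNReal.ofReal (Vf A B a b x) = ENNReal.ofReal (∫ x, Vf A B a b x) :=
    (ofReal_integral_eq_lintegral_ofReal h.V_int (Eventually.of_forall h.V_nonneg)).symm
  have := prekopa_leindler (h := fun x => ENNReal.ofReal (Vf A B a b x)) ma mb h.V_meas.ennreal_ofReal (by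
    intro x y
    by_cases hx : x ∈ O ∧ 0 < a x
    · by_cases hy : y ∈ O ∧ 0 < b y
      · rw [indicator_of_mem hx.1, indicator_of_mem hy.1, max_eq_left hx.2.le, max_eq_left hy.2.le,
          ← ENNReal.ofReal_mul hx.2.le, ← ENNReal.ofReal_pow (h.V_nonneg _)]
        apply ENNReal.ofReal_le_ofReal
        have h1 := h.le_V (h.hA x hx.1 hx.2.le) (h.hB y hy.1 hy.2.le)
        have h2 : √(a x) * √(b y) ≤ qf a b (x, y) := by
          unfold qf; nlinarith [sq_nonneg (√(a x) - √(b y))]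
        have h3 : a x * b y = (√(a x) * √(b y)) ^ 2 := by
          rw [mul_pow, Real.sq_sqrt hx.2.le, Real.sq_sqrt hy.2.le]
        rw [h3]
        exact pow_le_pow_left₀ (by positivity) (h2.trans h1) 2
      · have : O.indicator (fun x => max (b x) 0) y = 0 := by
          by_cases hO : y ∈ O
          · rw [indicator_of_mem hO, max_eq_right]
            by_contra hc; exact hy ⟨hO, not_le.1 hc⟩
          · exact indicator_of_notMem hO _
        simp only [this, ENNReal.ofReal_zero, mul_zero, zero_le]
    · have : O.indicator (fun x => max (a x) 0) x = 0 := by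
        by_cases hO : x ∈ O
        · rw [indicator_of_mem hO, max_eq_right]
          by_contra hc; exact hx ⟨hO, not_le.1 hc⟩
        · exact indicator_of_notMem hO _
      simp only [this, ENNReal.ofReal_zero, zero_mul, zero_le])
  rw [ia, ib, iV] at this
  have p1 : 0 ≤ ∫ x in O, max (a x) 0 := integral_nonneg fun x => le_max_right _ _
  have p2 : 0 ≤ ∫ x, Vf A B a b x := integral_nonneg h.V_nonneg
  rw [← ENNReal.ofReal_mul p1, ← ENNReal.ofReal_pow p2] at this
  exact (ENNReal.ofReal_le_ofReal_iff (by positivity)).1 this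

/-- integral over space of something vanishing outside O -/
lemma int_eq_set {n : ℕ} {O : Set (EE n)} {f : EE n → ℝ} (hf : ∀ x, x ∉ O → f x = 0) :
    ∫ x, f x = ∫ x in O, f x := (setIntegral_eq_integral_of_forall_compl_eq_zero hf).symm

lemma Core.wzero {m : ℕ} {Ω : Set (EE (m+1))} {U w b : EE (m+1) → ℝ} (h : Core Ω U w b) :
    ∫ x in interior Ω, w x = 0 := by
  obtain ⟨c, hc, H⟩ := h.dom.layer
  obtain ⟨χ, χ1, χ2, hχ⟩ := chi_exists (α := 1) (β := 2) (by norm_num)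
  have hcw := h.hw.continuous
  have hcg := h.dom.gc
  have hcU := h.dom.Uc
  have L1 := H (fun x t => w x * (1 - χ1 t)) (by
    have := hχ.c1'; simp only [Function.uncurry_def]; fun_prop) 2 (by norm_num)
    (fun x t ht => by rw [hχ.oneb t ht]; ring)
  have L2 := H (fun x t => w x * ‖gradient U x‖ ^ 2 * χ2 t) (by
    have := hχ.c2'; simp only [Function.uncurry_def]; fun_prop) 2 (by norm_num)
    (fun x t ht => by rw [hχ.twob t ht]; ring)
  have e0 : ∫ x in frontier Ω, (∫ t in (0:ℝ)..2, w x * ‖gradient U x‖ ^ 2 * χ2 t) / ‖gradient U x‖ ∂μH[(m:ℝ)] = 0 := by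
    refine Eq.trans ?_ h.orth
    refine setIntegral_congr_fun isClosed_frontier.measurableSet fun x hx => ?_
    have : ‖gradient U x‖ ≠ 0 := norm_ne_zero_iff.2 (h.dom.grad x hx)
    rw [intervalIntegral.integral_const_mul, hχ.int (by norm_num) le_rfl]
    field_simp
  rw [e0, mul_zero] at L2
  have id0 : Tendsto (fun s : ℝ => s) (𝓝[>] 0) (𝓝 0) := nhdsWithin_le_nhds
  have L3 := ((id0.mul L1).const_mul (2:ℝ)).add L2
  simp only [zero_mul, mul_zero, add_zero] at L3
  have key : ∀ s ∈ Ioi (0:ℝ), 2 * (s * (s⁻¹ * ∫ x in interior Ω, w x * (1 - χ1 (U x / s)))) +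
     s⁻¹ * ∫ x in interior Ω, w x * ‖gradient U x‖ ^ 2 * χ2 (U x / s) = 2 * ∫ x in interior Ω, w x := by
    intro s hs
    have hs : 0 < s := hs
    obtain ⟨φ, p1, p2, p3, p4, p5⟩ := test_fn h.dom hχ hs (by norm_num)
    have t := harm_test h.hw p1 p2 p3 (fun x hx => h.lw x (p4 hx))
    rw [zero_mul, int_eq_set (O := interior Ω) (fun x hx => by
      rw [lap_zero_off p1 (fun hc => hx (p4 hc)), mul_zero])] at t
    have i1 : IntegrableOn (fun x => w x * (1 - χ1 (U x / s))) (interior Ω) :=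
      h.dom.intint (by have := hχ.c1'; fun_prop)
    have i2 : IntegrableOn (fun x => w x * ‖gradient U x‖ ^ 2 * χ2 (U x / s)) (interior Ω) :=
      h.dom.intint (by have := hχ.c2'; fun_prop)
    have i3 : IntegrableOn w (interior Ω) := h.dom.intint hcw.continuousOn
    have e : ∫ x in interior Ω, w x * lap φ x = ∫ x in interior Ω, (2 * (w x * (1 - χ1 (U x / s))) +
        s⁻¹ * (w x * ‖gradient U x‖ ^ 2 * χ2 (U x / s)) + (-2) * w x) := by
      refine setIntegral_congr_fun isOpen_interior.measurableSet fun x hx => ?_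
      rw [p5 x hx, h.lU x hx]; ring
    rw [e, int_lin3 i1 i2 i3] at t
    rw [mul_inv_cancel_left₀ hs.ne']
    linarith
  have L4 : Tendsto (fun _ : ℝ => 2 * ∫ x in interior Ω, w x) (𝓝[>] (0:ℝ)) (𝓝 0) := by
    refine L3.congr' ?_
    filter_upwards [self_mem_nhdsWithin] with s hs using key s hs
  have := tendsto_nhds_unique L4 tendsto_const_nhds
  linarith


def LayerC {m : ℕ} (Ω : Set (EE (m+1))) (U : EE (m+1) → ℝ) (c : ℝ) : Prop :=
  ∀ F : EE (m+1) → ℝ → ℝ, Continuous (Function.uncurry F) → ∀ T, 0 < T → (∀ x t, T ≤ t → F x t = 0) →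
    Tendsto (fun s => s⁻¹ * ∫ x in interior Ω, F x (U x / s)) (𝓝[>] 0)
      (𝓝 (c * ∫ x in frontier Ω, (∫ t in (0:ℝ)..T, F x t) / ‖gradient U x‖ ∂μH[(m:ℝ)]))

lemma Core.upper {m : ℕ} {Ω : Set (EE (m+1))} {U w b : EE (m+1) → ℝ} (h : Core Ω U w b)
    {C : ℝ} (hC : 1 ≤ C) (hwC : ∀ x ∈ Ω, |w x| ≤ C - 1) {c : ℝ} (H : LayerC Ω U c) {ε : ℝ} (hε : 0 < ε) :
    ∃ β : ℝ → ℝ, Tendsto β (𝓝[>] 0) (𝓝 (c * ∫ x in frontier Ω, (- b x / 2 + ε) * ‖gradient U x‖ ∂μH[(m:ℝ)])) ∧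
      ∀ᶠ s in 𝓝[>] (0:ℝ), 2 * ∫ x, Vf (SA Ω U w C s) (SA Ω U (fun x => - w x) C s)
        (fun x => U x - C * s + s * w x) (fun x => U x - C * s + s * (- w x)) x ≤
          2 * (∫ x in interior Ω, max (U x - C * s) 0) + s ^ 2 * β s := by
  have hcU := h.dom.Uc
  have hcg := h.dom.gc
  have hcb := h.hb
  obtain ⟨κ', hκ', s0, hs0, LB'⟩ := h.layer_bound C hε
  obtain ⟨s1, hs1, HP⟩ := h.pair hC hwC
  set κ := min κ' 1 with hκdef
  have hκ : 0 < κ := lt_min hκ' one_pos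
  have hκ1 : κ ≤ 1 := min_le_right _ _
  obtain ⟨χ, χ1, χ2, hχ⟩ := chi_exists (α := C + κ / 3) (β := C + κ) (by linarith)
  have hc1 := hχ.c1'
  have hc2 := hχ.c2'
  set k : EE (m+1) → ℝ := fun x => - b x / 2 + ε with hk
  have hkc : Continuous k := by fun_prop
  obtain ⟨M, hM⟩ := h.dom.cpt.exists_bound_of_continuousOn hkc.continuousOn
  have hM0 : 0 ≤ M := (norm_nonneg _).trans (hM _ (interior_subset h.dom.ne.some_mem))
  have L1 := H (fun x t => k x * ‖gradient U x‖ ^ 2 * χ2 t) (by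
    simp only [Function.uncurry_def]; fun_prop) (C + κ) (by positivity)
    (fun x t ht => by rw [hχ.twob t ht]; ring)
  have L2 := H (fun x t => 1 - χ1 t) (by
    simp only [Function.uncurry_def]; fun_prop) (C + κ) (by positivity)
    (fun x t ht => by rw [hχ.oneb t ht]; ring)
  have e0 : ∫ x in frontier Ω, (∫ t in (0:ℝ)..(C + κ), k x * ‖gradient U x‖ ^ 2 * χ2 t) / ‖gradient U x‖ ∂μH[(m:ℝ)]
      = ∫ x in frontier Ω, k x * ‖gradient U x‖ ∂μH[(m:ℝ)] := by
    refine setIntegral_congr_fun isClosed_frontier.measurableSet fun x hx => ?_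
    have : ‖gradient U x‖ ≠ 0 := norm_ne_zero_iff.2 (h.dom.grad x hx)
    rw [intervalIntegral.integral_const_mul, hχ.int (by positivity) le_rfl]
    field_simp
  rw [e0] at L1
  have id0 : Tendsto (fun s : ℝ => s) (𝓝[>] 0) (𝓝 0) := nhdsWithin_le_nhds
  have L3 := L1.add ((id0.mul L2).const_mul (2 * M))
  simp only [zero_mul, mul_zero, add_zero] at L3
  refine ⟨_, L3, ?_⟩
  have hs3 : 0 < κ / 3 / (M + 1) := by positivity
  filter_upwards [Ioo_mem_nhdsGT hs0, Ioo_mem_nhdsGT hs1, Ioo_mem_nhdsGT hs3] with s m0 m1 m3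
  have hs : 0 < s := m0.1
  have hsM : s * (M + 1) < κ / 3 := (lt_div_iff₀ (by positivity)).1 m3.2
  have P := HP s hs m1.2
  set V := Vf (SA Ω U w C s) (SA Ω U (fun x => - w x) C s)
        (fun x => U x - C * s + s * w x) (fun x => U x - C * s + s * (- w x)) with hV
  have Vsupp : ∀ x, x ∉ interior Ω → V x = 0 := by
    intro x hx
    by_contra hc
    obtain ⟨⟨x0, x1⟩, ⟨h0, h1⟩, h2⟩ := P.V_supp hc
    apply hx
    have := h.dom.conv.interior (P.AO h0) (P.BO h1) (a := 1/2) (b := 1/2) (by norm_num) (by norm_num) (by norm_num)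
    rw [← h2]; simpa [smul_add] using this
  have K1 : ∀ x, U x ≤ (C + κ) * s → 0 < V x → V x ≤ U x - C * s + s ^ 2 * k x := by
    intro x hx hp
    obtain ⟨x0, h0, x1, h1, h2, h3⟩ := P.V_att hp
    have a0 : 0 ≤ U x0 - C * s + s * w x0 := h0.2
    have a1 : 0 ≤ U x1 - C * s + s * - w x1 := h1.2
    have := LB' s hs m0.2 x0 h0.1 x1 h1.1 (by
      rw [h2]; refine hx.trans ?_
      have := min_le_left κ' 1
      gcongr) (by linarith) (by linarith)
    rw [h2] at this
    have q : V x ≤ ((U x0 - C * s + s * w x0) + (U x1 - C * s + s * - w x1)) / 2 := by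
      change Vf _ _ _ _ x ≤ _
      rw [h3]; unfold qf
      dsimp only
      nlinarith [Real.sq_sqrt a0, Real.sq_sqrt a1, sq_nonneg (√(U x0 - C * s + s * w x0) - √(U x1 - C * s + s * - w x1))]
    simp only [hk]
    linarith
  have hkM : ∀ x ∈ interior Ω, - M ≤ k x ∧ k x ≤ M := fun x hx =>
    abs_le.1 (by simpa using hM x (interior_subset hx))
  have K2 : ∀ x ∈ interior Ω, (C + κ / 3) * s ≤ U x → U x ≤ (C + κ) * s → V x - (U x - C * s) ≤ s ^ 2 * k x := by
    intro x hx ha hb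
    rcases (P.V_nonneg x).eq_or_lt with h0 | h0
    · have h0 : V x = 0 := h0.symm
      rw [h0]
      have : - M ≤ k x := (hkM x hx).1
      have h5 : s ^ 2 * (- M) ≤ s ^ 2 * k x := by gcongr
      nlinarith
    · linarith [K1 x hb h0]
  have iV : ∀ f : EE (m+1) → ℝ, Continuous f → IntegrableOn (fun x => V x * f x) (interior Ω) := by
    intro f hf
    exact (P.V_int.integrableOn.mul_continuousOn (K := Ω) hf.continuousOn h.dom.cpt).mono_set interior_subset
  have iV1 : IntegrableOn V (interior Ω) := P.V_int.integrableOn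
  have iC : ∀ f : EE (m+1) → ℝ, Continuous f → IntegrableOn f (interior Ω) := fun f hf => h.dom.intint hf.continuousOn
  obtain ⟨φ, p1, p2, p3, p4, p5⟩ := test_fn h.dom hχ hs (by positivity)
  have t1 := P.V_test p1 p2 p3
  have hvs : ContDiff ℝ 2 (fun x => U x - C * s + 0 * w x) :=
    (h.dom.hU.sub contDiff_const).add (contDiff_const.mul h.hw)
  have t2 := harm_test hvs p1 p2 p3 (a := -2) (fun x hx => by
    rw [lap_lin h.dom.hU h.hw, h.lU x (p4 hx)]; ring)
  have hzo : ∀ f : EE (m+1) → ℝ, ∫ x, f x * lap φ x = ∫ x in interior Ω, f x * lap φ x := fun f =>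
    int_eq_set (fun x hx => by rw [lap_zero_off p1 (fun hc => hx (p4 hc)), mul_zero])
  rw [hzo] at t1 t2
  have T1 : IntegrableOn (fun x => (V x - (U x - C * s)) * χ1 (U x / s)) (interior Ω) := by
    have := (iV (fun x => χ1 (U x / s)) (by fun_prop)).sub (iC (fun x => (U x - C * s) * χ1 (U x / s)) (by fun_prop))
    refine this.congr (Eventually.of_forall fun x => ?_)
    simp only [Pi.sub_apply]; ring
  have T2 : IntegrableOn (fun x => (V x - (U x - C * s)) * (χ2 (U x / s) * ‖gradient U x‖ ^ 2)) (interior Ω) := by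
    have := (iV (fun x => χ2 (U x / s) * ‖gradient U x‖ ^ 2) (by fun_prop)).sub
      (iC (fun x => (U x - C * s) * (χ2 (U x / s) * ‖gradient U x‖ ^ 2)) (by fun_prop))
    refine this.congr (Eventually.of_forall fun x => ?_)
    simp only [Pi.sub_apply]; ring
  have T3 : IntegrableOn (fun x => (V x - max (U x - C * s) 0) * (1 - χ1 (U x / s))) (interior Ω) := by
    have := (iV (fun x => 1 - χ1 (U x / s)) (by fun_prop)).sub
      (iC (fun x => (max (U x - C * s) 0) * (1 - χ1 (U x / s))) (by fun_prop))
    refine this.congr (Eventually.of_forall fun x => ?_)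
    simp only [Pi.sub_apply]; ring
  have T4 : IntegrableOn (fun x => V x * lap φ x) (interior Ω) := iV _ (lap_continuous p1)
  have T5 : IntegrableOn (fun x => (U x - C * s + 0 * w x) * lap φ x) (interior Ω) :=
    iC _ (hvs.continuous.mul (lap_continuous p1))
  have T6 : IntegrableOn (fun x => max (U x - C * s) 0) (interior Ω) := iC _ (by fun_prop)
  have A1 : 0 ≤ ∫ x in interior Ω, (V x * lap φ x - (U x - C * s + 0 * w x) * lap φ x) := by
    rw [integral_sub T4 T5, t2]
    linarith [t1]
  have A2 : ∫ x in interior Ω, (V x * lap φ x - (U x - C * s + 0 * w x) * lap φ x) =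
      ∫ x in interior Ω, ((-2) * ((V x - (U x - C * s)) * χ1 (U x / s)) +
        s⁻¹ * ((V x - (U x - C * s)) * (χ2 (U x / s) * ‖gradient U x‖ ^ 2)) + 0 * V x) := by
    refine setIntegral_congr_fun isOpen_interior.measurableSet fun x hx => ?_
    change V x * lap φ x - (U x - C * s + 0 * w x) * lap φ x = (-2) * ((V x - (U x - C * s)) * χ1 (U x / s)) +
        s⁻¹ * ((V x - (U x - C * s)) * (χ2 (U x / s) * ‖gradient U x‖ ^ 2)) + 0 * V x
    rw [p5 x hx, h.lU x hx]; ring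
  rw [A2, int_lin3 T1 T2 iV1] at A1
  have A3 : ∫ x in interior Ω, (V x - (U x - C * s)) * (χ2 (U x / s) * ‖gradient U x‖ ^ 2) ≤
      ∫ x in interior Ω, s ^ 2 * (k x * ‖gradient U x‖ ^ 2 * χ2 (U x / s)) := by
    refine setIntegral_mono_on T2 (iC _ (by fun_prop)) isOpen_interior.measurableSet fun x hx => ?_
    by_cases hz : χ2 (U x / s) = 0
    · simp [hz]
    · have ha : (C + κ / 3) * s ≤ U x := by
        rw [← le_div_iff₀ hs]; by_contra hc; exact hz (hχ.twoa _ (not_le.1 hc))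
      have hb : U x ≤ (C + κ) * s := by
        rw [← div_le_iff₀ hs]; by_contra hc; exact hz (hχ.twob _ (not_le.1 hc).le)
      have hp : 0 ≤ χ2 (U x / s) * ‖gradient U x‖ ^ 2 := mul_nonneg (hχ.two0 _) (sq_nonneg _)
      calc (V x - (U x - C * s)) * (χ2 (U x / s) * ‖gradient U x‖ ^ 2)
          ≤ (s ^ 2 * k x) * (χ2 (U x / s) * ‖gradient U x‖ ^ 2) :=
            mul_le_mul_of_nonneg_right (K2 x hx ha hb) hp
        _ = _ := by ring
  rw [integral_const_mul] at A3
  have A4 : ∫ x in interior Ω, (V x - max (U x - C * s) 0) * (1 - χ1 (U x / s)) ≤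
      ∫ x in interior Ω, s ^ 2 * M * (1 - χ1 (U x / s)) := by
    refine setIntegral_mono_on T3 (iC _ (by fun_prop)) isOpen_interior.measurableSet fun x hx => ?_
    have hp : 0 ≤ 1 - χ1 (U x / s) := sub_nonneg.2 (hχ.one1 _)
    by_cases hz : 1 - χ1 (U x / s) = 0
    · simp [hz]
    · refine mul_le_mul_of_nonneg_right ?_ hp
      have hb : U x ≤ (C + κ) * s := by
        rw [← div_le_iff₀ hs]; by_contra hc; exact hz (by rw [hχ.oneb _ (not_le.1 hc).le]; ring)
      have hsM2 : 0 ≤ s ^ 2 * M := by positivity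
      rcases (P.V_nonneg x).eq_or_lt with h0 | h0
      · have h0 : V x = 0 := h0.symm
        rw [h0]
        linarith [le_max_right (U x - C * s) 0]
      · have h5 := K1 x hb h0
        have h6 : s ^ 2 * k x ≤ s ^ 2 * M := mul_le_mul_of_nonneg_left (hkM x hx).2 (sq_nonneg _)
        linarith [le_max_left (U x - C * s) 0]
  rw [integral_const_mul] at A4
  have A5 : ∫ x in interior Ω, V x = ∫ x in interior Ω, (1 * ((V x - (U x - C * s)) * χ1 (U x / s)) +
      1 * ((V x - max (U x - C * s) 0) * (1 - χ1 (U x / s))) + 1 * max (U x - C * s) 0) := by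
    congr 1
    funext x
    by_cases hz : χ1 (U x / s) = 0
    · rw [hz]; ring
    · have ha : (C + κ / 3) * s < U x := by
        rw [← lt_div_iff₀ hs]; by_contra hc; exact hz (hχ.onea _ (not_lt.1 hc))
      have : 0 ≤ U x - C * s := by nlinarith
      rw [max_eq_left this]; ring
  rw [int_lin3 T1 T3 T6] at A5
  rw [int_eq_set Vsupp, A5]
  have hsi : s * s⁻¹ = 1 := mul_inv_cancel₀ hs.ne'
  set X1 := ∫ x in interior Ω, (V x - (U x - C * s)) * χ1 (U x / s)
  set X2 := ∫ x in interior Ω, (V x - (U x - C * s)) * (χ2 (U x / s) * ‖gradient U x‖ ^ 2)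
  set X3 := ∫ x in interior Ω, k x * ‖gradient U x‖ ^ 2 * χ2 (U x / s)
  set X4 := ∫ x in interior Ω, (1 - χ1 (U x / s))
  set X5 := ∫ x in interior Ω, (V x - max (U x - C * s) 0) * (1 - χ1 (U x / s))
  have A6 : s⁻¹ * X2 ≤ s⁻¹ * (s ^ 2 * X3) := mul_le_mul_of_nonneg_left A3 (inv_nonneg.2 hs.le)
  have e1 : s ^ 2 * (s⁻¹ * X3 + 2 * M * (s * (s⁻¹ * X4))) = s⁻¹ * (s ^ 2 * X3) + 2 * (s ^ 2 * M * X4) := by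
    field_simp
  rw [e1]
  linarith


lemma tent_half {a C : ℝ} (h0 : 0 ≤ a) (h1 : a ≤ C) : ∫ t in (0:ℝ)..C, max (a - |t|) 0 = a ^ 2 / 2 := by
  have hc : Continuous (fun t : ℝ => max (a - |t|) 0) := by fun_prop
  rw [← intervalIntegral.integral_add_adjacent_intervals (b := a) (hc.intervalIntegrable _ _) (hc.intervalIntegrable _ _)]
  have e1 : ∫ t in (0:ℝ)..a, max (a - |t|) 0 = ∫ t in (0:ℝ)..a, (a - t) := by
    refine intervalIntegral.integral_congr fun t ht => ?_
    rw [uIcc_of_le h0] at ht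
    change max (a - |t|) 0 = a - t
    rw [abs_of_nonneg ht.1, max_eq_left (by linarith [ht.2])]
  have e2 : ∫ t in a..C, max (a - |t|) 0 = ∫ t in a..C, (0:ℝ) := by
    refine intervalIntegral.integral_congr fun t ht => ?_
    rw [uIcc_of_le h1] at ht
    change max (a - |t|) 0 = 0
    rw [abs_of_nonneg (h0.trans ht.1), max_eq_right (by linarith [ht.1])]
  rw [e1, e2]
  rw [intervalIntegral.integral_sub (by simp) (by simp)]
  simp
  ring

lemma tent {a C : ℝ} (h0 : 0 ≤ a) (h1 : a ≤ C) : ∫ t in (0:ℝ)..(2*C), max (a - |t - C|) 0 = a ^ 2 := by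
  have hc : Continuous (fun t : ℝ => max (a - |t|) 0) := by fun_prop
  rw [intervalIntegral.integral_comp_sub_right (fun t => max (a - |t|) 0) C]
  rw [← intervalIntegral.integral_add_adjacent_intervals (b := 0) (hc.intervalIntegrable _ _) (hc.intervalIntegrable _ _)]
  have e : ∫ t in (0 - C)..0, max (a - |t|) 0 = ∫ t in (0:ℝ)..C, max (a - |t|) 0 := by
    have := intervalIntegral.integral_comp_neg (a := 0) (b := C) (fun t : ℝ => max (a - |t|) 0)
    simp only [abs_neg, neg_zero] at this
    rw [zero_sub]; exact this.symm
  have e2 : 2 * C - C = C := by ring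
  rw [e, e2, tent_half h0 h1]; ring

lemma max_sum (v q : ℝ) : max (v + q) 0 + max (v - q) 0 = 2 * max v 0 + max (|q| - |v|) 0 := by
  rcases le_total 0 q with hq | hq <;> rcases le_total 0 v with hv | hv <;>
  simp only [abs_of_nonneg, abs_of_nonpos, hq, hv] <;> grind

lemma max_diff {v q : ℝ} : |max (v + q) 0 - max (v - q) 0 - 2 * q| ≤ 4 * |q| := by
  rcases le_total 0 q with hq | hq <;>
  simp only [abs_of_nonneg, abs_of_nonpos, hq] <;> rw [abs_le] <;> grind

lemma Core.lower {m : ℕ} {Ω : Set (EE (m+1))} {U w b : EE (m+1) → ℝ} (h : Core Ω U w b)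
    {C : ℝ} (hC : 1 ≤ C) (hwC : ∀ x ∈ Ω, |w x| ≤ C - 1) {c : ℝ} (H : LayerC Ω U c) :
    ∃ γ δ : ℝ → ℝ, ∃ δ0 : ℝ, Tendsto γ (𝓝[>] 0) (𝓝 (c * ∫ x in frontier Ω, w x ^ 2 / ‖gradient U x‖ ∂μH[(m:ℝ)])) ∧
      Tendsto δ (𝓝[>] 0) (𝓝 δ0) ∧
      ∀ s, 0 < s →
        (∫ x in interior Ω, max (U x - C * s + s * w x) 0) + (∫ x in interior Ω, max (U x - C * s + s * (- w x)) 0) =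
          2 * (∫ x in interior Ω, max (U x - C * s) 0) + s ^ 2 * γ s ∧
        |(∫ x in interior Ω, max (U x - C * s + s * w x) 0) - (∫ x in interior Ω, max (U x - C * s + s * (- w x)) 0)|
          ≤ s ^ 2 * δ s := by
  have hcU := h.dom.Uc
  have hcw := h.hw.continuous
  have L1 := H (fun x t => max (min (|w x|) C - |t - C|) 0) (by
    simp only [Function.uncurry_def]; fun_prop) (2 * C) (by positivity)
    (fun x t ht => by
      rw [abs_of_nonneg (a := t - C) (by linarith)]
      apply max_eq_right
      linarith [min_le_right (|w x|) C])
  have L2 := H (fun x t => 4 * C * max (2 * C + 1 - t) 0) (by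
    simp only [Function.uncurry_def]; fun_prop) (2 * C + 1) (by positivity)
    (fun x t ht => by rw [max_eq_right (by linarith), mul_zero])
  have e0 : ∫ x in frontier Ω, (∫ t in (0:ℝ)..(2 * C), max (min (|w x|) C - |t - C|) 0) / ‖gradient U x‖ ∂μH[(m:ℝ)]
      = ∫ x in frontier Ω, w x ^ 2 / ‖gradient U x‖ ∂μH[(m:ℝ)] := by
    refine setIntegral_congr_fun isClosed_frontier.measurableSet fun x hx => ?_
    have hw1 := hwC x (h.dom.frsub hx)
    have e : min (|w x|) C = |w x| := min_eq_left (by linarith)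
    rw [e, tent (abs_nonneg _) (by linarith), sq_abs]
  rw [e0] at L1
  refine ⟨_, _, _, L1, L2, fun s hs => ?_⟩
  have iC : ∀ f : EE (m+1) → ℝ, Continuous f → IntegrableOn f (interior Ω) := fun f hf => h.dom.intint hf.continuousOn
  have i1 := iC (fun x => max (U x - C * s + s * w x) 0) (by fun_prop)
  have i2 := iC (fun x => max (U x - C * s + s * (- w x)) 0) (by fun_prop)
  have i3 := iC (fun x => max (U x - C * s) 0) (by fun_prop)
  have i4 := iC (fun x => s * max (min (|w x|) C - |U x / s - C|) 0) (by fun_prop)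
  have i5 := iC (fun x => s * (4 * C * max (2 * C + 1 - U x / s) 0)) (by fun_prop)
  have i6 := iC w hcw
  have hsq : ∀ X : ℝ, s ^ 2 * (s⁻¹ * X) = s * X := fun X => by field_simp
  constructor
  · have e : ∫ x in interior Ω, (max (U x - C * s + s * w x) 0 + max (U x - C * s + s * (- w x)) 0) =
      ∫ x in interior Ω, (2 * max (U x - C * s) 0 + s * max (min (|w x|) C - |U x / s - C|) 0) := by
      refine setIntegral_congr_fun isOpen_interior.measurableSet fun x hx => ?_
      have hw1 := hwC x (interior_subset hx)
      have e : min (|w x|) C = |w x| := min_eq_left (by linarith)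
      have e2 := max_sum (U x - C * s) (s * w x)
      have e3 : s * max (|w x| - |U x / s - C|) 0 = max (|s * w x| - |U x - C * s|) 0 := by
        rw [mul_max_of_nonneg _ _ hs.le, mul_zero, mul_sub, abs_mul, abs_of_pos hs]
        congr 2
        rw [← abs_of_pos hs, ← abs_mul, abs_of_pos hs]
        congr 1; field_simp
      change max (U x - C * s + s * w x) 0 + max (U x - C * s + s * (- w x)) 0 =
        2 * max (U x - C * s) 0 + s * max (min (|w x|) C - |U x / s - C|) 0
      rw [e, e3, ← e2, mul_neg, sub_eq_add_neg]
      ring_nf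
    rw [integral_add i1 i2, integral_add (i3.const_mul 2) i4, integral_const_mul, integral_const_mul] at e
    rw [e, hsq]
  · have e : (∫ x in interior Ω, max (U x - C * s + s * w x) 0) - (∫ x in interior Ω, max (U x - C * s + s * (- w x)) 0)
       = ∫ x in interior Ω, (1 * max (U x - C * s + s * w x) 0 + (-1) * max (U x - C * s + s * (- w x)) 0 + (-2 * s) * w x) := by
      rw [int_lin3 i1 i2 i6, h.wzero]; ring
    rw [e, hsq, ← integral_const_mul]
    refine (abs_integral_le_integral_abs).trans ?_
    refine setIntegral_mono_on ((iC _ (by fun_prop)) ) i5 isOpen_interior.measurableSet fun x hx => ?_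
    have hw1 := hwC x (interior_subset hx)
    have hq : |s * w x| ≤ s * C := by rw [abs_mul, abs_of_pos hs]; gcongr; linarith
    have e1 : 1 * max (U x - C * s + s * w x) 0 + (-1) * max (U x - C * s + s * (- w x)) 0 + (-2 * s) * w x =
      max (U x - C * s + s * w x) 0 - max (U x - C * s - s * w x) 0 - 2 * (s * w x) := by
      rw [mul_neg, ← sub_eq_add_neg]; ring
    rw [e1]
    rcases le_total (U x) (2 * C * s) with hU | hU
    · refine max_diff.trans ?_
      have : 1 ≤ max (2 * C + 1 - U x / s) 0 := by
        refine le_max_of_le_left ?_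
        have := (div_le_iff₀ hs).2 hU
        linarith
      calc 4 * |s * w x| ≤ s * (4 * C * 1) := by linarith
        _ ≤ _ := by gcongr
    · have h1 := abs_le.1 hq
      have : 0 ≤ s * (4 * C * max (2 * C + 1 - U x / s) 0) :=
        mul_nonneg hs.le (mul_nonneg (by linarith) (le_max_right _ _))
      rw [max_eq_left (by linarith), max_eq_left (by linarith)]
      refine le_trans (le_of_eq ?_) this
      rw [abs_eq_zero]; ring

theorem Core.concl {m : ℕ} {Ω : Set (EE (m+1))} {U w b : EE (m+1) → ℝ} (h : Core Ω U w b) :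
    ∫ x in frontier Ω, (b x * ‖gradient U x‖ + 2 * (w x ^ 2 / ‖gradient U x‖)) ∂μH[(m:ℝ)] ≤ 0 := by
  have hcU := h.dom.Uc
  have hcw := h.hw.continuous
  have hcb := h.hb
  have hcg := h.dom.gc
  obtain ⟨c, hc, H⟩ := h.dom.layer
  obtain ⟨W, hW⟩ := h.dom.cpt.exists_bound_of_continuousOn hcw.continuousOn
  have hW0 : 0 ≤ W := (norm_nonneg _).trans (hW _ (interior_subset h.dom.ne.some_mem))
  set C := W + 1 with hCdef
  have hC : 1 ≤ C := by linarith
  have hwC : ∀ x ∈ Ω, |w x| ≤ C - 1 := fun x hx => by have := hW x hx; rw [Real.norm_eq_abs] at this; linarith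
  obtain ⟨γ, δ, δ0, hγ, hδ, hlow⟩ := h.lower hC hwC H
  obtain ⟨s1, hs1, HP⟩ := h.pair hC hwC
  have iC : ∀ f : EE (m+1) → ℝ, Continuous f → IntegrableOn f (interior Ω) := fun f hf => h.dom.intint hf.continuousOn
  have j1 : IntegrableOn (fun x => b x * ‖gradient U x‖) (frontier Ω) μH[(m:ℝ)] := h.dom.frint (by fun_prop)
  have j2 : IntegrableOn (fun x => ‖gradient U x‖) (frontier Ω) μH[(m:ℝ)] := h.dom.frint (by fun_prop)
  have j3 : IntegrableOn (fun x => w x ^ 2 / ‖gradient U x‖) (frontier Ω) μH[(m:ℝ)] :=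
    h.dom.frint (h.dom.gdiv (f := fun x => w x ^ 2) (by fun_prop))
  have hP : Tendsto (fun s : ℝ => ∫ x in interior Ω, max (U x - C * s) 0) (𝓝[>] 0) (𝓝 (∫ x in interior Ω, U x)) := by
    have hfin : volume (interior Ω) < ∞ := (measure_mono interior_subset).trans_lt h.dom.cpt.measure_lt_top
    rw [tendsto_iff_norm_sub_tendsto_zero]
    have id0 : Tendsto (fun s : ℝ => C * s * volume.real (interior Ω)) (𝓝[>] 0) (𝓝 0) := by
      have : Tendsto (fun s : ℝ => C * s * volume.real (interior Ω)) (𝓝 0) (𝓝 (C * 0 * volume.real (interior Ω))) :=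
        (Continuous.tendsto (by fun_prop) _)
      rw [mul_zero, zero_mul] at this
      exact this.mono_left nhdsWithin_le_nhds
    refine squeeze_zero' (Eventually.of_forall fun _ => norm_nonneg _) ?_ id0
    filter_upwards [self_mem_nhdsWithin] with s hs
    have hs : 0 < s := hs
    rw [← integral_sub (iC _ (by fun_prop)) (iC _ hcU)]
    refine norm_setIntegral_le_of_norm_le_const hfin fun x hx => ?_
    have := h.dom.pos x hx
    have hCs : 0 ≤ C * s := by positivity
    rw [Real.norm_eq_abs, abs_le]
    constructor
    · linarith [le_max_left (U x - C * s) 0]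
    · rcases max_cases (U x - C * s) 0 with h | h <;> linarith
  have hP0 : 0 < ∫ x in interior Ω, U x := by
    rw [setIntegral_pos_iff_support_of_nonneg_ae]
    · refine (isOpen_interior.measure_pos volume h.dom.ne).trans_le (measure_mono fun x hx => ?_)
      exact ⟨(h.dom.pos x hx).ne', hx⟩
    · filter_upwards [ae_restrict_mem isOpen_interior.measurableSet] with x hx using (h.dom.pos x hx).le
    · exact iC _ hcU
  set G := ∫ x in frontier Ω, w x ^ 2 / ‖gradient U x‖ ∂μH[(m:ℝ)] with hG
  set Bb := ∫ x in frontier Ω, b x * ‖gradient U x‖ ∂μH[(m:ℝ)] with hBb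
  set N := ∫ x in frontier Ω, ‖gradient U x‖ ∂μH[(m:ℝ)] with hN
  have key : ∀ ε > 0, G ≤ - Bb / 2 + ε * N := by
    intro ε hε
    obtain ⟨β, hβ, hup⟩ := h.upper hC hwC H hε
    have e : ∫ x in frontier Ω, (- b x / 2 + ε) * ‖gradient U x‖ ∂μH[(m:ℝ)] = - Bb / 2 + ε * N := by
      have := int_lin3 j1 j2 j2 (-1/2) ε 0
      rw [zero_mul, add_zero] at this
      rw [show - Bb / 2 + ε * N = -1/2 * Bb + ε * N by ring, ← this]
      congr 1; funext x; ring
    rw [e] at hβ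
    set X := - Bb / 2 + ε * N
    have id0 : Tendsto (fun s : ℝ => s ^ 2) (𝓝[>] 0) (𝓝 0) := by
      have : Tendsto (fun s : ℝ => s ^ 2) (𝓝 0) (𝓝 (0 ^ 2)) := (Continuous.tendsto (by fun_prop) _)
      rw [zero_pow (by norm_num)] at this
      exact this.mono_left nhdsWithin_le_nhds
    have lim1 := (hβ.sub hγ).mul ((hP.const_mul 4).add (id0.mul (hβ.add hγ)))
    have lim2 := (id0.mul (hδ.pow 2)).neg
    have ev : ∀ᶠ s in 𝓝[>] (0:ℝ), -(s ^ 2 * (δ s) ^ 2) ≤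
        (β s - γ s) * (4 * (∫ x in interior Ω, max (U x - C * s) 0) + s ^ 2 * (β s + γ s)) := by
      filter_upwards [hup, Ioo_mem_nhdsGT hs1] with s u m1
      have hs : 0 < s := m1.1
      have P := HP s hs m1.2
      have pl := P.pl (iC _ (by fun_prop)) (iC _ (by fun_prop))
      obtain ⟨l1, l2⟩ := hlow s hs
      have hV0 : 0 ≤ ∫ x, Vf (SA Ω U w C s) (SA Ω U (fun x => - w x) C s)
        (fun x => U x - C * s + s * w x) (fun x => U x - C * s + s * (- w x)) x := integral_nonneg P.V_nonneg
      set V := ∫ x, Vf (SA Ω U w C s) (SA Ω U (fun x => - w x) C s)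
        (fun x => U x - C * s + s * w x) (fun x => U x - C * s + s * (- w x)) x
      set I1 := ∫ x in interior Ω, max (U x - C * s + s * w x) 0
      set I2 := ∫ x in interior Ω, max (U x - C * s + s * (- w x)) 0
      set PP := ∫ x in interior Ω, max (U x - C * s) 0
      have q1 : (2 * V) ^ 2 ≤ (2 * PP + s ^ 2 * β s) ^ 2 := pow_le_pow_left₀ (by positivity) u 2
      have q2 : (I1 - I2) ^ 2 ≤ (s ^ 2 * δ s) ^ 2 := by
        rw [← sq_abs (I1 - I2)]; exact pow_le_pow_left₀ (abs_nonneg _) l2 2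
      have q3 : (2 * PP + s ^ 2 * γ s) ^ 2 - (s ^ 2 * δ s) ^ 2 ≤ (2 * PP + s ^ 2 * β s) ^ 2 := by
        rw [← l1]; nlinarith
      have q4 : 0 ≤ s ^ 2 * ((β s - γ s) * (4 * PP + s ^ 2 * (β s + γ s)) + s ^ 2 * (δ s) ^ 2) := by
        linear_combination q3
      have q5 := nonneg_of_mul_nonneg_right q4 (by positivity)
      linarith
    have fin := le_of_tendsto_of_tendsto lim2 lim1 ev
    simp only [zero_mul, neg_zero, add_zero] at fin
    have h1 : 0 ≤ c * X - c * G := by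
      by_contra hcn
      have := mul_neg_of_neg_of_pos (not_le.1 hcn) (by linarith : 0 < 4 * ∫ x in interior Ω, U x)
      linarith
    rw [← mul_sub] at h1
    have := nonneg_of_mul_nonneg_right h1 hc
    linarith
  have fin : G ≤ - Bb / 2 := by
    have hl : Tendsto (fun ε : ℝ => - Bb / 2 + ε * N) (𝓝[>] 0) (𝓝 (- Bb / 2)) := by
      have : Tendsto (fun ε : ℝ => - Bb / 2 + ε * N) (𝓝 0) (𝓝 (- Bb / 2 + 0 * N)) := (Continuous.tendsto (by fun_prop) _)
      rw [zero_mul, add_zero] at this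
      exact this.mono_left nhdsWithin_le_nhds
    refine ge_of_tendsto hl ?_
    filter_upwards [self_mem_nhdsWithin] with ε hε using key ε hε
  rw [integral_add j1 (j3.const_mul 2), integral_const_mul]
  linarith


lemma seg_frontier {n : ℕ} {Ω : Set (EE n)} (hc : IsClosed Ω) {a z : EE n} (ha : a ∈ Ω) (hz : z ∉ Ω) :
    ∃ τ ∈ Icc (0:ℝ) 1, a + τ • (z - a) ∈ frontier Ω := by
  by_contra hcon
  have hsub : segment ℝ a z ⊆ interior Ω ∪ Ωᶜ := by
    intro x hx
    by_cases hxΩ : x ∈ Ω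
    · left
      by_contra hi
      rw [segment_eq_image'] at hx
      obtain ⟨τ, hτ, rfl⟩ := hx
      exact hcon ⟨τ, hτ, by rw [hc.frontier_eq]; exact ⟨hxΩ, hi⟩⟩
    · exact Or.inr hxΩ
  rcases (convex_segment a z).isPreconnected.subset_or_subset isOpen_interior hc.isOpen_compl
    (disjoint_compl_right.mono_left interior_subset) hsub with h | h
  · exact hz (interior_subset (h (right_mem_segment ℝ a z)))
  · exact h (left_mem_segment ℝ a z) ha

lemma lap_min {n : ℕ} {f : EE n → ℝ} (hf : ContDiff ℝ 2 f) {x : EE n} (h : IsLocalMin f x) : 0 ≤ lap f x := by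
  by_contra hl
  push Not at hl
  obtain ⟨r0, hr0, H⟩ := dlap_taylor hf (isCompact_singleton (x := x)) (ε := - lap f x / 2) (by linarith)
  obtain ⟨ρ, hρ, hb⟩ := Metric.eventually_nhds_iff.1 h
  set r := min r0 (ρ / 2) with hr
  have hrp : 0 < r := lt_min hr0 (by positivity)
  have h1 := abs_le.1 (H r hrp (min_le_left _ _) x rfl)
  have hρ2 : r < ρ := (min_le_right _ _).trans_lt (by linarith)
  have h2 : 0 ≤ dlap r f x := by
    refine Finset.sum_nonneg fun i _ => ?_
    have a1 := hb (y := x + r • EuclideanSpace.single i 1) (by simp [dist_eq_norm, norm_smul, abs_of_pos hrp, hρ2])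
    have a2 := hb (y := x - r • EuclideanSpace.single i 1) (by simp [dist_eq_norm, norm_smul, abs_of_pos hrp, hρ2])
    linarith
  have : 0 < r ^ 2 := by positivity
  nlinarith [h1.2]

lemma min_pr {n : ℕ} {K : Set (EE n)} (hK : IsCompact K) {f : EE n → ℝ} (hf : ContDiff ℝ 2 f)
    (hl : ∀ x ∈ interior K, lap f x < 0) (hb : ∀ x ∈ frontier K, 0 ≤ f x) :
    (∀ x ∈ K, 0 ≤ f x) ∧ ∀ x ∈ interior K, 0 < f x := by
  have nomin : ∀ x ∈ interior K, ¬ IsMinOn f K x := by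
    intro x hx hm
    have := lap_min hf (hm.isLocalMin (mem_interior_iff_mem_nhds.1 hx))
    linarith [hl x hx]
  have h1 : ∀ x ∈ K, 0 ≤ f x := by
    intro x hx
    obtain ⟨x0, hx0, hmin⟩ := hK.exists_isMinOn ⟨x, hx⟩ hf.continuous.continuousOn
    have : x0 ∈ frontier K := by
      rw [hK.isClosed.frontier_eq]
      exact ⟨hx0, fun hi => nomin x0 hi hmin⟩
    exact (hb x0 this).trans (hmin hx)
  refine ⟨h1, fun x hx => lt_of_le_of_ne (h1 x (interior_subset hx)) fun h0 => nomin x hx ?_⟩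
  intro y hy
  change f x ≤ f y
  rw [← h0]; exact h1 y hy

/-- geometric hypotheses -/
structure Geo {m : ℕ} (Ω : Set (EE (m+1))) (ν : EE (m+1) → EE (m+1)) : Prop where
  cpt : IsCompact Ω
  conv : Convex ℝ Ω
  ne : (interior Ω).Nonempty
  unit : ∀ x ∈ frontier Ω, ‖ν x‖ = 1
  supp : ∀ x ∈ frontier Ω, ∀ y ∈ Ω, ⟪y - x, ν x⟫_ℝ ≤ 0
  diff : ∀ x ∈ frontier Ω, DifferentiableAt ℝ ν x

namespace Geo
variable {m : ℕ} {Ω : Set (EE (m+1))} {ν : EE (m+1) → EE (m+1)}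

lemma frsub (h : Geo Ω ν) : frontier Ω ⊆ Ω := h.cpt.isClosed.frontier_subset

lemma lip (h : Geo Ω ν) {y : EE (m+1)} (hy : y ∈ frontier Ω) :
    ∃ L > (0:ℝ), ∃ δ > (0:ℝ), ∀ x, ‖x - y‖ < δ → ‖ν x - ν y‖ ≤ L * ‖x - y‖ := by
  have := (h.diff y hy).isBigO_sub
  obtain ⟨L, hL, hb⟩ := this.exists_pos
  rw [Asymptotics.IsBigOWith] at hb
  obtain ⟨δ, hδ, H⟩ := Metric.eventually_nhds_iff.1 hb
  exact ⟨L, hL, δ, hδ, fun x hx => H (by rwa [dist_eq_norm])⟩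

lemma inward (h : Geo Ω ν) {y : EE (m+1)} (hy : y ∈ frontier Ω) :
    ∃ R0 > (0:ℝ), ∀ R : ℝ, 0 < R → R < R0 → y - R • ν y ∈ Ω := by
  obtain ⟨L, hL, δ, hδ, Hl⟩ := h.lip hy
  obtain ⟨o, ho⟩ := h.ne
  obtain ⟨ρ, hρ, hball⟩ := Metric.nhds_basis_closedBall.mem_iff.1 (mem_interior_iff_mem_nhds.1 ho)
  have hyn := h.unit y hy
  have hsup : ρ ≤ ⟪y - o, ν y⟫_ℝ := by
    have h1 := h.supp y hy (o + ρ • ν y) (hball (by simp [norm_smul, hyn, abs_of_pos hρ]))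
    have e : o + ρ • ν y - y = ρ • ν y - (y - o) := by abel
    rw [e, inner_sub_left, inner_smul_left, real_inner_self_eq_norm_sq, hyn] at h1
    simp at h1; linarith
  set D := ‖o - y‖ + 1 with hD
  have hDp : 0 < D := by positivity
  set μ := min 1 ρ with hμ
  have hμp : 0 < μ := lt_min one_pos hρ
  refine ⟨min 1 (min (δ / D) (μ / (L * D * D))), by positivity, fun R hR hR0 => ?_⟩
  have r1 : R < 1 := hR0.trans_le (min_le_left _ _)
  have r2 : R * D < δ := (lt_div_iff₀ hDp).1 (hR0.trans_le ((min_le_right _ _).trans (min_le_left _ _)))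
  have r3 : R * (L * D * D) < μ :=
    (lt_div_iff₀ (by positivity)).1 (hR0.trans_le ((min_le_right _ _).trans (min_le_right _ _)))
  by_contra hc
  have hin : y + R • (o - y) ∈ Ω := by
    have := h.conv (h.frsub hy) (interior_subset ho) (a := 1 - R) (b := R) (by linarith) hR.le (by ring)
    convert this using 1
    module
  obtain ⟨τ, hτ, hx⟩ := seg_frontier h.cpt.isClosed hin hc
  set x := y + R • (o - y) + τ • (y - R • ν y - (y + R • (o - y))) with hxdef
  have e1 : y - x = R • ((1 - τ) • (y - o) + τ • ν y) := by rw [hxdef]; module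
  have n1 : ‖y - x‖ ≤ R * D := by
    rw [e1, norm_smul, Real.norm_of_nonneg hR.le]
    gcongr
    refine (norm_add_le _ _).trans ?_
    rw [norm_smul, norm_smul, hyn, Real.norm_of_nonneg hτ.1, Real.norm_of_nonneg (by linarith [hτ.2]), norm_sub_rev y o]
    nlinarith [norm_nonneg (o - y), hτ.1, hτ.2]
  have i1 : R * μ ≤ ⟪y - x, ν y⟫_ℝ := by
    rw [e1, inner_smul_left, inner_add_left, inner_smul_left, inner_smul_left, real_inner_self_eq_norm_sq, hyn]
    simp only [conj_trivial]
    refine mul_le_mul_of_nonneg_left ?_ hR.le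
    have a1 : μ ≤ 1 := min_le_left _ _
    have a2 : μ ≤ ⟪y - o, ν y⟫_ℝ := (min_le_right _ _).trans hsup
    nlinarith [hτ.1, hτ.2]
  have i2 := h.supp x hx y (h.frsub hy)
  have i3 : ‖ν x - ν y‖ ≤ L * (R * D) := by
    have := Hl x (by rw [norm_sub_rev]; linarith)
    rw [norm_sub_rev x y] at this
    exact this.trans (mul_le_mul_of_nonneg_left n1 hL.le)
  have i4 : ⟪y - x, ν y⟫_ℝ - ⟪y - x, ν x⟫_ℝ ≤ (R * D) * (L * (R * D)) := by
    rw [← inner_sub_right]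
    refine (real_inner_le_norm _ _).trans ?_
    rw [norm_sub_rev (ν y)]
    gcongr
  have i5 : R * (R * (L * D * D)) < R * μ := mul_lt_mul_of_pos_left r3 hR
  nlinarith

lemma ball (h : Geo Ω ν) {y : EE (m+1)} (hy : y ∈ frontier Ω) :
    ∃ R > (0:ℝ), Metric.closedBall (y - R • ν y) R ⊆ Ω := by
  obtain ⟨L, hL, δ, hδ, Hl⟩ := h.lip hy
  obtain ⟨R0, hR0, hin⟩ := h.inward hy
  have hyn := h.unit y hy
  obtain ⟨R, hR, r1, r2, r3⟩ : ∃ R > (0:ℝ), R < R0 ∧ 2 * R < δ ∧ L * (2 * R) < 1 := by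
    refine ⟨min (R0 / 2) (min (δ / 4) (1 / (4 * L))), by positivity, ?_, ?_, ?_⟩
    · exact (min_le_left _ _).trans_lt (by linarith)
    · have := (min_le_right (R0/2) _).trans (min_le_left (δ / 4) (1 / (4 * L)))
      linarith
    · have := (min_le_right (R0/2) _).trans (min_le_right (δ / 4) (1 / (4 * L)))
      have h2 := mul_le_mul_of_nonneg_left this hL.le
      have h3 : L * (1 / (4 * L)) = 1 / 4 := by field_simp
      linarith
  refine ⟨R, hR, ?_⟩
  set c := y - R • ν y with hc
  have hcΩ : c ∈ Ω := hin R hR r1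
  have segd : ∀ z, z ∉ Ω → ∃ x ∈ frontier Ω, ‖x - c‖ < ‖z - c‖ := by
    intro z hz
    obtain ⟨τ, hτ, hx⟩ := seg_frontier h.cpt.isClosed hcΩ hz
    refine ⟨_, hx, ?_⟩
    have hτ1 : τ ≠ 1 := by
      rintro rfl
      apply hz
      have := h.frsub hx
      simpa using this
    have hzc : 0 < ‖z - c‖ := norm_pos_iff.2 (sub_ne_zero.2 fun e => hz (e ▸ hcΩ))
    rw [add_sub_cancel_left, norm_smul, Real.norm_of_nonneg hτ.1]
    have : τ < 1 := lt_of_le_of_ne hτ.2 hτ1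
    nlinarith
  intro z hz
  by_contra hzn
  rw [mem_closedBall_iff_norm] at hz
  have hfc : IsCompact (frontier Ω) := h.cpt.of_isClosed_subset isClosed_frontier h.frsub
  obtain ⟨p, hp, hmin⟩ := hfc.exists_isMinOn ⟨y, hy⟩ (f := fun x => ‖x - c‖) (by fun_prop)
  set d := ‖p - c‖ with hd
  have hdR : d < R := by
    obtain ⟨x, hx, hlt⟩ := segd z hzn
    have : d ≤ ‖x - c‖ := hmin hx
    linarith
  have hpn := h.unit p hp
  have hbd : ∀ z, ‖z - c‖ < d → z ∈ Ω := by
    intro z hz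
    by_contra hzn
    obtain ⟨x, hx, hlt⟩ := segd z hzn
    have : d ≤ ‖x - c‖ := hmin hx
    linarith
  have hd0 : 0 ≤ d := norm_nonneg _
  have q1 : d ≤ ⟪p - c, ν p⟫_ℝ := by
    rcases hd0.eq_or_lt with h0 | h0
    · have : p - c = 0 := norm_eq_zero.1 h0.symm
      rw [this, inner_zero_left]; exact h0.ge
    refine le_of_forall_lt_imp_le_of_dense fun t ht => ?_
    rcases lt_or_ge t 0 with htn | htn
    · have hcc := h.supp p hp c hcΩ
      rw [← neg_sub, inner_neg_left] at hcc
      linarith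
    · have := h.supp p hp (c + t • ν p) (hbd _ (by simpa [norm_smul, hpn, abs_of_nonneg htn] using ht))
      have e : c + t • ν p - p = t • ν p - (p - c) := by abel
      rw [e, inner_sub_left, inner_smul_left, real_inner_self_eq_norm_sq, hpn] at this
      simp at this; linarith
  have q2 : p - c = d • ν p := by
    rw [← sub_eq_zero, ← norm_eq_zero, ← sq_eq_zero_iff, norm_sub_sq_real, inner_smul_right, norm_smul, hpn,
      Real.norm_of_nonneg hd0]
    have : ‖p - c‖ = d := rfl
    have h2 := real_inner_le_norm (p - c) (ν p)
    rw [hpn, this] at h2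
    have h3 : ⟪p - c, ν p⟫_ℝ = d := le_antisymm (by linarith) q1
    rw [h3, this]; ring
  have q3 : y - p = R • ν y - d • ν p := by rw [← q2, hc]; abel
  have q4 := h.supp p hp y (h.frsub hy)
  rw [q3, inner_sub_left, inner_smul_left, inner_smul_left, real_inner_self_eq_norm_sq, hpn] at q4
  simp only [conj_trivial, one_pow, mul_one] at q4
  have q5 : ‖ν p - ν y‖ ^ 2 = 2 - 2 * ⟪ν y, ν p⟫_ℝ := by
    rw [norm_sub_sq_real, hpn, hyn, real_inner_comm]; ring
  have q6 : ‖p - y‖ ^ 2 = (R - d) ^ 2 + d * R * ‖ν p - ν y‖ ^ 2 := by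
    rw [norm_sub_rev, q3, q5, norm_sub_sq_real, inner_smul_left, inner_smul_right, norm_smul, norm_smul, hpn, hyn]
    simp only [conj_trivial, Real.norm_eq_abs, mul_one, sq_abs]
    ring
  set θ := ‖ν p - ν y‖ with hθ
  have hθ0 : 0 ≤ θ := norm_nonneg _
  have hθ2 : θ ≤ 2 := by
    have := norm_sub_le (ν p) (ν y)
    rw [hpn, hyn] at this; linarith
  have q7 : R - d ≤ R * θ ^ 2 / 2 := by rw [q5]; linarith
  have q8 : ‖p - y‖ ^ 2 ≤ (2 * R * θ) ^ 2 := by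
    have a1 : (R - d) ^ 2 ≤ (R * θ ^ 2 / 2) ^ 2 := pow_le_pow_left₀ (by linarith) q7 2
    have a2 : d * R * θ ^ 2 ≤ R * R * θ ^ 2 := by gcongr
    have a3 : (R * θ ^ 2 / 2) ^ 2 ≤ (R * θ) ^ 2 := by
      apply pow_le_pow_left₀ (by positivity)
      nlinarith [mul_nonneg hR.le hθ0]
    rw [q6]; nlinarith [sq_nonneg (R * θ)]
  have q9 : ‖p - y‖ ≤ 2 * R * θ := abs_le_of_sq_le_sq' q8 (by positivity) |>.2
  have q10 : ‖p - y‖ < δ := by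
    have : p - y = (p - c) - R • ν y := by rw [hc]; abel
    rw [this]
    refine (norm_sub_le _ _).trans_lt ?_
    rw [norm_smul, hyn, Real.norm_of_nonneg hR.le]
    linarith
  have q11 := Hl p q10
  have q12 : θ ≤ L * (2 * R) * θ := by
    refine q11.trans ?_
    rw [mul_assoc]; exact mul_le_mul_of_nonneg_left q9 hL.le
  have q13 : θ = 0 := by
    by_contra hne
    have : 0 < θ := lt_of_le_of_ne hθ0 (Ne.symm hne)
    nlinarith
  rw [q13] at q7
  linarith

end Geo


lemma dir_nonneg {n : ℕ} {f : EE n → ℝ} {y v : EE n} (hf : DifferentiableAt ℝ f y) {t0 : ℝ} (ht0 : 0 < t0)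
    (h : ∀ t : ℝ, 0 < t → t < t0 → f y ≤ f (y + t • v)) : 0 ≤ fderiv ℝ f y v := by
  have h1 : HasDerivAt (fun t : ℝ => f (y + t • v)) (fderiv ℝ f y v) 0 := by
    have := hf.hasFDerivAt.hasLineDerivAt v
    exact this
  have h2 := h1.tendsto_slope_zero_right
  refine ge_of_tendsto h2 ?_
  filter_upwards [Ioo_mem_nhdsGT ht0] with t ht
  have := h t ht.1 ht.2
  simp only [zero_add, zero_smul, add_zero, smul_eq_mul]
  exact mul_nonneg (inv_nonneg.2 ht.1.le) (by linarith)

lemma fderiv_nsq {n : ℕ} (c y v : EE n) : fderiv ℝ (fun x : EE n => ‖x - c‖ ^ 2) y v = 2 * ⟪y - c, v⟫_ℝ := by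
  have h := ((hasFDerivAt_id (𝕜 := ℝ) y).sub_const c).norm_sq
  have h' : HasFDerivAt (fun x : EE n => ‖x - c‖ ^ 2) _ y := h
  rw [h'.fderiv]
  simp [inner_sub_left]

lemma lap_nsq {n : ℕ} (c x : EE n) : lap (fun x : EE n => ‖x - c‖ ^ 2) x = 2 * n := by
  unfold lap
  simp only [fderiv_nsq]
  have : ∀ i : Fin n, fderiv ℝ (fun y : EE n => 2 * ⟪y - c, EuclideanSpace.single i (1:ℝ)⟫_ℝ) x (EuclideanSpace.single i 1) = 2 := by
    intro i
    have h : HasFDerivAt (fun y : EE n => 2 * ⟪y - c, EuclideanSpace.single i (1:ℝ)⟫_ℝ)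
        ((2:ℝ) • (innerSL ℝ (EuclideanSpace.single i (1:ℝ)))) x := by
      have h1 := ((innerSL ℝ (EuclideanSpace.single i (1:ℝ)) : EE n →L[ℝ] ℝ).hasFDerivAt (x := x)).sub_const
        (⟪EuclideanSpace.single i (1:ℝ), c⟫_ℝ)
      have h2 := h1.const_smul (2:ℝ)
      refine h2.congr_of_eventuallyEq (Eventually.of_forall fun y => ?_)
      simp only [smul_eq_mul, innerSL_apply_apply, Pi.smul_apply]
      rw [real_inner_comm, inner_sub_right]
    rw [h.fderiv]
    simp
  rw [Finset.sum_congr rfl fun i _ => this i]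
  simp; ring

/-- torsion hypotheses -/
structure Tor {m : ℕ} (Ω : Set (EE (m+1))) (ν : EE (m+1) → EE (m+1)) (U : EE (m+1) → ℝ) : Prop extends Geo Ω ν where
  hU : ContDiff ℝ 2 U
  lU : ∀ x ∈ interior Ω, lap U x = -2
  zero : ∀ x ∈ frontier Ω, U x = 0

namespace Tor
variable {m : ℕ} {Ω : Set (EE (m+1))} {ν : EE (m+1) → EE (m+1)} {U : EE (m+1) → ℝ}

lemma minpr (h : Tor Ω ν U) : (∀ x ∈ Ω, 0 ≤ U x) ∧ ∀ x ∈ interior Ω, 0 < U x :=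
  min_pr h.cpt h.hU (fun x hx => by rw [h.lU x hx]; norm_num) (fun x hx => (h.zero x hx).ge)

lemma Ud (h : Tor Ω ν U) (y) : DifferentiableAt ℝ U y := (h.hU.differentiable (by norm_num)) y

lemma hopf (h : Tor Ω ν U) {y : EE (m+1)} (hy : y ∈ frontier Ω) : fderiv ℝ U y (ν y) < 0 := by
  obtain ⟨R, hR, hb⟩ := h.ball hy
  have hyn := h.unit y hy
  set c := y - R • ν y with hc
  set k : ℝ := 1 / (2 * (m + 1)) with hk
  have hkp : 0 < k := by positivity
  set f : EE (m+1) → ℝ := fun x => U x - k * R ^ 2 + k * ‖x - c‖ ^ 2 with hf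
  have hq : ContDiff ℝ 2 (fun x : EE (m+1) => ‖x - c‖ ^ 2) := (contDiff_id.sub contDiff_const).norm_sq ℝ
  have hfC : ContDiff ℝ 2 f := (h.hU.sub contDiff_const).add (contDiff_const.mul hq)
  have hfr := min_pr (isCompact_closedBall c R) hfC (fun x hx => by
      rw [hf, lap_lin h.hU hq, lap_nsq, h.lU x (interior_mono hb hx), hk]
      push_cast
      have : (1:ℝ) / (2 * (m + 1)) * (2 * (m + 1)) = 1 := by field_simp
      linarith) (fun x hx => by
      rw [frontier_closedBall c hR.ne'] at hx
      have hx' : ‖x - c‖ = R := by simpa [dist_eq_norm] using hx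
      simp only [hf, hx']
      have := h.minpr.1 x (hb (Metric.sphere_subset_closedBall hx))
      linarith)
  have hyc : y - c = R • ν y := by rw [hc]; abel
  have hfy : f y = 0 := by
    simp only [hf, hyc, norm_smul, hyn, h.zero y hy, Real.norm_of_nonneg hR.le]; ring
  have hd := dir_nonneg (f := f) (y := y) (v := - ν y) ((hfC.differentiable (by norm_num)) y) hR (fun t ht htR => by
    rw [hfy]
    apply hfr.1
    rw [mem_closedBall_iff_norm]
    have : y + t • -ν y - c = (R - t) • ν y := by rw [hc]; module
    rw [this, norm_smul, hyn, Real.norm_of_nonneg (by linarith)]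
    linarith)
  have hfd : fderiv ℝ f y (ν y) = fderiv ℝ U y (ν y) + k * (2 * R) := by
    have h1 := ((h.Ud y).hasFDerivAt.sub_const (k * R ^ 2)).add
      (((hq.differentiable (by norm_num)) y).hasFDerivAt.const_mul k)
    have h1' : HasFDerivAt f _ y := h1
    rw [h1'.fderiv]
    simp only [add_apply, smul_apply, fderiv_nsq, hyc, inner_smul_left,
      real_inner_self_eq_norm_sq, hyn]
    simp
  rw [map_neg, hfd] at hd
  have : 0 < k * (2 * R) := by positivity
  linarith

lemma cone (h : Tor Ω ν U) {y τ : EE (m+1)} (hy : y ∈ frontier Ω) (hτ : ⟪τ, ν y⟫_ℝ = 0) {η : ℝ} (hη : 0 < η) :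
    ∃ t0 > (0:ℝ), ∀ t : ℝ, 0 < t → t < t0 → y + t • (τ - η • ν y) ∈ Ω := by
  obtain ⟨R, hR, hb⟩ := h.ball hy
  have hyn := h.unit y hy
  refine ⟨2 * R * η / (‖τ‖ ^ 2 + η ^ 2), by positivity, fun t ht ht0 => hb ?_⟩
  rw [lt_div_iff₀ (by positivity)] at ht0
  rw [mem_closedBall_iff_norm]
  refine abs_le_of_sq_le_sq' (a := ‖_‖) ?_ hR.le |>.2
  have e : y + t • (τ - η • ν y) - (y - R • ν y) = t • τ + (R - t * η) • ν y := by module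
  rw [e, norm_add_sq_real, inner_smul_left, inner_smul_right, hτ, norm_smul, norm_smul, hyn]
  simp only [mul_zero, mul_one, Real.norm_eq_abs, sq_abs, mul_pow]
  nlinarith

lemma gradtan (h : Tor Ω ν U) {y τ : EE (m+1)} (hy : y ∈ frontier Ω) (hτ : ⟪τ, ν y⟫_ℝ = 0) :
    fderiv ℝ U y τ = 0 := by
  have key : ∀ σ : EE (m+1), ⟪σ, ν y⟫_ℝ = 0 → 0 ≤ fderiv ℝ U y σ := by
    intro σ hσ
    have h1 : ∀ η : ℝ, 0 < η → 0 ≤ fderiv ℝ U y σ - η * fderiv ℝ U y (ν y) := by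
      intro η hη
      obtain ⟨t0, ht0, H⟩ := h.cone hy hσ hη
      have := dir_nonneg (h.Ud y) ht0 (fun t ht htt => by
        rw [h.zero y hy]; exact h.minpr.1 _ (H t ht htt))
      simpa using this
    have hh := h.hopf hy
    by_contra hc
    push Not at hc
    have := h1 (fderiv ℝ U y σ / (2 * fderiv ℝ U y (ν y))) (by
      apply div_pos_of_neg_of_neg <;> linarith)
    have hne := hh.ne
    have e : fderiv ℝ U y σ / (2 * fderiv ℝ U y (ν y)) * fderiv ℝ U y (ν y) = fderiv ℝ U y σ / 2 := by
      field_simp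
    linarith
  have a := key τ hτ
  have b := key (-τ) (by rw [inner_neg_left, hτ, neg_zero])
  rw [map_neg] at b
  linarith

/-- gradient is normal -/
lemma grad_eq (h : Tor Ω ν U) {y : EE (m+1)} (hy : y ∈ frontier Ω) :
    gradient U y = - (‖gradient U y‖ • ν y) := by
  have hyn := h.unit y hy
  have e1 : gradient U y = ⟪gradient U y, ν y⟫_ℝ • ν y := by
    rw [← sub_eq_zero, ← norm_eq_zero, ← sq_eq_zero_iff, ← real_inner_self_eq_norm_sq]
    set τ := gradient U y - ⟪gradient U y, ν y⟫_ℝ • ν y with hτ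
    have ht : ⟪τ, ν y⟫_ℝ = 0 := by
      rw [hτ, inner_sub_left, inner_smul_left, real_inner_self_eq_norm_sq, hyn]; simp
    have h2 : ⟪gradient U y, τ⟫_ℝ = 0 := by rw [grad_inner]; exact h.gradtan hy ht
    have h3 : ⟪τ, τ⟫_ℝ = ⟪gradient U y, τ⟫_ℝ - ⟪gradient U y, ν y⟫_ℝ * ⟪ν y, τ⟫_ℝ := by
      conv_lhs => rw [hτ]
      rw [← hτ, inner_sub_left, inner_smul_left]; simp
    rw [h3, h2, real_inner_comm τ (ν y), ht]; simp
  have h4 := h.hopf hy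
  rw [← grad_inner] at h4
  have h5 : ‖gradient U y‖ = - ⟪gradient U y, ν y⟫_ℝ := by
    conv_lhs => rw [e1]
    rw [norm_smul, hyn, mul_one, Real.norm_of_nonpos h4.le]
  rw [h5, neg_smul, neg_neg]; exact e1

lemma gpos (h : Tor Ω ν U) {y : EE (m+1)} (hy : y ∈ frontier Ω) : 0 < ‖gradient U y‖ := by
  rw [norm_pos_iff]
  intro h0
  have := h.hopf hy
  rw [← grad_inner, h0, inner_zero_left] at this
  exact lt_irrefl _ this

lemma dom (h : Tor Ω ν U) : Dom Ω U :=
  ⟨h.cpt, h.conv, h.ne, h.hU, h.minpr.2, h.zero, fun _ hx => norm_pos_iff.1 (h.gpos hx)⟩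

/-- tangential derivative of functions vanishing on the boundary -/
lemma tang (h : Tor Ω ν U) {f : EE (m+1) → ℝ} {y τ : EE (m+1)} (hy : y ∈ frontier Ω) (hτ : ⟪τ, ν y⟫_ℝ = 0)
    (hf : DifferentiableAt ℝ f y) (h0 : ∀ x ∈ frontier Ω, f x = 0) : fderiv ℝ f y τ = 0 := by
  have hyn := h.unit y hy
  set A := fderiv ℝ f y with hA
  have key : ∀ η : ℝ, 0 < η → ‖A τ‖ ≤ η * (‖A‖ + ‖τ‖ + η) := by
    intro η hη
    obtain ⟨t0, ht0, H⟩ := h.cone hy hτ hη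
    have hlo := hf.hasFDerivAt.isLittleO
    have := (Asymptotics.isLittleO_iff.1 hlo) hη
    obtain ⟨δ, hδ, Hδ⟩ := Metric.eventually_nhds_iff.1 this
    set t := min (t0 / 2) (δ / (2 * (‖τ‖ + η))) with ht
    have htp : 0 < t := by positivity
    have ht1 : t < t0 := (min_le_left _ _).trans_lt (by linarith)
    have ht2 : t * (‖τ‖ + η) < δ := by
      have := (le_div_iff₀ (by positivity)).1 (min_le_right (t0 / 2) (δ / (2 * (‖τ‖ + η))))
      rw [← ht] at this
      nlinarith
    have hin := H t htp ht1
    have hout : y + t • (τ + η • ν y) ∉ Ω := by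
      intro hc
      have := h.supp y hy _ hc
      rw [add_sub_cancel_left, inner_smul_left, inner_add_left, hτ, inner_smul_left, real_inner_self_eq_norm_sq, hyn] at this
      simp at this
      nlinarith [mul_pos htp hη]
    obtain ⟨s, hs, hx⟩ := seg_frontier h.cpt.isClosed hin hout
    set x := y + t • (τ - η • ν y) + s • (y + t • (τ + η • ν y) - (y + t • (τ - η • ν y))) with hxd
    have e : x - y = t • τ + (t * η * (2 * s - 1)) • ν y := by rw [hxd]; module
    have habs : |2 * s - 1| ≤ 1 := by rw [abs_le]; constructor <;> linarith [hs.1, hs.2]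
    have nb : ‖(t * η * (2 * s - 1)) • ν y‖ ≤ t * η := by
      rw [norm_smul, hyn, mul_one, Real.norm_eq_abs, abs_mul, abs_of_pos (mul_pos htp hη)]
      nlinarith [mul_pos htp hη]
    have n1 : ‖x - y‖ ≤ t * (‖τ‖ + η) := by
      rw [e]
      refine (norm_add_le _ _).trans ?_
      rw [norm_smul, Real.norm_of_nonneg htp.le]
      linarith
    have hb := Hδ (y := x) (by rw [dist_eq_norm]; linarith)
    rw [h0 x hx, h0 y hy, sub_zero, zero_sub, norm_neg] at hb
    have e2 : t • A τ = A (x - y) - A ((t * η * (2 * s - 1)) • ν y) := by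
      rw [e, map_add, map_smul]; simp
    have n2 : ‖t • A τ‖ ≤ η * (t * (‖τ‖ + η)) + ‖A‖ * (t * η) := by
      rw [e2]
      refine (norm_sub_le _ _).trans (add_le_add ?_ ?_)
      · exact hb.trans (mul_le_mul_of_nonneg_left n1 hη.le)
      · exact (A.le_opNorm _).trans (mul_le_mul_of_nonneg_left nb (norm_nonneg _))
    rw [norm_smul, Real.norm_of_nonneg htp.le] at n2
    have : t * ‖A τ‖ ≤ t * (η * (‖A‖ + ‖τ‖ + η)) := by nlinarith
    exact le_of_mul_le_mul_left this htp
  have lim : Tendsto (fun η : ℝ => η * (‖A‖ + ‖τ‖ + η)) (𝓝[>] 0) (𝓝 0) := by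
    have : Continuous (fun η : ℝ => η * (‖A‖ + ‖τ‖ + η)) := by fun_prop
    have := this.tendsto 0
    simp only [zero_mul] at this
    exact this.mono_left nhdsWithin_le_nhds
  have := ge_of_tendsto lim (eventually_mem_nhdsWithin.mono fun η hη => key η hη)
  exact norm_le_zero_iff.1 this

end Tor


namespace Tor
variable {m : ℕ} {Ω : Set (EE (m+1))} {ν : EE (m+1) → EE (m+1)} {U : EE (m+1) → ℝ}

lemma DUd (h : Tor Ω ν U) (y) : DifferentiableAt ℝ (fderiv ℝ U) y :=
  ((h.hU.fderiv_right (m := 1) (by norm_num)).differentiable (by norm_num)) y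

lemma sym (h : Tor Ω ν U) (y u v : EE (m+1)) :
    fderiv ℝ (fderiv ℝ U) y u v = fderiv ℝ (fderiv ℝ U) y v u :=
  (h.hU.contDiffAt (x := y)).isSymmSndFDerivAt (by simp) u v

lemma DUv (h : Tor Ω ν U) {y : EE (m+1)} (hy : y ∈ frontier Ω) (v : EE (m+1)) :
    fderiv ℝ U y v = - (‖gradient U y‖ * ⟪ν y, v⟫_ℝ) := by
  rw [← grad_inner]
  conv_lhs => rw [h.grad_eq hy]
  rw [inner_neg_left, inner_smul_left]; simp

lemma DUn (h : Tor Ω ν U) {y : EE (m+1)} (hy : y ∈ frontier Ω) :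
    fderiv ℝ U y (ν y) = - ‖gradient U y‖ := by
  rw [h.DUv hy, real_inner_self_eq_norm_sq, h.unit y hy]; simp

lemma nunu (h : Tor Ω ν U) {y τ : EE (m+1)} (hy : y ∈ frontier Ω) (hτ : ⟪τ, ν y⟫_ℝ = 0) :
    ⟪fderiv ℝ ν y τ, ν y⟫_ℝ = 0 := by
  have hd := (h.diff y hy).hasFDerivAt
  have h1 : HasFDerivAt (fun x => ⟪ν x, ν x⟫_ℝ - 1) _ y := (hd.inner ℝ hd).sub_const 1
  have := h.tang hy hτ h1.differentiableAt (fun x hx => by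
    rw [real_inner_self_eq_norm_sq, h.unit x hx]; norm_num)
  rw [h1.fderiv] at this
  simp [fderivInnerCLM_apply] at this
  rw [real_inner_comm] at this
  linarith

lemma second (h : Tor Ω ν U) {y τ σ : EE (m+1)} (hy : y ∈ frontier Ω) (hτ : ⟪τ, ν y⟫_ℝ = 0) (hσ : ⟪σ, ν y⟫_ℝ = 0) :
    fderiv ℝ (fderiv ℝ U) y τ σ = - (‖gradient U y‖ * ⟪fderiv ℝ ν y τ, σ⟫_ℝ) := by
  have hd := (h.diff y hy).hasFDerivAt
  have hD := (h.DUd y).hasFDerivAt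
  have h1 : HasFDerivAt (fun x => fderiv ℝ U x σ - fderiv ℝ U x (ν x) * ⟪ν x, σ⟫_ℝ) _ y :=
    (hD.clm_apply (hasFDerivAt_const σ y)).sub ((hD.clm_apply hd).mul (hd.inner ℝ (hasFDerivAt_const σ y)))
  have := h.tang hy hτ h1.differentiableAt (fun x hx => by
    rw [h.DUn hx, h.DUv hx]; ring)
  rw [h1.fderiv] at this
  have hσ' : ⟪ν y, σ⟫_ℝ = 0 := by rw [real_inner_comm]; exact hσ
  simp [fderivInnerCLM_apply, hσ', h.DUn hy] at this
  linarith

lemma wtan (h : Tor Ω ν U) {y q : EE (m+1)} {w ψ : EE (m+1) → ℝ} (hy : y ∈ frontier Ω) (hq : ⟪q, ν y⟫_ℝ = 0)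
    (hw : DifferentiableAt ℝ w y) (hψ : DifferentiableAt ℝ ψ y)
    (hb : ∀ x ∈ frontier Ω, w x = ‖gradient U x‖ * ψ x) :
    fderiv ℝ w y q = - (ψ y * fderiv ℝ (fderiv ℝ U) y q (ν y)) + ‖gradient U y‖ * fderiv ℝ ψ y q := by
  have hd := (h.diff y hy).hasFDerivAt
  have hD := (h.DUd y).hasFDerivAt
  have h1 : HasFDerivAt (fun x => w x + fderiv ℝ U x (ν x) * ψ x) _ y :=
    hw.hasFDerivAt.add ((hD.clm_apply hd).mul hψ.hasFDerivAt)
  have := h.tang hy hq h1.differentiableAt (fun x hx => by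
    rw [h.DUn hx, hb x hx]; ring)
  rw [h1.fderiv] at this
  have e : fderiv ℝ U y (fderiv ℝ ν y q) = 0 := by
    rw [h.DUv hy, real_inner_comm, h.nunu hy hq]; simp
  simp [h.DUn hy, e] at this
  linarith

lemma lapfr (h : Tor Ω ν U) {y : EE (m+1)} (hy : y ∈ frontier Ω) : lap U y = -2 := by
  have hcl : y ∈ closure (interior Ω) := by
    rw [h.conv.closure_interior_eq_closure_of_nonempty_interior h.ne]
    exact subset_closure (h.frsub hy)
  have hc : IsClosed {x | lap U x = -2} := isClosed_eq (lap_continuous h.hU) continuous_const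
  exact hc.closure_subset_iff.2 (fun x hx => h.lU x hx) hcl

lemma tproj_perp (h : Tor Ω ν U) {y : EE (m+1)} (hy : y ∈ frontier Ω) (v) : ⟪tproj ν y v, ν y⟫_ℝ = 0 := by
  unfold tproj
  rw [inner_sub_left, inner_smul_left, real_inner_self_eq_norm_sq, h.unit y hy]; simp

lemma Unn (h : Tor Ω ν U) {y : EE (m+1)} (hy : y ∈ frontier Ω) :
    fderiv ℝ (fderiv ℝ U) y (ν y) (ν y) = -2 + ‖gradient U y‖ * trII ν y := by
  have hl := h.lapfr hy
  rw [lap_eq h.hU] at hl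
  set H := fderiv ℝ (fderiv ℝ U) y with hH
  set P : Fin (m+1) → EE (m+1) := fun i => tproj ν y (EuclideanSpace.single i 1) with hP
  have hPe : ∀ i, EuclideanSpace.single i (1:ℝ) = P i + (ν y i) • ν y := by
    intro i
    simp only [hP, tproj]
    simp [EuclideanSpace.inner_single_left]
  have h1 : ∀ i, H (EuclideanSpace.single i (1:ℝ)) (EuclideanSpace.single i (1:ℝ)) =
      - (‖gradient U y‖ * ⟪fderiv ℝ ν y (P i), P i⟫_ℝ) + 2 * (H (ν y i • P i) (ν y)) + (ν y i) ^ 2 * H (ν y) (ν y) := by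
    intro i
    have hs : H (P i) (P i) = _ := h.second hy (h.tproj_perp hy _) (h.tproj_perp hy _)
    rw [← hs, hPe i]
    simp only [map_add, map_smul, add_apply, smul_apply, smul_eq_mul]
    rw [h.sym y (ν y) (P i), ← hH]; ring
  rw [Finset.sum_congr rfl fun i _ => h1 i, Finset.sum_add_distrib, Finset.sum_add_distrib, Finset.sum_neg_distrib,
    ← Finset.mul_sum, ← Finset.mul_sum, ← Finset.sum_mul] at hl
  have hn : ∑ i, ν y i ^ 2 = 1 := by
    have := EuclideanSpace.real_norm_sq_eq (ν y)
    rw [h.unit y hy] at this; linarith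
  have hz : ∑ i, ν y i • P i = 0 := by
    have e1 : ∀ i, ν y i • P i = ν y i • EuclideanSpace.single i (1:ℝ) - (ν y i ^ 2) • ν y := by
      intro i
      rw [hPe i]; module
    rw [Finset.sum_congr rfl fun i _ => e1 i, Finset.sum_sub_distrib, ← Finset.sum_smul, hn, one_smul]
    have := (EuclideanSpace.basisFun (Fin (m+1)) ℝ).sum_repr (ν y)
    simp only [EuclideanSpace.basisFun_repr, EuclideanSpace.basisFun_apply] at this
    rw [this, sub_self]
  have hz2 : ∑ i, H (ν y i • P i) (ν y) = 0 := by
    have : H (∑ i, ν y i • P i) (ν y) = 0 := by rw [hz]; simp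
    rw [map_sum] at this
    simpa using this
  rw [hz2, hn] at hl
  have : trII ν y = ∑ i, ⟪fderiv ℝ ν y (P i), P i⟫_ℝ := rfl
  rw [this]; linarith

end Tor


/-- all hypotheses -/
structure Hyp {m : ℕ} (Ω : Set (EE (m+1))) (ν : EE (m+1) → EE (m+1)) (U ψ w : EE (m+1) → ℝ)
    (S : EE (m+1) → EE (m+1) →L[ℝ] EE (m+1)) : Prop extends Tor Ω ν U where
  pos : ∀ x ∈ frontier Ω, ∀ v, ⟪v, ν x⟫_ℝ = 0 → v ≠ 0 → 0 < ⟪fderiv ℝ ν x v, v⟫_ℝ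
  hψ : ContDiff ℝ 1 ψ
  hw : ContDiff ℝ 2 w
  lw : ∀ x ∈ interior Ω, lap w x = 0
  wb : ∀ x ∈ frontier Ω, w x = ‖gradient U x‖ * ψ x
  St : ∀ x ∈ frontier Ω, ∀ v, ⟪S x v, ν x⟫_ℝ = 0
  SI : ∀ x ∈ frontier Ω, ∀ v, ⟪v, ν x⟫_ℝ = 0 → fderiv ℝ ν x (S x v) = v

namespace Hyp
variable {m : ℕ} {Ω : Set (EE (m+1))} {ν : EE (m+1) → EE (m+1)} {U ψ w : EE (m+1) → ℝ}
  {S : EE (m+1) → EE (m+1) →L[ℝ] EE (m+1)}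

lemma tgrad_inner (_h : Hyp Ω ν U ψ w S) {y q : EE (m+1)} (_hy : y ∈ frontier Ω) (hq : ⟪q, ν y⟫_ℝ = 0) :
    ⟪tgrad ν ψ y, q⟫_ℝ = fderiv ℝ ψ y q := by
  rw [← grad_inner, tgrad, tproj, inner_sub_left, inner_smul_left, real_inner_comm q (ν y), hq]; simp

lemma dsym (h : Hyp Ω ν U ψ w S) {y p q : EE (m+1)} (hy : y ∈ frontier Ω) (hp : ⟪p, ν y⟫_ℝ = 0) (hq : ⟪q, ν y⟫_ℝ = 0) :
    ⟪fderiv ℝ ν y p, q⟫_ℝ = ⟪fderiv ℝ ν y q, p⟫_ℝ := by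
  have h1 := h.second hy hp hq
  have h2 := h.second hy hq hp
  rw [h.sym, h2] at h1
  have := h.gpos hy
  have h3 : ‖gradient U y‖ * ⟪fderiv ℝ ν y p, q⟫_ℝ = ‖gradient U y‖ * ⟪fderiv ℝ ν y q, p⟫_ℝ := by linarith
  exact mul_left_cancel₀ this.ne' h3

lemma young (h : Hyp Ω ν U ψ w S) {y q t : EE (m+1)} (hy : y ∈ frontier Ω) (ht : ⟪t, ν y⟫_ℝ = 0) (hq : ⟪q, ν y⟫_ℝ = 0) :
    2 * ⟪t, q⟫_ℝ - ⟪fderiv ℝ ν y q, q⟫_ℝ ≤ ⟪S y t, t⟫_ℝ := by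
  have hs := h.St y hy t
  have hi := h.SI y hy t ht
  have he : ⟪q - S y t, ν y⟫_ℝ = 0 := by rw [inner_sub_left, hq, hs, sub_zero]
  have h0 : 0 ≤ ⟪fderiv ℝ ν y (q - S y t), q - S y t⟫_ℝ := by
    by_cases hz : q - S y t = 0
    · rw [hz]; simp
    · exact (h.pos y hy _ he hz).le
  rw [map_sub, hi, inner_sub_left, inner_sub_right, inner_sub_right, h.dsym hy hq hs, hi, real_inner_comm (S y t) t] at h0
  linarith

/-- the function b on the boundary -/
noncomputable def b0 (_h : Hyp Ω ν U ψ w S) (y : EE (m+1)) : ℝ :=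
  2 * ψ y ^ 2 - ‖gradient U y‖ * trII ν y * ψ y ^ 2 - 2 * ψ y * ⟪gradient w y, ν y⟫_ℝ
    - ‖gradient U y‖ * ⟪S y (tgrad ν ψ y), tgrad ν ψ y⟫_ℝ

lemma alg (h : Hyp Ω ν U ψ w S) {y p : EE (m+1)} (hy : y ∈ frontier Ω) (hp : fderiv ℝ U y p = - w y) :
    fderiv ℝ (fderiv ℝ U) y p p + 2 * fderiv ℝ w y p ≤ - h.b0 y := by
  have hg := h.gpos hy
  rw [h.DUv hy, h.wb y hy, neg_inj] at hp
  have hpn : ⟪ν y, p⟫_ℝ = ψ y := mul_left_cancel₀ hg.ne' hp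
  obtain ⟨q, hq⟩ : ∃ q, q = p - ψ y • ν y := ⟨_, rfl⟩
  have hqn : ⟪q, ν y⟫_ℝ = 0 := by
    rw [hq, inner_sub_left, inner_smul_left, real_inner_self_eq_norm_sq, h.unit y hy, real_inner_comm, hpn]; simp
  have hpq : p = q + ψ y • ν y := by rw [hq]; abel
  have htn : ⟪tgrad ν ψ y, ν y⟫_ℝ = 0 := h.tproj_perp hy _
  have hyo := h.young hy htn hqn
  have hwt := h.wtan hy hqn ((h.hw.differentiable (by norm_num)) y) ((h.hψ.differentiable (by norm_num)) y) h.wb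
  rw [← h.tgrad_inner hy hqn] at hwt
  have h2 := h.second hy hqn hqn
  have h3 := h.Unn hy
  rw [hpq]
  simp only [map_add, map_smul, add_apply, smul_apply, smul_eq_mul]
  rw [h.sym y (ν y) q, hwt, h2, h3, ← grad_inner, b0]
  have := mul_le_mul_of_nonneg_left hyo hg.le
  nlinarith

lemma str (h : Hyp Ω ν U ψ w S) {y u : EE (m+1)} (hy : y ∈ frontier Ω) (hu : fderiv ℝ U y u = 0) (hu0 : u ≠ 0) :
    fderiv ℝ (fderiv ℝ U) y u u < 0 := by
  have hg := h.gpos hy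
  have hun : ⟪u, ν y⟫_ℝ = 0 := by
    rw [h.DUv hy, neg_eq_zero, mul_eq_zero] at hu
    rw [real_inner_comm]; exact hu.resolve_left hg.ne'
  rw [h.second hy hun hun]
  have := mul_pos hg (h.pos y hy u hun hu0)
  linarith

lemma νc (h : Hyp Ω ν U ψ w S) : ContinuousOn ν (frontier Ω) :=
  fun x hx => (h.diff x hx).continuousAt.continuousWithinAt

lemma gc (h : Hyp Ω ν U ψ w S) : Continuous (gradient U) := grad_cont (h.hU.of_le (by norm_num))

lemma Hc (h : Hyp Ω ν U ψ w S) : Continuous (fderiv ℝ (fderiv ℝ U)) :=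
  (h.hU.fderiv_right (m := 1) (by norm_num)).continuous_fderiv (by norm_num)

lemma trc (h : Hyp Ω ν U ψ w S) : ContinuousOn (trII ν) (frontier Ω) := by
  have hν := h.νc
  have hH := h.Hc
  have hg := h.gc
  have : ContinuousOn (fun y => (fderiv ℝ (fderiv ℝ U) y (ν y) (ν y) + 2) / ‖gradient U y‖) (frontier Ω) := by
    refine ContinuousOn.div ?_ hg.norm.continuousOn (fun y hy => (h.gpos hy).ne')
    exact ((hH.continuousOn.clm_apply hν).clm_apply hν).add continuousOn_const
  refine this.congr fun y hy => ?_
  change _ = (fderiv ℝ (fderiv ℝ U) y (ν y) (ν y) + 2) / ‖gradient U y‖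
  rw [h.Unn hy, eq_div_iff (h.gpos hy).ne']; ring

lemma tgc (h : Hyp Ω ν U ψ w S) : ContinuousOn (tgrad ν ψ) (frontier Ω) := by
  have hν := h.νc
  have hg : ContinuousOn (gradient ψ) (frontier Ω) := (grad_cont h.hψ).continuousOn
  have h1 : ContinuousOn (fun y => ⟪gradient ψ y, ν y⟫_ℝ) (frontier Ω) := ContinuousOn.inner hg hν
  exact hg.sub (h1.smul hν)

/-- auxiliary operator -/
noncomputable def B (_h : Hyp Ω ν U ψ w S) (y : EE (m+1)) : EE (m+1) →L[ℝ] EE (m+1) :=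
  let N : EE (m+1) →L[ℝ] EE (m+1) := (innerSL ℝ (ν y)).smulRight (ν y)
  let P : EE (m+1) →L[ℝ] EE (m+1) := ContinuousLinearMap.id ℝ _ - N
  (-(‖gradient U y‖)⁻¹) • (P ∘L ((InnerProductSpace.toDual ℝ (EE (m+1))).symm.toContinuousLinearEquiv.toContinuousLinearMap ∘L
    fderiv ℝ (fderiv ℝ U) y) ∘L P) + N

lemma Bc (h : Hyp Ω ν U ψ w S) : ContinuousOn h.B (frontier Ω) := by
  have hν := h.νc
  have hH := h.Hc.continuousOn (s := frontier Ω)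
  have hg := h.gc.norm.continuousOn (s := frontier Ω)
  have hN : ContinuousOn (fun y => ((innerSL ℝ (ν y)).smulRight (ν y) : EE (m+1) →L[ℝ] EE (m+1))) (frontier Ω) := by
    have h1 : ContinuousOn (fun y => innerSL ℝ (ν y)) (frontier Ω) := (innerSL ℝ).continuous.comp_continuousOn hν
    have h2 : ContinuousOn (fun y => ContinuousLinearMap.smulRightL ℝ (EE (m+1)) (EE (m+1)) (innerSL ℝ (ν y)) (ν y)) (frontier Ω) :=
      ((ContinuousLinearMap.smulRightL ℝ (EE (m+1)) (EE (m+1))).continuous.comp_continuousOn h1).clm_apply hν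
    exact h2
  have hP := (continuousOn_const (c := ContinuousLinearMap.id ℝ (EE (m+1)))).sub hN
  refine ContinuousOn.add (ContinuousOn.smul (ContinuousOn.neg (hg.inv₀ fun y hy => (h.gpos hy).ne')) ?_) hN
  exact hP.clm_comp ((continuousOn_const.clm_comp hH).clm_comp hP)

lemma Bapply (h : Hyp Ω ν U ψ w S) {y τ : EE (m+1)} (hy : y ∈ frontier Ω) (hτ : ⟪τ, ν y⟫_ℝ = 0) (a : ℝ) :
    h.B y (τ + a • ν y) = fderiv ℝ ν y τ + a • ν y := by
  have hτ' : ⟪ν y, τ⟫_ℝ = 0 := by rw [real_inner_comm]; exact hτ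
  have hg := h.gpos hy
  have e1 : h.B y (τ + a • ν y) = (-(‖gradient U y‖)⁻¹) •
      tproj ν y ((InnerProductSpace.toDual ℝ (EE (m+1))).symm (fderiv ℝ (fderiv ℝ U) y τ)) + a • ν y := by
    have hi : ⟪ν y, τ + a • ν y⟫_ℝ = a := by
      rw [inner_add_right, inner_smul_right, real_inner_self_eq_norm_sq, h.unit y hy, hτ']; simp
    have e2 : h.B y (τ + a • ν y) = (-(‖gradient U y‖)⁻¹) •
      ((InnerProductSpace.toDual ℝ (EE (m+1))).symm (fderiv ℝ (fderiv ℝ U) y (τ + a • ν y - ⟪ν y, τ + a • ν y⟫_ℝ • ν y))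
        - ⟪ν y, (InnerProductSpace.toDual ℝ (EE (m+1))).symm
          (fderiv ℝ (fderiv ℝ U) y (τ + a • ν y - ⟪ν y, τ + a • ν y⟫_ℝ • ν y))⟫_ℝ • ν y)
        + ⟪ν y, τ + a • ν y⟫_ℝ • ν y := rfl
    rw [e2, hi, add_sub_cancel_right, tproj, real_inner_comm (ν y)]
  rw [e1]
  congr 1
  refine ext_inner_right ℝ fun v => ?_
  obtain ⟨u, hu⟩ : ∃ u, u = tproj ν y v := ⟨_, rfl⟩
  have hun : ⟪u, ν y⟫_ℝ = 0 := by rw [hu]; exact h.tproj_perp hy v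
  have hv : v = u + ⟪v, ν y⟫_ℝ • ν y := by rw [hu, tproj]; abel
  rw [hv, inner_add_right, inner_smul_right, inner_add_right, inner_smul_right, h.nunu hy hτ, inner_smul_left,
    inner_smul_left, h.tproj_perp hy]
  rw [tproj, inner_sub_left, inner_smul_left, real_inner_comm u (ν y), hun, InnerProductSpace.toDual_symm_apply, h.second hy hτ hun]
  simp
  field_simp

lemma Bunit (h : Hyp Ω ν U ψ w S) {y : EE (m+1)} (hy : y ∈ frontier Ω) : IsUnit (h.B y) := by
  have hinj : Function.Injective (h.B y) := by
    rw [injective_iff_map_eq_zero]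
    intro v hv
    obtain ⟨u, hu⟩ : ∃ u, u = tproj ν y v := ⟨_, rfl⟩
    have hun : ⟪u, ν y⟫_ℝ = 0 := by rw [hu]; exact h.tproj_perp hy v
    have hve : v = u + ⟪v, ν y⟫_ℝ • ν y := by rw [hu, tproj]; abel
    rw [hve, h.Bapply hy hun] at hv
    have h1 := congrArg (fun z => ⟪z, ν y⟫_ℝ) hv
    simp only [inner_add_left, inner_smul_left, h.nunu hy hun, real_inner_self_eq_norm_sq, h.unit y hy, inner_zero_left] at h1
    have h1' : ⟪v, ν y⟫_ℝ = 0 := by simpa using h1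
    rw [h1', zero_smul, add_zero] at hv hve
    by_contra hv0
    have := h.pos y hy u hun (fun e => hv0 (hve.trans e))
    rw [hv, inner_zero_left] at this
    exact lt_irrefl _ this
  rw [ContinuousLinearMap.isUnit_iff_bijective]
  exact ⟨hinj, LinearMap.injective_iff_surjective (f := (h.B y).toLinearMap) |>.1 hinj⟩

lemma Stc (h : Hyp Ω ν U ψ w S) : ContinuousOn (fun y => S y (tgrad ν ψ y)) (frontier Ω) := by
  have hc : ContinuousOn (fun y => Ring.inverse (h.B y)) (frontier Ω) := by
    intro y hy
    obtain ⟨u, hu⟩ := h.Bunit hy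
    have h1 := NormedRing.inverse_continuousAt u
    rw [hu] at h1
    exact h1.comp_continuousWithinAt (h.Bc y hy)
  refine (hc.clm_apply h.tgc).congr fun y hy => ?_
  have htn : ⟪tgrad ν ψ y, ν y⟫_ℝ = 0 := h.tproj_perp hy _
  have h1 := h.Bapply hy (h.St y hy (tgrad ν ψ y)) 0
  rw [h.SI y hy _ htn] at h1
  simp only [zero_smul, add_zero] at h1
  have h2 := Ring.inverse_mul_cancel _ (h.Bunit hy)
  have h3 := congrArg (fun A : EE (m+1) →L[ℝ] EE (m+1) => A (S y (tgrad ν ψ y))) h2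
  change Ring.inverse (h.B y) (h.B y (S y (tgrad ν ψ y))) = S y (tgrad ν ψ y) at h3
  change _ = Ring.inverse (h.B y) (tgrad ν ψ y)
  rw [h1] at h3
  exact h3.symm

lemma qc (h : Hyp Ω ν U ψ w S) : ContinuousOn (fun y => ⟪S y (tgrad ν ψ y), tgrad ν ψ y⟫_ℝ) (frontier Ω) :=
  h.Stc.inner h.tgc

lemma wnc (h : Hyp Ω ν U ψ w S) : ContinuousOn (fun y => ⟪gradient w y, ν y⟫_ℝ) (frontier Ω) :=
  ContinuousOn.inner (grad_cont (h.hw.of_le (by norm_num))).continuousOn h.νc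

lemma bc (h : Hyp Ω ν U ψ w S) : ContinuousOn h.b0 (frontier Ω) := by
  have h1 := h.qc
  have h2 := h.trc
  have h3 := h.wnc
  have h4 := h.gc.norm.continuousOn (s := frontier Ω)
  have h5 := h.hψ.continuous.continuousOn (s := frontier Ω)
  unfold b0
  exact (((continuousOn_const.mul (h5.pow 2)).sub ((h4.mul h2).mul (h5.pow 2))).sub ((continuousOn_const.mul h5).mul h3)).sub
    (h4.mul h1)

theorem concl (h : Hyp Ω ν U ψ w S)
    (horth : ∫ x in frontier Ω, ψ x * ‖gradient U x‖ ^ 2 ∂μH[(m:ℝ)] = 0) :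
    -(∫ x in frontier Ω, trII ν x * ψ x ^ 2 * ‖gradient U x‖ ^ 2 ∂μH[(m:ℝ)]) -
        2 * (∫ x in frontier Ω, ψ x * ⟪gradient w x, ν x⟫_ℝ * ‖gradient U x‖ ∂μH[(m:ℝ)]) +
        4 * (∫ x in frontier Ω, ψ x ^ 2 * ‖gradient U x‖ ∂μH[(m:ℝ)]) ≤
      ∫ x in frontier Ω, ⟪S x (tgrad ν ψ x), tgrad ν ψ x⟫_ℝ * ‖gradient U x‖ ^ 2 ∂μH[(m:ℝ)] := by
  have h1 := h.qc
  have h2 := h.trc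
  have h3 := h.wnc
  have h4 := h.gc.norm.continuousOn (s := frontier Ω)
  have h5 := h.hψ.continuous.continuousOn (s := frontier Ω)
  have hms : MeasurableSet (frontier Ω) := isClosed_frontier.measurableSet
  obtain ⟨b, hb⟩ := ContinuousMap.exists_restrict_eq isClosed_frontier ⟨_, h.bc.domRestrict⟩
  have hbe : ∀ x ∈ frontier Ω, b x = h.b0 x := fun x hx => by
    have := congrArg (fun f => f ⟨x, hx⟩) hb
    simpa using this
  have core : Core Ω U w b :=
    { dom := h.dom
      hw := h.hw
      hb := b.continuous
      lU := h.lU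
      lw := h.lw
      alg := fun y hy p hp => by rw [hbe y hy]; exact h.alg hy hp
      str := fun y hy u hu hu0 => h.str hy hu hu0
      orth := by
        rw [← horth]
        refine setIntegral_congr_fun hms fun x hx => ?_
        simp only [h.wb x hx]; ring }
  have hc := core.concl
  have i1 := h.dom.frint ((h2.mul (h5.pow 2)).mul (h4.pow 2))
  have i2 := h.dom.frint ((h5.mul h3).mul h4)
  have i3 := h.dom.frint ((h5.pow 2).mul h4)
  have i4 := h.dom.frint (h1.mul (h4.pow 2))
  have e : ∫ x in frontier Ω, (b x * ‖gradient U x‖ + 2 * (w x ^ 2 / ‖gradient U x‖)) ∂μH[(m:ℝ)] =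
      ∫ x in frontier Ω, (-(trII ν x * ψ x ^ 2 * ‖gradient U x‖ ^ 2) - 2 * (ψ x * ⟪gradient w x, ν x⟫_ℝ * ‖gradient U x‖)
        + 4 * (ψ x ^ 2 * ‖gradient U x‖) - ⟪S x (tgrad ν ψ x), tgrad ν ψ x⟫_ℝ * ‖gradient U x‖ ^ 2) ∂μH[(m:ℝ)] := by
    refine setIntegral_congr_fun hms fun x hx => ?_
    have hg := h.gpos hx
    simp only [hbe x hx, h.wb x hx, b0]
    have : (‖gradient U x‖ * ψ x) ^ 2 / ‖gradient U x‖ = ‖gradient U x‖ * ψ x ^ 2 := by field_simp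
    rw [this]; ring
  rw [e, integral_sub, integral_add, integral_sub, integral_neg, integral_const_mul, integral_const_mul] at hc
  · linarith
  · exact i1.neg
  · exact i2.const_mul 2
  · exact i1.neg.sub (i2.const_mul 2)
  · exact i3.const_mul 4
  · exact (i1.neg.sub (i2.const_mul 2)).add (i3.const_mul 4)
  · exact i4

end Hyp

theorem final (n : ℕ) (Ω : Set (EuclideanSpace ℝ (Fin n)))
    (hΩc : IsCompact Ω) (hΩconv : Convex ℝ Ω) (hΩint : (interior Ω).Nonempty)
    (ν : EuclideanSpace ℝ (Fin n) → EuclideanSpace ℝ (Fin n))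
    (hν : ∀ x ∈ frontier Ω, ‖ν x‖ = 1 ∧ ∀ y ∈ Ω, ⟪y - x, ν x⟫_ℝ ≤ 0)
    (hν2 : ∀ x ∈ frontier Ω, DifferentiableAt ℝ ν x ∧
      ∀ w, ⟪w, ν x⟫_ℝ = 0 → w ≠ 0 → 0 < ⟪fderiv ℝ ν x w, w⟫_ℝ)
    (U : EuclideanSpace ℝ (Fin n) → ℝ)
    (hUsm : ContDiff ℝ 2 U)
    (hlap : ∀ x ∈ interior Ω, lap U x = -2)
    (hbd : ∀ x ∈ frontier Ω, U x = 0)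
    (ψ : EuclideanSpace ℝ (Fin n) → ℝ) (hψ : ContDiff ℝ 1 ψ)
    (Udot : EuclideanSpace ℝ (Fin n) → ℝ) (hUdsm : ContDiff ℝ 2 Udot)
    (hUdharm : ∀ x ∈ interior Ω, lap Udot x = 0)
    (hUdbd : ∀ x ∈ frontier Ω, Udot x = ‖gradient U x‖ * ψ x)
    (S : EuclideanSpace ℝ (Fin n) →
      EuclideanSpace ℝ (Fin n) →L[ℝ] EuclideanSpace ℝ (Fin n))
    (hS : ∀ x ∈ frontier Ω, (∀ v, ⟪S x v, ν x⟫_ℝ = 0) ∧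
      ∀ v, ⟪v, ν x⟫_ℝ = 0 → fderiv ℝ ν x (S x v) = v ∧ S x (fderiv ℝ ν x v) = v)
    (horth : ∫ x in frontier Ω, ψ x * ‖gradient U x‖ ^ 2 ∂μH[(n : ℝ) - 1] = 0) :
    -(∫ x in frontier Ω, trII ν x * ψ x ^ 2 * ‖gradient U x‖ ^ 2 ∂μH[(n : ℝ) - 1]) -
        2 * (∫ x in frontier Ω,
          ψ x * ⟪gradient Udot x, ν x⟫_ℝ * ‖gradient U x‖ ∂μH[(n : ℝ) - 1]) +
        4 * (∫ x in frontier Ω, ψ x ^ 2 * ‖gradient U x‖ ∂μH[(n : ℝ) - 1]) ≤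
      ∫ x in frontier Ω,
        ⟪S x (tgrad ν ψ x), tgrad ν ψ x⟫_ℝ * ‖gradient U x‖ ^ 2 ∂μH[(n : ℝ) - 1] := by
  rcases n with _ | m
  · obtain ⟨o, ho⟩ := hΩint
    have : Ω = Set.univ := Set.eq_univ_of_forall fun x => by
      rw [Subsingleton.elim x o]; exact interior_subset ho
    rw [this]
    simp
  · have e : ((m + 1 : ℕ) : ℝ) - 1 = (m : ℝ) := by push_cast; ring
    rw [e] at horth ⊢
    have H : Hyp Ω ν U ψ Udot S :=
      { cpt := hΩc
        conv := hΩconv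
        ne := hΩint
        unit := fun x hx => (hν x hx).1
        supp := fun x hx => (hν x hx).2
        diff := fun x hx => (hν2 x hx).1
        hU := hUsm
        lU := hlap
        zero := hbd
        pos := fun x hx => (hν2 x hx).2
        hψ := hψ
        hw := hUdsm
        lw := hUdharm
        wb := hUdbd
        St := fun x hx => (hS x hx).1
        SI := fun x hx v hv => ((hS x hx).2 v hv).1 }
    exact H.concl horth

end Aux

/-- **Generalized Poincaré-type inequality for torsional rigidity** (Theorem 1.1). Let `Ω`
be a convex body of class `C²₊` in `ℝⁿ`, `U` its torsion function, `ψ ∈ C¹(∂Ω)`, and `U̇`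
harmonic in `Ω` with boundary values `|∇U|ψ`. If `∫_{∂Ω} ψ |∇U|² dH^{n-1} = 0`, then
`-∫ tr(II) ψ² |∇U|² - 2 ∫ ψ (∇U̇·ν)|∇U| + 4 ∫ ψ² |∇U| ≤ ∫ (II⁻¹ ∇_{∂Ω}ψ · ∇_{∂Ω}ψ)|∇U|²`,
where `S x` realizes the inverse `II⁻¹` of the Weingarten map on the tangent space. -/
theorem stmt_15 (n : ℕ) (Ω : Set (EuclideanSpace ℝ (Fin n)))
    (hΩc : IsCompact Ω) (hΩconv : Convex ℝ Ω) (hΩint : (interior Ω).Nonempty)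
    (ν : EuclideanSpace ℝ (Fin n) → EuclideanSpace ℝ (Fin n))
    -- `ν` is the outer unit normal (Gauss map) of `∂Ω`:
    (hν : ∀ x ∈ frontier Ω, ‖ν x‖ = 1 ∧ ∀ y ∈ Ω, ⟪y - x, ν x⟫_ℝ ≤ 0)
    -- `Ω` of class `C²₊`: `ν` is differentiable with positive-definite second fundamental form:
    (hν2 : ∀ x ∈ frontier Ω, DifferentiableAt ℝ ν x ∧
      ∀ w, ⟪w, ν x⟫_ℝ = 0 → w ≠ 0 → 0 < ⟪fderiv ℝ ν x w, w⟫_ℝ)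
    (U : EuclideanSpace ℝ (Fin n) → ℝ)
    -- `U` is the torsion function of `Ω`:
    (hUsm : ContDiff ℝ 2 U)
    (hlap : ∀ x ∈ interior Ω, lap U x = -2)
    (hbd : ∀ x ∈ frontier Ω, U x = 0)
    -- `ψ ∈ C¹(∂Ω)`:
    (ψ : EuclideanSpace ℝ (Fin n) → ℝ) (hψ : ContDiff ℝ 1 ψ)
    -- `U̇` is harmonic in `Ω` with boundary values `|∇U| ψ`:
    (Udot : EuclideanSpace ℝ (Fin n) → ℝ) (hUdsm : ContDiff ℝ 2 Udot)
    (hUdharm : ∀ x ∈ interior Ω, lap Udot x = 0)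
    (hUdbd : ∀ x ∈ frontier Ω, Udot x = ‖gradient U x‖ * ψ x)
    -- `S x` is the inverse `II⁻¹` of the Weingarten map on the tangent space at `x ∈ ∂Ω`:
    (S : EuclideanSpace ℝ (Fin n) →
      EuclideanSpace ℝ (Fin n) →L[ℝ] EuclideanSpace ℝ (Fin n))
    (hS : ∀ x ∈ frontier Ω, (∀ v, ⟪S x v, ν x⟫_ℝ = 0) ∧
      ∀ v, ⟪v, ν x⟫_ℝ = 0 → fderiv ℝ ν x (S x v) = v ∧ S x (fderiv ℝ ν x v) = v)
    -- the orthogonality condition `∫_{∂Ω} ψ |∇U|² dH^{n-1} = 0`: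
    (horth : ∫ x in frontier Ω, ψ x * ‖gradient U x‖ ^ 2 ∂μH[(n : ℝ) - 1] = 0) :
    -(∫ x in frontier Ω, trII ν x * ψ x ^ 2 * ‖gradient U x‖ ^ 2 ∂μH[(n : ℝ) - 1]) -
        2 * (∫ x in frontier Ω,
          ψ x * ⟪gradient Udot x, ν x⟫_ℝ * ‖gradient U x‖ ∂μH[(n : ℝ) - 1]) +
        4 * (∫ x in frontier Ω, ψ x ^ 2 * ‖gradient U x‖ ∂μH[(n : ℝ) - 1]) ≤
      ∫ x in frontier Ω,
        ⟪S x (tgrad ν ψ x), tgrad ν ψ x⟫_ℝ * ‖gradient U x‖ ^ 2 ∂μH[(n : ℝ) - 1] := by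
  exact final n Ω hΩc hΩconv hΩint ν hν hν2 U hUsm hlap hbd ψ hψ Udot hUdsm hUdharm hUdbd S hS horth
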